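/- Let P be a simple polygon with n ≥ 3 vertices. Between any two points s and t of the interior of P there exists a diffuse reflection path in P from s to t with at most ⌊n/2⌋ − 1 reflections. -/

import Mathlib

open Set

/-- The plane ℝ². -/
abbrev Plane := EuclideanSpace ℝ (Fin 2)

/-- The `i`-th edge of a polygon with vertices `v 0, …, v (n-1)`:
the segment from `v i` to `v ((i+1) % n)`. -/
def polyEdge (n : ℕ) (v : ℕ → Plane) (i : ℕ) : Set Plane :=
  segment ℝ (v i) (v ((i + 1) % n))

/-- `P` is a simple polygon with vertices `v 0, …, v (n-1)`: a compact set with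
nonempty connected interior whose frontier is the union of the `n` edges; the
vertices are pairwise distinct, consecutive edges meet exactly in their common
vertex, and non-consecutive edges are disjoint. -/
def IsSimplePolygon (n : ℕ) (P : Set Plane) (v : ℕ → Plane) : Prop :=
  IsCompact P ∧ IsConnected (interior P) ∧
  (∀ i < n, ∀ j < n, v i = v j → i = j) ∧
  (frontier P = ⋃ i ∈ Finset.range n, polyEdge n v i) ∧
  (∀ i < n, ∀ j < n, i ≠ j →
    (j = (i + 1) % n → polyEdge n v i ∩ polyEdge n v j = {v j}) ∧
    (i = (j + 1) % n → polyEdge n v i ∩ polyEdge n v j = {v i}) ∧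
    (j ≠ (i + 1) % n → i ≠ (j + 1) % n →
      Disjoint (polyEdge n v i) (polyEdge n v j)))

/-- A diffuse reflection path in `P` from `s` to `t` with `m` segments
(`m - 1` reflections), given by the points `p 0 = s, p 1, …, p m = t`:
all points lie in `P`, every intermediate point lies in the relative interior
(open segment) of some edge of `P`, and the relative interior of each segment
of the path lies in the interior of `P`. -/
def IsDiffusePath (n : ℕ) (P : Set Plane) (v : ℕ → Plane)
    (s t : Plane) (m : ℕ) (p : ℕ → Plane) : Prop :=
  p 0 = s ∧ p m = t ∧ (∀ i ≤ m, p i ∈ P) ∧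
  (∀ i, 0 < i → i < m → ∃ j < n, p i ∈ openSegment ℝ (v j) (v ((j + 1) % n))) ∧
  (∀ i < m, openSegment ℝ (p i) (p (i + 1)) ⊆ interior P)

/-- `Vis n P v s k` is `V_k(s)`: the set of points `t ∈ P` reachable from `s`
by a diffuse reflection path with at most `k` reflections. -/
def Vis (n : ℕ) (P : Set Plane) (v : ℕ → Plane) (s : Plane) (k : ℕ) : Set Plane :=
  {t | t ∈ P ∧ ∃ m, m - 1 ≤ k ∧ ∃ p : ℕ → Plane, IsDiffusePath n P v s t m p}

open Topology Filter

/-- The point at parameter `t` on the line from `x` to `y`. -/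
def pt (x y : Plane) (t : ℝ) : Plane := x + t • (y - x)

theorem pt_zero (x y : Plane) : pt x y 0 = x := by simp [pt]

theorem pt_one (x y : Plane) : pt x y 1 = y := by simp [pt]

theorem pt_apply (x y : Plane) (t : ℝ) (i : Fin 2) : pt x y t i = x i + t * (y i - x i) := by
  simp [pt]

theorem plane_ext {x y : Plane} (h0 : x 0 = y 0) (h1 : x 1 = y 1) : x = y := by
  ext i; fin_cases i <;> assumption

theorem mem_segment_iff_pt {x y p : Plane} :
    p ∈ segment ℝ x y ↔ ∃ t : ℝ, 0 ≤ t ∧ t ≤ 1 ∧ p = pt x y t := by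
  rw [segment_eq_image']
  constructor
  · rintro ⟨t, ht, rfl⟩; exact ⟨t, ht.1, ht.2, rfl⟩
  · rintro ⟨t, h0, h1, rfl⟩; exact ⟨t, ⟨h0, h1⟩, rfl⟩

theorem mem_openSegment_iff_pt {x y p : Plane} :
    p ∈ openSegment ℝ x y ↔ ∃ t : ℝ, 0 < t ∧ t < 1 ∧ p = pt x y t := by
  rw [openSegment_eq_image']
  constructor
  · rintro ⟨t, ht, rfl⟩; exact ⟨t, ht.1, ht.2, rfl⟩
  · rintro ⟨t, h0, h1, rfl⟩; exact ⟨t, ⟨h0, h1⟩, rfl⟩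

theorem pt_mem_segment {x y : Plane} {t : ℝ} (h0 : 0 ≤ t) (h1 : t ≤ 1) :
    pt x y t ∈ segment ℝ x y := mem_segment_iff_pt.2 ⟨t, h0, h1, rfl⟩

theorem pt_mem_openSegment {x y : Plane} {t : ℝ} (h0 : 0 < t) (h1 : t < 1) :
    pt x y t ∈ openSegment ℝ x y := mem_openSegment_iff_pt.2 ⟨t, h0, h1, rfl⟩

theorem pt_pt_right (x y : Plane) (s t : ℝ) : pt x (pt x y s) t = pt x y (t * s) := by
  apply plane_ext <;> simp only [pt_apply] <;> ring

theorem pt_pt (x y : Plane) (s t u : ℝ) :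
    pt (pt x y s) (pt x y t) u = pt x y (s + u * (t - s)) := by
  apply plane_ext <;> simp only [pt_apply] <;> ring

theorem pt_symm (x y : Plane) (t : ℝ) : pt x y t = pt y x (1 - t) := by
  apply plane_ext <;> simp only [pt_apply] <;> ring

theorem continuous_pt (x y : Plane) : Continuous (pt x y) := by
  unfold pt; fun_prop

theorem pt_injective {x y : Plane} (h : x ≠ y) {s t : ℝ} (he : pt x y s = pt x y t) : s = t := by
  unfold pt at he
  have h1 : (s - t) • (y - x) = 0 := by
    rw [sub_smul]; exact sub_eq_zero.2 (add_left_cancel he)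
  rcases smul_eq_zero.1 h1 with h2 | h2
  · linarith
  · exact absurd (sub_eq_zero.1 h2).symm h

/-- Real valued affine functions on the plane. -/
def IsAff (h : Plane → ℝ) : Prop := ∃ p q c : ℝ, ∀ x, h x = p * x 0 + q * x 1 + c

namespace IsAff
variable {h k : Plane → ℝ}

theorem pt (hh : IsAff h) (x y : Plane) (t : ℝ) : h (pt x y t) = h x + t * (h y - h x) := by
  obtain ⟨p, q, c, e⟩ := hh
  simp only [e, pt_apply]; ring

theorem continuous (hh : IsAff h) : Continuous h := by
  obtain ⟨p, q, c, e⟩ := hh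
  rw [show h = fun x => p * x 0 + q * x 1 + c from funext e]
  fun_prop

theorem lin (hh : IsAff h) (hk : IsAff k) (a b c : ℝ) : IsAff fun x => a * h x + b * k x + c := by
  obtain ⟨p, q, r, e⟩ := hh
  obtain ⟨p', q', r', e'⟩ := hk
  exact ⟨a * p + b * p', a * q + b * q', a * r + b * r' + c, fun x => by simp only [e, e']; ring⟩

theorem isOpen_pos (hh : IsAff h) : IsOpen {x | 0 < h x} := isOpen_lt continuous_const hh.continuous

theorem convexComb (hh : IsAff h) {x y : Plane} {a b : ℝ} (hab : a + b = 1) :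
    h (a • x + b • y) = a * h x + b * h y := by
  obtain ⟨p, q, c, e⟩ := hh
  simp only [e, PiLp.add_apply, PiLp.smul_apply, smul_eq_mul]
  linear_combination (-c) * hab

theorem convex_pos (hh : IsAff h) : Convex ℝ {x | 0 < h x} := by
  intro x hx y hy a b ha hb hab
  simp only [mem_ofPred_eq] at *
  rw [hh.convexComb hab]
  rcases ha.eq_or_lt with rfl | ha
  · simp at hab; subst hab; simpa using hy
  · nlinarith [mul_pos ha hx, mul_nonneg hb hy.le]

theorem convex_nonneg (hh : IsAff h) : Convex ℝ {x | 0 ≤ h x} := by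
  intro x hx y hy a b ha hb hab
  simp only [mem_ofPred_eq] at *
  rw [hh.convexComb hab]
  positivity

theorem neg (hh : IsAff h) : IsAff fun x => - h x := by
  obtain ⟨p, q, c, e⟩ := hh
  exact ⟨-p, -q, -c, fun x => by simp only [e]; ring⟩

theorem eq_of_collinear (hh : IsAff h) {x y : Plane} {t : ℝ} (hx : h x = 0) (hy : h y = 0) :
    h (_root_.pt x y t) = 0 := by rw [hh.pt, hx, hy]; ring

end IsAff

/-- Twice the signed area of the triangle `p q x`. -/
def dt (p q x : Plane) : ℝ := (q 0 - p 0) * (x 1 - p 1) - (q 1 - p 1) * (x 0 - p 0)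

theorem isAff_dt (p q : Plane) : IsAff (dt p q) :=
  ⟨-(q 1 - p 1), q 0 - p 0, (q 1 - p 1) * p 0 - (q 0 - p 0) * p 1, fun x => by unfold dt; ring⟩

theorem dt_self_left (p q : Plane) : dt p q p = 0 := by unfold dt; ring

theorem dt_self_right (p q : Plane) : dt p q q = 0 := by unfold dt; ring

theorem exists_pt_of_dt_eq_zero {p q x : Plane} (hpq : p ≠ q) (h : dt p q x = 0) :
    ∃ t, x = pt p q t := by
  unfold dt at h
  by_cases h0 : q 0 - p 0 = 0
  · have h1 : q 1 - p 1 ≠ 0 := by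
      intro h1; exact hpq (plane_ext (by linarith) (by linarith))
    refine ⟨(x 1 - p 1) / (q 1 - p 1), plane_ext ?_ ?_⟩
    · rw [pt_apply, h0]
      have : (q 1 - p 1) * (x 0 - p 0) = 0 := by rw [h0] at h; linarith
      rcases mul_eq_zero.1 this with h2 | h2
      · exact absurd h2 h1
      · linarith
    · rw [pt_apply]; field_simp; ring
  · refine ⟨(x 0 - p 0) / (q 0 - p 0), plane_ext ?_ ?_⟩
    · rw [pt_apply]; field_simp; ring
    · rw [pt_apply]; field_simp; linarith

theorem dt_ne_zero_of_isAff {h : Plane → ℝ} (hh : IsAff h) {p q x : Plane} (hpq : p ≠ q)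
    (hp : h p = 0) (hq : h q = 0) (hx : h x ≠ 0) : dt p q x ≠ 0 := by
  intro h0
  obtain ⟨t, rfl⟩ := exists_pt_of_dt_eq_zero hpq h0
  exact hx (hh.eq_of_collinear hp hq)

/-- An affine function vanishing at two points and nonzero at a third one vanishes only on the
line through these points. -/
theorem IsAff.exists_pt {h : Plane → ℝ} (hh : IsAff h) {p q x y : Plane} (hpq : p ≠ q)
    (hp : h p = 0) (hq : h q = 0) (hx : h x ≠ 0) (hy : h y = 0) :
    ∃ t, y = _root_.pt p q t := by
  have hD := dt_ne_zero_of_isAff hh hpq hp hq hx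
  obtain ⟨a, b, c, e⟩ := hh
  refine exists_pt_of_dt_eq_zero hpq ?_
  simp only [e] at *
  unfold dt at *
  by_contra hne
  apply hx
  have e1 : a * (q 0 - p 0) + b * (q 1 - p 1) = 0 := by linarith
  have e2 : a * (y 0 - p 0) + b * (y 1 - p 1) = 0 := by linarith
  have hb : b * ((q 0 - p 0) * (y 1 - p 1) - (q 1 - p 1) * (y 0 - p 0)) = 0 := by
    linear_combination (q 0 - p 0) * e2 - (y 0 - p 0) * e1
  have ha : a * ((q 0 - p 0) * (y 1 - p 1) - (q 1 - p 1) * (y 0 - p 0)) = 0 := by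
    linear_combination (y 1 - p 1) * e1 - (q 1 - p 1) * e2
  have hb' := (mul_eq_zero.1 hb).resolve_right hne
  have ha' := (mul_eq_zero.1 ha).resolve_right hne
  subst hb' ha'
  linarith

/-- Affine coordinates with respect to a nondegenerate triangle. -/
theorem exists_frame {o p q : Plane} (hD : dt o p q ≠ 0) :
    ∃ A B : Plane → ℝ, IsAff A ∧ IsAff B ∧ A o = 0 ∧ A p = 1 ∧ A q = 0 ∧ B o = 0 ∧ B p = 0 ∧
      B q = 1 ∧ ∀ x y, A x = A y → B x = B y → x = y := by
  have hA : IsAff fun x => - (dt o q x / dt o p q) := by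
    obtain ⟨a, b, c, e⟩ := isAff_dt o q
    exact ⟨-a / dt o p q, -b / dt o p q, -c / dt o p q, fun x => by
      show -(dt o q x / dt o p q) = _
      rw [e x]; ring⟩
  have hB : IsAff fun x => dt o p x / dt o p q := by
    obtain ⟨a, b, c, e⟩ := isAff_dt o p
    exact ⟨a / dt o p q, b / dt o p q, c / dt o p q, fun x => by
      show dt o p x / dt o p q = _
      rw [e x]; ring⟩
  refine ⟨_, _, hA, hB, ?_, ?_, ?_, ?_, ?_, ?_, ?_⟩
  · simp [dt_self_left]
  · have : dt o q p = - dt o p q := by unfold dt; ring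
    simp only [this]; field_simp
  · simp [dt_self_right]
  · simp [dt_self_left]
  · simp [dt_self_right]
  · exact div_self hD
  · intro x y h1 h2
    have h1 : -(dt o q x / dt o p q) = -(dt o q y / dt o p q) := h1
    have h2 : dt o p x / dt o p q = dt o p y / dt o p q := h2
    rw [neg_inj] at h1
    rw [div_left_inj' hD] at h1 h2
    unfold dt at *
    apply plane_ext
    · have : ((p 0 - o 0) * (q 1 - o 1) - (p 1 - o 1) * (q 0 - o 0)) * (x 0 - y 0) = 0 := by
        linear_combination (q 0 - o 0) * h2 - (p 0 - o 0) * h1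
      have := (mul_eq_zero.1 this).resolve_left hD
      linarith
    · have : ((p 0 - o 0) * (q 1 - o 1) - (p 1 - o 1) * (q 0 - o 0)) * (x 1 - y 1) = 0 := by
        linear_combination (q 1 - o 1) * h2 - (p 1 - o 1) * h1
      have := (mul_eq_zero.1 this).resolve_left hD
      linarith

/-- Two affine functions vanishing on the same line are proportional. -/
theorem IsAff.proportional {h k : Plane → ℝ} (hh : IsAff h) (hk : IsAff k) {p q x : Plane}
    (hpq : p ≠ q) (hp : h p = 0) (hq : h q = 0) (kp : k p = 0) (kq : k q = 0)
    (hx : 0 < h x) (kx : 0 < k x) : ∃ c : ℝ, 0 < c ∧ ∀ y, h y = c * k y := by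
  refine ⟨h x / k x, by positivity, fun y => ?_⟩
  have h1 : IsAff fun y => k x * h y + (- h x) * k y + 0 := hh.lin hk _ _ _
  by_contra hne
  have hy : k x * h y + (- h x) * k y + 0 ≠ 0 := by
    intro h0; apply hne; field_simp; linarith
  obtain ⟨t, ht⟩ := h1.exists_pt hpq (by simp [hp, kp]) (by simp [hq, kq]) hy
    (show k x * h x + (- h x) * k x + 0 = 0 by ring)
  rw [ht, hh.pt, hp, hq] at hx
  simp at hx

/-- The first point at which a segment starting in an open set leaves it. -/
theorem exists_first_exit {T : Set Plane} (hT : IsOpen T) {x y : Plane} (hx : x ∈ T)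
    (hy : y ∉ T) :
    ∃ t : ℝ, 0 < t ∧ t ≤ 1 ∧ pt x y t ∉ T ∧ ∀ s, 0 ≤ s → s < t → pt x y s ∈ T := by
  set S : Set ℝ := {t | t ∈ Icc (0 : ℝ) 1 ∧ pt x y t ∉ T} with hS
  have hSc : IsClosed S := by
    have : S = Icc (0 : ℝ) 1 ∩ (pt x y) ⁻¹' Tᶜ := rfl
    rw [this]
    exact isClosed_Icc.inter (hT.isClosed_compl.preimage (continuous_pt x y))
  have hSne : S.Nonempty := ⟨1, ⟨by norm_num, by norm_num⟩, by rwa [pt_one]⟩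
  have hSb : BddBelow S := ⟨0, fun t ht => ht.1.1⟩
  have hm := hSc.csInf_mem hSne hSb
  refine ⟨sInf S, ?_, hm.1.2, hm.2, ?_⟩
  · rcases hm.1.1.eq_or_lt with h | h
    · exfalso; apply hm.2; rw [← h, pt_zero]; exact hx
    · exact h
  · intro s hs0 hs
    by_contra hns
    exact absurd (csInf_le hSb ⟨⟨hs0, hs.le.trans hm.1.2⟩, hns⟩) (not_le.2 hs)

/-- If `k S` and `Z` as well as `S` and `s Z` are joined by segments (all seen from `o`), with
`k, s < 1`, then the two segments meet. -/
theorem segments_cross {o S Z : Plane} {k s : ℝ} (hk0 : 0 < k) (hk : k < 1) (hs0 : 0 < s)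
    (hs : s < 1) :
    ∃ x, x ∈ openSegment ℝ (pt o S k) Z ∧ x ∈ openSegment ℝ S (pt o Z s) := by
  have hsk : 0 < 1 - s * k := by nlinarith
  set β := (1 - k) / (1 - s * k) with hβ
  have hβ0 : 0 < β := div_pos (by linarith) hsk
  have hβ1 : β < 1 := by rw [hβ, div_lt_one hsk]; nlinarith
  have e : β * (1 - s * k) = 1 - k := div_mul_cancel₀ _ hsk.ne'
  refine ⟨pt S (pt o Z s) β, mem_openSegment_iff_pt.2 ⟨β * s, by positivity, by nlinarith, ?_⟩,
    pt_mem_openSegment hβ0 hβ1⟩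
  apply plane_ext <;> simp only [pt_apply]
  · linear_combination (-(S 0 - o 0)) * e
  · linear_combination (-(S 1 - o 1)) * e

theorem isPreconnected_segment (x y : Plane) : IsPreconnected (segment ℝ x y) :=
  (convex_segment x y).isPreconnected

/-- The plane as the complex numbers. -/
noncomputable def toC (x : Plane) : ℂ := ⟨x 0, x 1⟩

theorem continuous_toC : Continuous toC := by
  have : toC = fun x : Plane => ((x 0 : ℝ) : ℂ) + ((x 1 : ℝ) : ℂ) * Complex.I := by
    funext x; apply Complex.ext <;> simp [toC]
  rw [this]
  fun_prop

theorem toC_injective : Function.Injective toC := by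
  intro x y h
  exact plane_ext (congrArg Complex.re h) (congrArg Complex.im h)

/-- The ratio whose argument is the angle at `x` from `p` to `q`. -/
noncomputable def ratio (p q x : Plane) : ℂ := (toC q - toC x) / (toC p - toC x)

/-- The angle under which the segment from `p` to `q` is seen from `x`. -/
noncomputable def ang (p q x : Plane) : ℝ := (ratio p q x).arg

theorem toC_sub_ne_zero {p x : Plane} (h : x ≠ p) : toC p - toC x ≠ 0 :=
  sub_ne_zero.2 fun e => h (toC_injective e).symm

theorem ratio_mem_slitPlane {p q x : Plane} (h : x ∉ segment ℝ p q) :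
    ratio p q x ∈ Complex.slitPlane := by
  have hp : x ≠ p := fun e => h (e ▸ left_mem_segment ℝ _ _)
  by_contra hs
  rw [Complex.mem_slitPlane_iff] at hs
  push Not at hs
  obtain ⟨hre, him⟩ := hs
  set r := -(ratio p q x).re with hr
  have hr0 : 0 ≤ r := by linarith
  have e : ratio p q x = ((-r : ℝ) : ℂ) := by apply Complex.ext <;> simp [hr, him]
  have e2 : toC q - toC x = ((-r : ℝ) : ℂ) * (toC p - toC x) := by
    rw [← e, ratio, div_mul_cancel₀ _ (toC_sub_ne_zero hp)]
  have e0 := congrArg Complex.re e2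
  have e1 := congrArg Complex.im e2
  simp only [toC, Complex.sub_re, Complex.sub_im, Complex.mul_re, Complex.mul_im,
    Complex.ofReal_re, Complex.ofReal_im] at e0 e1
  apply h
  refine mem_segment_iff_pt.2 ⟨1 / (1 + r), by positivity, ?_, ?_⟩
  · rw [div_le_one (by positivity)]; linarith
  · have : (1 + r) ≠ 0 := by positivity
    apply plane_ext <;> rw [pt_apply] <;> field_simp <;> linarith

theorem continuousAt_ratio {p q x : Plane} (h : x ≠ p) : ContinuousAt (ratio p q) x := by
  unfold ratio
  exact ContinuousAt.div (continuousAt_const.sub continuous_toC.continuousAt)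
    (continuousAt_const.sub continuous_toC.continuousAt) (toC_sub_ne_zero h)

theorem continuousAt_ang {p q x : Plane} (h : x ∉ segment ℝ p q) : ContinuousAt (ang p q) x := by
  have hp : x ≠ p := fun e => h (e ▸ left_mem_segment ℝ _ _)
  exact ContinuousAt.comp (g := Complex.arg) (Complex.continuousAt_arg (ratio_mem_slitPlane h))
    (continuousAt_ratio hp)

theorem ang_symm {p q x : Plane} (h : x ∉ segment ℝ p q) : ang q p x = - ang p q x := by
  have : ratio q p x = (ratio p q x)⁻¹ := by unfold ratio; rw [inv_div]
  rw [ang, this, Complex.arg_inv, if_neg (Complex.mem_slitPlane_iff_arg.1 (ratio_mem_slitPlane h)).1]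
  rfl

/-- The unit complex number pointing from `x` to `p`. -/
noncomputable def dirTo (p x : Plane) : ℂ := (toC p - toC x) / (‖toC p - toC x‖ : ℂ)

theorem dirTo_ne_zero {p x : Plane} (h : x ≠ p) : dirTo p x ≠ 0 := by
  have := toC_sub_ne_zero h
  unfold dirTo
  refine div_ne_zero this ?_
  simpa using this

theorem exp_ang {p q x : Plane} (h : x ∉ segment ℝ p q) :
    Complex.exp (ang p q x * Complex.I) = dirTo q x / dirTo p x := by
  have hp : x ≠ p := fun e => h (e ▸ left_mem_segment ℝ _ _)
  have hq : x ≠ q := fun e => h (e ▸ right_mem_segment ℝ _ _)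
  have h1 := toC_sub_ne_zero hp
  have h2 := toC_sub_ne_zero hq
  have h1' : (‖toC p - toC x‖ : ℂ) ≠ 0 := by simpa using h1
  have h2' : (‖toC q - toC x‖ : ℂ) ≠ 0 := by simpa using h2
  have h3 : ratio p q x ≠ 0 := div_ne_zero h2 h1
  have h4 := Complex.norm_mul_exp_arg_mul_I (ratio p q x)
  have h5 : (‖ratio p q x‖ : ℂ) ≠ 0 := by simpa using h3
  have h6 : (‖ratio p q x‖ : ℂ) = (‖toC q - toC x‖ : ℂ) / (‖toC p - toC x‖ : ℂ) := by
    unfold ratio; rw [norm_div]; push_cast; rfl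
  unfold ang
  apply mul_left_cancel₀ h5
  rw [h4, h6]
  unfold ratio dirTo
  field_simp

/-- The total angle of a polygonal path seen from `x`. -/
noncomputable def angSum (P : ℕ → Plane) (m : ℕ) (x : Plane) : ℝ :=
  ∑ k ∈ Finset.range m, ang (P k) (P (k + 1)) x

/-- The trace of a polygonal path. -/
def trace (P : ℕ → Plane) (m : ℕ) : Set Plane :=
  ⋃ k ∈ Finset.range m, segment ℝ (P k) (P (k + 1))

theorem notMem_trace {P : ℕ → Plane} {m : ℕ} {x : Plane} (h : x ∉ trace P m) {k : ℕ}
    (hk : k < m) : x ∉ segment ℝ (P k) (P (k + 1)) := fun hx =>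
  h (mem_biUnion (Finset.mem_coe.2 (Finset.mem_range.2 hk)) hx)

theorem isCompact_segment (x y : Plane) : IsCompact (segment ℝ x y) := by
  have : segment ℝ x y = pt x y '' Icc 0 1 := by
    ext p
    rw [mem_segment_iff_pt]
    constructor
    · rintro ⟨t, h0, h1, rfl⟩; exact ⟨t, ⟨h0, h1⟩, rfl⟩
    · rintro ⟨t, h, rfl⟩; exact ⟨t, h.1, h.2, rfl⟩
  rw [this]
  exact isCompact_Icc.image (continuous_pt x y)

theorem isClosed_segment (x y : Plane) : IsClosed (segment ℝ x y) :=
  (isCompact_segment x y).isClosed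

theorem isClosed_trace (P : ℕ → Plane) (m : ℕ) : IsClosed (trace P m) :=
  isClosed_biUnion_finset fun _ _ => isClosed_segment _ _

theorem continuousAt_angSum {P : ℕ → Plane} {m : ℕ} {x : Plane} (h : x ∉ trace P m) :
    ContinuousAt (angSum P m) x := by
  unfold angSum
  refine tendsto_finsetSum _ fun k hk => ?_
  exact continuousAt_ang (notMem_trace h (Finset.mem_range.1 hk))

theorem exp_angSum {P : ℕ → Plane} {m : ℕ} {x : Plane} (h : x ∉ trace P m) (h0 : x ≠ P 0) :
    Complex.exp (angSum P m x * Complex.I) = dirTo (P m) x / dirTo (P 0) x := by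
  induction m with
  | zero => simp [angSum, div_self (dirTo_ne_zero h0)]
  | succ m ih =>
    have h1 : x ∉ trace P m := by
      intro hx; apply h
      obtain ⟨k, hk, hx⟩ := mem_iUnion₂.1 hx
      exact mem_biUnion (Finset.mem_coe.2
        (Finset.mem_range.2 ((Finset.mem_range.1 hk).trans m.lt_succ_self))) hx
    have h2 := notMem_trace h m.lt_succ_self
    have hp : x ≠ P m := fun e => h2 (e ▸ left_mem_segment ℝ _ _)
    have h3 : angSum P (m + 1) x = angSum P m x + ang (P m) (P (m + 1)) x :=
      Finset.sum_range_succ _ _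
    rw [h3]
    push_cast
    rw [add_mul, Complex.exp_add, ih h1, exp_ang h2]
    have := dirTo_ne_zero hp
    have := dirTo_ne_zero h0
    field_simp

/-- The angle total of a polygonal path closed up by the segment from its end to its start. -/
noncomputable def wind (P : ℕ → Plane) (m : ℕ) (x : Plane) : ℝ :=
  angSum P m x + ang (P m) (P 0) x

theorem exists_wind_eq {P : ℕ → Plane} {m : ℕ} {x : Plane} (h : x ∉ trace P m)
    (hc : x ∉ segment ℝ (P m) (P 0)) : ∃ k : ℤ, wind P m x = k * (2 * Real.pi) := by
  have hp : x ≠ P m := fun e => hc (e ▸ left_mem_segment ℝ _ _)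
  have h0 : x ≠ P 0 := fun e => hc (e ▸ right_mem_segment ℝ _ _)
  have e : Complex.exp (wind P m x * Complex.I) = 1 := by
    unfold wind
    push_cast
    rw [add_mul, Complex.exp_add, exp_angSum h h0, exp_ang hc]
    have := dirTo_ne_zero hp
    have := dirTo_ne_zero h0
    field_simp
  obtain ⟨k, hk⟩ := Complex.exp_eq_one_iff.1 e
  refine ⟨k, ?_⟩
  have := congrArg Complex.im hk
  simpa using this

theorem continuousAt_wind {P : ℕ → Plane} {m : ℕ} {x : Plane} (h : x ∉ trace P m)
    (hc : x ∉ segment ℝ (P m) (P 0)) : ContinuousAt (wind P m) x :=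
  (continuousAt_angSum h).add (continuousAt_ang hc)

theorem IsPreconnected.eq_of_int_mul {K : Set Plane} (hK : IsPreconnected K) {f : Plane → ℝ}
    (hf : ContinuousOn f K) {c : ℝ} (hc : 0 < c) (hi : ∀ x ∈ K, ∃ k : ℤ, f x = k * c) {x y : Plane}
    (hx : x ∈ K) (hy : y ∈ K) : f x = f y := by
  wlog hlt : f x < f y generalizing x y with H
  · rcases lt_trichotomy (f x) (f y) with h | h | h
    · exact H hx hy h
    · exact h
    · exact (H hy hx h).symm
  exfalso
  obtain ⟨a, ha⟩ := hi x hx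
  obtain ⟨b, hb⟩ := hi y hy
  have hab : a < b := by
    rw [ha, hb] at hlt
    exact_mod_cast lt_of_mul_lt_mul_right hlt hc.le
  have hab' : (a : ℝ) + 1 ≤ b := by exact_mod_cast hab
  obtain ⟨z, hz, hze⟩ := (hK.image f hf).Icc_subset (mem_image_of_mem f hx) (mem_image_of_mem f hy)
    (show f x + c / 2 ∈ Icc (f x) (f y) by
      constructor
      · linarith
      · rw [ha, hb]; nlinarith)
  obtain ⟨k, hk⟩ := hi z hz
  rw [hk, ha] at hze
  have h1 : ((k - a : ℤ) : ℝ) * 2 = 1 := by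
    push_cast
    have : ((k - a) * 2 - 1 : ℝ) * c = 0 := by linear_combination 2 * hze
    have := (mul_eq_zero.1 this).resolve_right hc.ne'
    linarith
  have h2 : (k - a) * 2 = 1 := by exact_mod_cast h1
  omega

theorem ratio_im (p q x : Plane) :
    (ratio p q x).im = dt p q x / Complex.normSq (toC p - toC x) := by
  unfold ratio dt
  rw [Complex.div_im]
  simp only [toC, Complex.sub_re, Complex.sub_im]
  ring

theorem ratio_of_mem_openSegment {p q x : Plane} (hpq : p ≠ q) (h : x ∈ openSegment ℝ p q) :
    (ratio p q x).re < 0 ∧ (ratio p q x).im = 0 := by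
  obtain ⟨t, h0, h1, rfl⟩ := mem_openSegment_iff_pt.1 h
  have hp : pt p q t ≠ p := by
    intro e
    rw [← pt_zero p q] at e
    have := pt_injective hpq (by simpa [pt_zero] using e : pt p q t = pt p q 0)
    linarith
  have e : ratio p q (pt p q t) = ((-((1 - t) / t) : ℝ) : ℂ) := by
    unfold ratio
    rw [div_eq_iff (toC_sub_ne_zero hp)]
    apply Complex.ext
    · simp only [toC, Complex.sub_re, Complex.mul_re, Complex.ofReal_re, Complex.ofReal_im,
        pt_apply]
      field_simp
      ring
    · simp only [toC, Complex.sub_im, Complex.mul_im, Complex.ofReal_re, Complex.ofReal_im,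
        pt_apply]
      field_simp
      ring
  rw [e]
  constructor
  · rw [Complex.ofReal_re]
    have : 0 < (1 - t) / t := div_pos (by linarith) h0
    linarith
  · exact Complex.ofReal_im _

/-- The winding angle jumps across the closing chord of a polygonal path. -/
theorem wind_jump {P : ℕ → Plane} {m : ℕ} {X A : Plane} (hne : P m ≠ P 0)
    (hX : X ∈ openSegment ℝ (P m) (P 0)) (hA : ∀ t, 0 ≤ t → t ≤ 1 → pt X A t ∉ trace P m) :
    (0 < dt (P m) (P 0) A → wind P m A = angSum P m X + Real.pi) ∧
    (dt (P m) (P 0) A < 0 → wind P m A = angSum P m X - Real.pi) := by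
  have haff := isAff_dt (P m) (P 0)
  have hdX : dt (P m) (P 0) X = 0 := by
    obtain ⟨t, -, -, rfl⟩ := mem_openSegment_iff_pt.1 hX
    exact haff.eq_of_collinear (dt_self_left _ _) (dt_self_right _ _)
  have hdt : ∀ t, dt (P m) (P 0) (pt X A t) = t * dt (P m) (P 0) A := by
    intro t; rw [haff.pt, hdX]; ring
  have hoff : dt (P m) (P 0) A ≠ 0 → ∀ t, 0 < t → pt X A t ∉ segment ℝ (P m) (P 0) := by
    intro h0 t ht hm
    obtain ⟨u, -, -, hu⟩ := mem_segment_iff_pt.1 hm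
    have h1 := hdt t
    rw [hu, haff.eq_of_collinear (dt_self_left _ _) (dt_self_right _ _)] at h1
    exact (mul_ne_zero ht.ne' h0) h1.symm
  have hconst : dt (P m) (P 0) A ≠ 0 → ∀ t ∈ Ioc (0 : ℝ) 1, wind P m (pt X A t) = wind P m A := by
    intro h0 t ht
    have hK : IsPreconnected (pt X A '' Ioc (0 : ℝ) 1) :=
      isPreconnected_Ioc.image _ (continuous_pt X A).continuousOn
    refine hK.eq_of_int_mul (f := wind P m) ?_ Real.two_pi_pos ?_ (mem_image_of_mem _ ht)
      ⟨1, ⟨by norm_num, le_rfl⟩, pt_one _ _⟩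
    · rintro _ ⟨s, hs, rfl⟩
      exact (continuousAt_wind (hA s hs.1.le hs.2) (hoff h0 s hs.1)).continuousWithinAt
    · rintro _ ⟨s, hs, rfl⟩
      exact exists_wind_eq (hA s hs.1.le hs.2) (hoff h0 s hs.1)
  have hlim0 : Tendsto (pt X A) (𝓝[>] 0) (𝓝 X) := by
    have := ((continuous_pt X A).tendsto 0).mono_left (nhdsWithin_le_nhds (s := Ioi 0))
    rwa [pt_zero] at this
  have hXP : X ≠ P m := by
    rintro rfl
    exact hne (left_mem_openSegment_iff.1 hX)
  have hXt : X ∉ trace P m := by simpa [pt_zero] using hA 0 le_rfl zero_le_one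
  obtain ⟨hre, him⟩ := ratio_of_mem_openSegment hne hX
  have hns : ∀ t, 0 < t → dt (P m) (P 0) A ≠ 0 →
      0 < Complex.normSq (toC (P m) - toC (pt X A t)) := by
    intro t ht h0
    apply Complex.normSq_pos.2
    apply toC_sub_ne_zero
    intro e
    exact hoff h0 t ht (e ▸ left_mem_segment ℝ _ _)
  have hmem : ∀ᶠ t in 𝓝[>] (0 : ℝ), t ∈ Ioc (0 : ℝ) 1 :=
    Ioc_mem_nhdsGT zero_lt_one
  constructor
  · intro hp
    have h1 : Tendsto (fun t => ratio (P m) (P 0) (pt X A t)) (𝓝[>] 0)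
        (𝓝[{z : ℂ | 0 ≤ z.im}] (ratio (P m) (P 0) X)) := by
      refine tendsto_nhdsWithin_iff.2 ⟨((continuousAt_ratio hXP).tendsto).comp hlim0, ?_⟩
      filter_upwards [hmem] with t ht
      show 0 ≤ (ratio (P m) (P 0) (pt X A t)).im
      rw [ratio_im, hdt]
      exact div_nonneg (mul_nonneg ht.1.le hp.le) (Complex.normSq_nonneg _)
    have h2 := (Complex.tendsto_arg_nhdsWithin_im_nonneg_of_re_neg_of_im_zero hre him).comp h1
    have h3 := (((continuousAt_angSum hXt).tendsto).comp hlim0).add h2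
    refine tendsto_nhds_unique (Tendsto.congr' ?_ tendsto_const_nhds) h3
    filter_upwards [hmem] with t ht
    exact (hconst hp.ne' t ht).symm
  · intro hp
    have h1 : Tendsto (fun t => ratio (P m) (P 0) (pt X A t)) (𝓝[>] 0)
        (𝓝[{z : ℂ | z.im < 0}] (ratio (P m) (P 0) X)) := by
      refine tendsto_nhdsWithin_iff.2 ⟨((continuousAt_ratio hXP).tendsto).comp hlim0, ?_⟩
      filter_upwards [hmem] with t ht
      show (ratio (P m) (P 0) (pt X A t)).im < 0
      rw [ratio_im, hdt]
      exact div_neg_of_neg_of_pos (mul_neg_of_pos_of_neg ht.1 hp) (hns t ht.1 hp.ne)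
    have h2 := (Complex.tendsto_arg_nhdsWithin_im_neg_of_re_neg_of_im_zero hre him).comp h1
    have h3 := (((continuousAt_angSum hXt).tendsto).comp hlim0).add h2
    refine tendsto_nhds_unique (Tendsto.congr' ?_ tendsto_const_nhds) h3
    filter_upwards [hmem] with t ht
    exact (hconst hp.ne t ht).symm

/-- A chord of a region bounded by two polygonal paths joining its ends separates the region. -/
theorem chord_separates {P Q : ℕ → Plane} {m l : ℕ} {a σ : Plane} {I K : Set Plane} (hne : a ≠ σ)
    (hP0 : P 0 = a) (hPm : P m = σ) (hQ0 : Q 0 = σ) (hQl : Q l = a) (hI : IsPreconnected I)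
    (hI1 : Disjoint I (trace P m)) (hI2 : Disjoint I (trace Q l))
    (h12 : trace P m ∩ trace Q l ⊆ segment ℝ a σ) {A B X : Plane} (hAB : segment ℝ A B ⊆ I)
    (hX : X ∈ openSegment ℝ a σ) (hXAB : X ∈ segment ℝ A B) (hA : 0 < dt σ a A)
    (hB : dt σ a B < 0) (hK : IsPreconnected K) (hKs : K ⊆ I ∪ trace P m ∪ trace Q l)
    (hKc : Disjoint K (segment ℝ a σ)) (hAK : A ∈ K) (hBK : B ∈ K) : False := by
  classical
  have hsub : ∀ C ∈ segment ℝ A B, ∀ t, 0 ≤ t → t ≤ 1 → pt X C t ∉ trace P m := by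
    intro C hC t h0 h1 ht
    refine disjoint_left.1 hI1 (hAB ?_) ht
    exact (convex_segment A B).segment_subset hXAB hC (pt_mem_segment h0 h1)
  have hX' : X ∈ openSegment ℝ (P m) (P 0) := by rw [hP0, hPm, openSegment_symm]; exact hX
  have hne' : P m ≠ P 0 := by rw [hP0, hPm]; exact hne.symm
  have hwA := (wind_jump hne' hX' (hsub A (left_mem_segment ℝ _ _))).1 (by rwa [hP0, hPm])
  have hwB := (wind_jump hne' hX' (hsub B (right_mem_segment ℝ _ _))).2 (by rwa [hP0, hPm])
  have hAI : A ∈ I := hAB (left_mem_segment ℝ _ _)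
  have hBI : B ∈ I := hAB (right_mem_segment ℝ _ _)
  have hcP : ∀ {x}, x ∉ segment ℝ a σ → x ∉ segment ℝ (P m) (P 0) := by
    intro x hx; rwa [hP0, hPm, segment_symm]
  have hcQ : ∀ {x}, x ∉ segment ℝ a σ → x ∉ segment ℝ (Q l) (Q 0) := by
    intro x hx; rwa [hQ0, hQl]
  have hAc : A ∉ segment ℝ a σ := disjoint_left.1 hKc hAK
  set w0 : ℝ := angSum P m A + angSum Q l A with hw0
  have hw0c : ∀ x ∈ I, angSum P m x + angSum Q l x = w0 := by
    intro x hx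
    have hpq : ∀ y ∈ I, y ≠ a := by
      intro y hy e
      rcases Nat.eq_zero_or_pos m with h0 | h0
      · exact hne (by rw [← hP0, ← hPm, h0])
      · refine disjoint_left.1 hI1 hy (mem_biUnion (Finset.mem_coe.2 (Finset.mem_range.2 h0)) ?_)
        rw [e, hP0]; exact left_mem_segment ℝ _ _
    have hps : ∀ y ∈ I, y ≠ σ := by
      intro y hy e
      rcases Nat.eq_zero_or_pos l with h0 | h0
      · exact hne (by rw [← hQ0, ← hQl, h0])
      · refine disjoint_left.1 hI2 hy (mem_biUnion (Finset.mem_coe.2 (Finset.mem_range.2 h0)) ?_)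
        rw [e, hQ0]; exact left_mem_segment ℝ _ _
    refine hI.eq_of_int_mul (f := fun x => angSum P m x + angSum Q l x) ?_ Real.two_pi_pos ?_ hx hAI
    · intro y hy
      exact ((continuousAt_angSum (disjoint_left.1 hI1 hy)).add
        (continuousAt_angSum (disjoint_left.1 hI2 hy))).continuousWithinAt
    · intro y hy
      have e : Complex.exp ((angSum P m y + angSum Q l y : ℝ) * Complex.I) = 1 := by
        push_cast
        rw [add_mul, Complex.exp_add, exp_angSum (disjoint_left.1 hI1 hy) (by
          rw [hP0]; exact hpq y hy), exp_angSum (disjoint_left.1 hI2 hy) (by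
          rw [hQ0]; exact hps y hy), hP0, hPm, hQ0, hQl]
        have := dirTo_ne_zero (hpq y hy)
        have := dirTo_ne_zero (hps y hy)
        field_simp
      obtain ⟨k, hk⟩ := Complex.exp_eq_one_iff.1 e
      refine ⟨k, ?_⟩
      have := congrArg Complex.im hk
      simpa using this
  have hsum : ∀ x ∈ I, x ∉ segment ℝ a σ → wind P m x = w0 - wind Q l x := by
    intro x hx hxc
    have h1 := hw0c x hx
    have h2 : ang a σ x = - ang σ a x := ang_symm (by rwa [segment_symm])
    unfold wind
    rw [hP0, hPm, hQ0, hQl, h2]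
    linarith
  obtain ⟨kA, hkA⟩ := exists_wind_eq (disjoint_left.1 hI1 hAI) (hcP hAc)
  obtain ⟨lA, hlA⟩ := exists_wind_eq (disjoint_left.1 hI2 hAI) (hcQ hAc)
  have hw0i : w0 = (kA + lA : ℤ) * (2 * Real.pi) := by
    have := hsum A hAI hAc
    push_cast
    linarith
  set L : Plane → ℝ := fun x => if x ∈ trace P m then w0 - wind Q l x else wind P m x with hL
  have hLQ : ∀ x ∈ I ∪ trace P m, x ∉ segment ℝ a σ → L x = w0 - wind Q l x := by
    intro x hx hxc
    simp only [hL]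
    split_ifs with h
    · rfl
    · exact hsum x (hx.resolve_right h) hxc
  have hKL : L A = L B := by
    refine hK.eq_of_int_mul (f := L) ?_ Real.two_pi_pos ?_ hAK hBK
    · intro x hx
      have hxc := disjoint_left.1 hKc hx
      by_cases hxP : x ∈ trace P m
      · have hxQ : x ∉ trace Q l := fun h => hxc (h12 ⟨hxP, h⟩)
        have h1 : ContinuousWithinAt (fun x => w0 - wind Q l x) K x :=
          (continuousAt_const.sub (continuousAt_wind hxQ (hcQ hxc))).continuousWithinAt
        refine h1.congr_of_eventuallyEq ?_ (hLQ x (Or.inr hxP) hxc)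
        filter_upwards [self_mem_nhdsWithin,
          mem_nhdsWithin_of_mem_nhds ((isClosed_trace Q l).isOpen_compl.mem_nhds hxQ)] with y hy hyQ
        exact hLQ y ((hKs hy).resolve_right hyQ) (disjoint_left.1 hKc hy)
      · have h1 : ContinuousWithinAt (wind P m) K x :=
          (continuousAt_wind hxP (hcP hxc)).continuousWithinAt
        refine h1.congr_of_eventuallyEq ?_ (if_neg hxP)
        filter_upwards [mem_nhdsWithin_of_mem_nhds
          ((isClosed_trace P m).isOpen_compl.mem_nhds hxP)] with y hyP
        exact if_neg hyP
    · intro x hx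
      have hxc := disjoint_left.1 hKc hx
      by_cases hxP : x ∈ trace P m
      · have hxQ : x ∉ trace Q l := fun h => hxc (h12 ⟨hxP, h⟩)
        obtain ⟨k, hk⟩ := exists_wind_eq hxQ (hcQ hxc)
        refine ⟨kA + lA - k, ?_⟩
        rw [hLQ x (Or.inr hxP) hxc, hk, hw0i]
        push_cast
        ring
      · obtain ⟨k, hk⟩ := exists_wind_eq hxP (hcP hxc)
        exact ⟨k, by rw [← hk]; exact if_neg hxP⟩
  have e1 : L A = wind P m A := if_neg (disjoint_left.1 hI1 hAI)
  have e2 : L B = wind P m B := if_neg (disjoint_left.1 hI1 hBI)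
  have := Real.pi_pos
  linarith

/-- The combinatorial and topological data of a simple polygon: interior `I`, frontier `F`,
vertices `Vs` and the adjacency relation `E` of vertices. -/
structure Region where
  I : Set Plane
  F : Set Plane
  Vs : Finset Plane
  E : Plane → Plane → Prop
  isOpen_I : IsOpen I
  isClosed_P : IsClosed (I ∪ F)
  disj : Disjoint I F
  preconn : IsPreconnected I
  bdd : Bornology.IsBounded I
  sub_I : ∀ K : Set Plane, IsPreconnected K → Disjoint K F → (K ∩ I).Nonempty → K ⊆ I
  not_nhds : ∀ x ∈ F, I ∪ F ∉ 𝓝 x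
  E_symm : ∀ p q, E p q → E q p
  E_ne : ∀ p q, E p q → p ≠ q
  E_left : ∀ p q, E p q → p ∈ Vs
  seg_sub : ∀ p q, E p q → segment ℝ p q ⊆ F
  cover : ∀ x ∈ F, ∃ p q, E p q ∧ x ∈ segment ℝ p q
  uniq : ∀ p q p' q' x, E p q → E p' q' → x ∈ openSegment ℝ p q → x ∈ segment ℝ p' q' →
    (p = p' ∧ q = q') ∨ (p = q' ∧ q = p')
  nbrs : ∀ α ∈ Vs, ∃ p q, p ≠ q ∧ E α p ∧ E α q ∧ ∀ r, E α r → r = p ∨ r = q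
  inter : ∀ α p q, E α p → E α q → p ≠ q → segment ℝ α p ∩ segment ℝ α q = {α}
  sep : ∀ a w f σ, a ∈ Vs → E w f → σ ∈ openSegment ℝ w f → openSegment ℝ a σ ⊆ I →
    ∀ h, IsAff h → h a = 0 → h σ = 0 → ∀ A B X K, segment ℝ A B ⊆ I → X ∈ openSegment ℝ a σ →
    X ∈ segment ℝ A B → 0 < h A → h B < 0 → IsPreconnected K → K ⊆ (I ∪ F) \ segment ℝ a σ →
    A ∈ K → B ∉ K

theorem comp_absorb {S K : Set Plane} {w x : Plane} (hK : IsPreconnected K) (hKS : K ⊆ S)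
    (hxK : x ∈ K) (hx : x ∈ connectedComponentIn S w) : K ⊆ connectedComponentIn S w := by
  rw [connectedComponentIn_eq hx]
  exact hK.subset_connectedComponentIn hxK hKS

namespace Region
variable (D : Region)

/-- The closed region. -/
def P : Set Plane := D.I ∪ D.F

/-- Interior visibility. -/
def Sees (x y : Plane) : Prop := openSegment ℝ x y ⊆ D.I

/-- A point in the relative interior of an edge. -/
def Reg (x : Plane) : Prop := ∃ p q, D.E p q ∧ x ∈ openSegment ℝ p q

/-- A point of the region which is not a vertex. -/
def Valid (x : Plane) : Prop := x ∈ D.I ∨ D.Reg x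

variable {D}

theorem Sees.symm {x y : Plane} (h : D.Sees x y) : D.Sees y x := by
  unfold Sees; rw [openSegment_symm]; exact h

theorem notMem_F {x : Plane} (h : x ∈ D.I) : x ∉ D.F := disjoint_left.1 D.disj h

theorem E_right {p q : Plane} (h : D.E p q) : q ∈ D.Vs := D.E_left _ _ (D.E_symm _ _ h)

theorem Reg.mem_F {x : Plane} (h : D.Reg x) : x ∈ D.F := by
  obtain ⟨p, q, he, hx⟩ := h
  exact D.seg_sub _ _ he (openSegment_subset_segment ℝ _ _ hx)

theorem Valid.mem_P {x : Plane} (h : D.Valid x) : x ∈ D.P :=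
  h.imp id Reg.mem_F

theorem vertex_mem_F {α : Plane} (h : α ∈ D.Vs) : α ∈ D.F := by
  obtain ⟨p, q, -, hp, -⟩ := D.nbrs α h
  exact D.seg_sub _ _ hp (left_mem_segment ℝ _ _)

theorem vertex_notMem_openSegment {α p q : Plane} (h : α ∈ D.Vs) (hE : D.E p q) :
    α ∉ openSegment ℝ p q := by
  intro hm
  obtain ⟨n, -, -, hn, -⟩ := D.nbrs α h
  rcases D.uniq _ _ _ _ _ hE hn hm (left_mem_segment ℝ _ _) with ⟨h1, h2⟩ | ⟨h1, h2⟩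
  · subst h1; exact D.E_ne _ _ hE (left_mem_openSegment_iff.1 hm)
  · subst h2; exact D.E_ne _ _ hE (right_mem_openSegment_iff.1 hm)

theorem vertex_mem_segment {α p q : Plane} (h : α ∈ D.Vs) (hE : D.E p q)
    (hm : α ∈ segment ℝ p q) : α = p ∨ α = q := by
  by_contra hne
  push Not at hne
  exact vertex_notMem_openSegment h hE
    (mem_openSegment_of_ne_left_right hne.1.symm hne.2.symm hm)

theorem vertex_not_reg {α : Plane} (h : α ∈ D.Vs) : ¬ D.Reg α := by
  rintro ⟨p, q, hE, hm⟩
  exact vertex_notMem_openSegment h hE hm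

theorem reg_of_mem_F {x : Plane} (h : x ∈ D.F) (hv : x ∉ D.Vs) : D.Reg x := by
  obtain ⟨p, q, hE, hm⟩ := D.cover x h
  refine ⟨p, q, hE, mem_openSegment_of_ne_left_right ?_ ?_ hm⟩
  · rintro rfl; exact hv (D.E_left _ _ hE)
  · rintro rfl; exact hv (E_right hE)

theorem isClosed_edges (R : Plane → Plane → Prop) (hR : ∀ p q, R p q → D.E p q) :
    IsClosed {x | ∃ p q, R p q ∧ x ∈ segment ℝ p q} := by
  classical
  have : {x | ∃ p q, R p q ∧ x ∈ segment ℝ p q} =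
      ⋃ e ∈ (D.Vs ×ˢ D.Vs).filter (fun e => R e.1 e.2), segment ℝ e.1 e.2 := by
    ext x
    simp only [mem_ofPred_eq, mem_iUnion, Finset.mem_filter, Finset.mem_product, exists_prop]
    constructor
    · rintro ⟨p, q, h, hx⟩
      exact ⟨(p, q), ⟨⟨D.E_left _ _ (hR _ _ h), E_right (hR _ _ h)⟩, h⟩, hx⟩
    · rintro ⟨e, ⟨-, h⟩, hx⟩; exact ⟨_, _, h, hx⟩
  rw [this]
  exact isClosed_biUnion_finset fun _ _ => isClosed_segment _ _

/-- Near a point only edges through that point are met. -/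
theorem eventually_edge (x : Plane) :
    ∀ᶠ y in 𝓝 x, ∀ p q, D.E p q → y ∈ segment ℝ p q → x ∈ segment ℝ p q := by
  have h := isClosed_edges (D := D) (fun p q => D.E p q ∧ x ∉ segment ℝ p q) fun _ _ h => h.1
  have hx : x ∈ {x' | ∃ p q, (D.E p q ∧ x ∉ segment ℝ p q) ∧ x' ∈ segment ℝ p q}ᶜ := by
    rintro ⟨p, q, ⟨-, h1⟩, h2⟩; exact h1 h2
  filter_upwards [h.isOpen_compl.mem_nhds hx] with y hy p q hE hyp
  by_contra hxp
  exact hy ⟨p, q, ⟨hE, hxp⟩, hyp⟩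

theorem eventually_edge_reg {σ w f : Plane} (hE : D.E w f) (hσ : σ ∈ openSegment ℝ w f) :
    ∀ᶠ y in 𝓝 σ, y ∈ D.F → y ∈ segment ℝ w f := by
  filter_upwards [eventually_edge (D := D) σ] with y hy hyF
  obtain ⟨p, q, hpq, hyp⟩ := D.cover y hyF
  rcases D.uniq _ _ _ _ _ hE hpq hσ (hy p q hpq hyp) with ⟨rfl, rfl⟩ | ⟨rfl, rfl⟩
  · exact hyp
  · rwa [segment_symm]

theorem eventually_edge_vertex {α : Plane} (h : α ∈ D.Vs) :
    ∀ᶠ y in 𝓝 α, y ∈ D.F → ∃ n, D.E α n ∧ y ∈ segment ℝ α n := by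
  filter_upwards [eventually_edge (D := D) α] with y hy hyF
  obtain ⟨p, q, hpq, hyp⟩ := D.cover y hyF
  rcases vertex_mem_segment h hpq (hy p q hpq hyp) with rfl | rfl
  · exact ⟨q, hpq, hyp⟩
  · exact ⟨p, D.E_symm _ _ hpq, by rwa [segment_symm]⟩

theorem isAff_zero_on_segment {h : Plane → ℝ} (hh : IsAff h) {w f y : Plane} (hw : h w = 0)
    (hf : h f = 0) (hy : y ∈ segment ℝ w f) : h y = 0 := by
  obtain ⟨t, -, -, rfl⟩ := mem_segment_iff_pt.1 hy
  exact hh.eq_of_collinear hw hf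

theorem tendsto_pt_zero (x y : Plane) : Tendsto (pt x y) (𝓝[>] 0) (𝓝 x) := by
  have := ((continuous_pt x y).tendsto 0).mono_left (nhdsWithin_le_nhds (s := Ioi 0))
  rwa [pt_zero] at this

/-- A property that holds near `x` holds at some point of the open segment from `x` to `y`. -/
theorem exists_near {p : Plane → Prop} {x : Plane} (y : Plane) (h : ∀ᶠ q in 𝓝 x, p q) :
    ∃ t : ℝ, 0 < t ∧ t < 1 ∧ p (pt x y t) := by
  have h1 : ∀ᶠ t in 𝓝[>] (0 : ℝ), p (pt x y t) := (tendsto_pt_zero x y).eventually h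
  have h2 : ∀ᶠ t in 𝓝[>] (0 : ℝ), t ∈ Ioo (0 : ℝ) 1 := Ioo_mem_nhdsGT zero_lt_one
  obtain ⟨t, h3, h4⟩ := (h1.and h2).exists
  exact ⟨t, h4.1, h4.2, h3⟩

/-- Near a regular point seen from one side of its edge, this side is inside the region and the
other side is outside. -/
theorem eventually_sides {w f σ q : Plane} (hE : D.E w f) (hσ : σ ∈ openSegment ℝ w f)
    {h : Plane → ℝ} (hh : IsAff h) (hw : h w = 0) (hf : h f = 0) (hq : 0 < h q)
    (hqσ : D.Sees q σ) :
    ∀ᶠ x in 𝓝 σ, (0 < h x → x ∈ D.I) ∧ (h x < 0 → x ∉ D.P) ∧ (x ∈ D.F → x ∈ segment ℝ w f) := by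
  have hσ0 : h σ = 0 := isAff_zero_on_segment hh hw hf (openSegment_subset_segment ℝ _ _ hσ)
  have hσF : σ ∈ D.F := D.seg_sub _ _ hE (openSegment_subset_segment ℝ _ _ hσ)
  obtain ⟨ε, hε, hball⟩ := Metric.eventually_nhds_iff_ball.1 (eventually_edge_reg hE hσ)
  have hzero : ∀ x ∈ Metric.ball σ ε, h x ≠ 0 → x ∉ D.F := fun x hx h0 hF =>
    h0 (isAff_zero_on_segment hh hw hf (hball x hx hF))
  have hmem : ∀ᶠ x in 𝓝 σ, x ∈ Metric.ball σ ε := Metric.ball_mem_nhds σ hε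
  have hpos : ∀ x ∈ Metric.ball σ ε, 0 < h x → x ∈ D.I := by
    intro x hx hx0
    obtain ⟨t, ht0, ht1, ht⟩ := exists_near q hmem
    refine D.sub_I (Metric.ball σ ε ∩ {x | 0 < h x})
      ((convex_ball σ ε).inter hh.convex_pos).isPreconnected
      (disjoint_left.2 fun y hy => hzero y hy.1 (ne_of_gt hy.2))
      ⟨pt σ q t, ⟨ht, ?_⟩, hqσ.symm (pt_mem_openSegment ht0 ht1)⟩ ⟨hx, hx0⟩
    show 0 < h (pt σ q t)
    rw [hh.pt, hσ0]
    have := mul_pos ht0 hq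
    linarith
  filter_upwards [hmem] with x hx
  refine ⟨hpos x hx, fun hx0 hxP => ?_, hball x hx⟩
  have hxI : x ∈ D.I := hxP.resolve_right (hzero x hx hx0.ne)
  have hneg : Metric.ball σ ε ∩ {x | 0 < - h x} ⊆ D.I :=
    D.sub_I _ ((convex_ball σ ε).inter hh.neg.convex_pos).isPreconnected
      (disjoint_left.2 fun y hy => hzero y hy.1 (ne_of_lt (by have : 0 < - h y := hy.2; linarith)))
      ⟨x, ⟨hx, by show 0 < - h x; linarith⟩, hxI⟩
  refine D.not_nhds σ hσF (Filter.mem_of_superset (Metric.ball_mem_nhds σ hε) fun y hy => ?_)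
  by_cases hyF : y ∈ D.F
  · exact Or.inr hyF
  left
  rcases lt_trichotomy (h y) 0 with h0 | h0 | h0
  · exact hneg ⟨hy, by show 0 < - h y; linarith⟩
  · obtain ⟨t, ht0, ht1, ht⟩ := exists_near (x := y) q
      (show ∀ᶠ z in 𝓝 y, z ∈ Metric.ball σ ε from Metric.isOpen_ball.mem_nhds hy)
    have hpt : ∀ s, 0 < s → 0 < h (pt y q s) := by
      intro s hs; rw [hh.pt, h0]; have := mul_pos hs hq; linarith
    refine D.sub_I (segment ℝ y (pt y q t)) (isPreconnected_segment _ _) ?_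
      ⟨pt y q t, right_mem_segment ℝ _ _, hpos _ ht (hpt t ht0)⟩ (left_mem_segment ℝ _ _)
    refine disjoint_left.2 fun z hz hzF => ?_
    have hzb : z ∈ Metric.ball σ ε := (convex_ball σ ε).segment_subset hy ht hz
    obtain ⟨s, hs0, -, rfl⟩ := mem_segment_iff_pt.1 hz
    rcases hs0.eq_or_lt with rfl | hs0
    · rw [pt_zero] at hzF; exact hyF hzF
    · rw [pt_pt_right] at hzF hzb
      exact hzero _ hzb (hpt _ (mul_pos hs0 ht0)).ne' hzF
  · exact hpos y hy h0

/-- A point seeing an interior point of an edge is not on the line of this edge. -/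
theorem aff_ne_zero_of_sees {w f σ x : Plane} (hE : D.E w f) (hσ : σ ∈ openSegment ℝ w f)
    {h : Plane → ℝ} (hh : IsAff h) (hw : h w = 0) (hf : h f = 0) (hne : ∃ q, h q ≠ 0)
    (hx : D.Sees x σ) : h x ≠ 0 := by
  intro h0
  obtain ⟨q, hq⟩ := hne
  obtain ⟨s, hs⟩ := hh.exists_pt (D.E_ne _ _ hE) hw hf hq h0
  obtain ⟨t, ht0, ht1, rfl⟩ := mem_openSegment_iff_pt.1 hσ
  have hc : ContinuousAt (fun u : ℝ => t + u * (s - t)) 0 := by fun_prop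
  have h1 : ∀ᶠ u in 𝓝[>] (0 : ℝ), t + u * (s - t) ∈ Ioo (0 : ℝ) 1 := by
    apply (hc.tendsto.mono_left nhdsWithin_le_nhds).eventually
    simp only [zero_mul, add_zero]
    exact Ioo_mem_nhds ht0 ht1
  have h2 : ∀ᶠ u in 𝓝[>] (0 : ℝ), u ∈ Ioo (0 : ℝ) 1 := Ioo_mem_nhdsGT zero_lt_one
  obtain ⟨u, hu1, hu2⟩ := (h1.and h2).exists
  have h3 := hx.symm (pt_mem_openSegment hu2.1 hu2.2)
  rw [hs, pt_pt] at h3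
  exact notMem_F h3 (D.seg_sub _ _ hE (pt_mem_segment hu1.1.le hu1.2.le))

/-- An affine function vanishing on a given edge and positive at a point seeing the edge. -/
theorem exists_aff_edge {w f σ x : Plane} (hE : D.E w f) (hσ : σ ∈ openSegment ℝ w f)
    (hx : D.Sees x σ) : ∃ h, IsAff h ∧ h w = 0 ∧ h f = 0 ∧ 0 < h x := by
  have hne : ∃ q, dt w f q ≠ 0 := by
    by_contra hall
    push Not at hall
    have h1 := hall (w + !₂[-(f 1 - w 1), f 0 - w 0])
    have h2 : (f 0 - w 0) ^ 2 + (f 1 - w 1) ^ 2 = 0 := by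
      unfold dt at h1
      simp at h1
      nlinarith
    exact D.E_ne _ _ hE (plane_ext (by nlinarith [sq_nonneg (f 0 - w 0), sq_nonneg (f 1 - w 1)])
      (by nlinarith [sq_nonneg (f 0 - w 0), sq_nonneg (f 1 - w 1)]))
  have h0 := aff_ne_zero_of_sees hE hσ (isAff_dt w f) (dt_self_left _ _) (dt_self_right _ _) hne hx
  rcases h0.lt_or_gt with h | h
  · exact ⟨_, (isAff_dt w f).neg, by simp [dt_self_left], by simp [dt_self_right], by linarith⟩
  · exact ⟨_, isAff_dt w f, dt_self_left _ _, dt_self_right _ _, h⟩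

/-- Visibility of a valid point is an open condition. -/
theorem eventually_sees {x z : Plane} (hz : D.Valid z) (hx : x ∈ D.I) (hs : D.Sees x z) :
    ∀ᶠ x' in 𝓝 x, D.Sees x' z := by
  have hcont : Continuous fun e : Plane × ℝ => pt z e.1 e.2 := by unfold pt; fun_prop
  have key : ∀ t ∈ Icc (0 : ℝ) 1, ∀ᶠ e : Plane × ℝ in 𝓝 x ×ˢ 𝓝 t, 0 < e.2 → pt z e.1 e.2 ∈ D.I := by
    intro t ht
    rw [← nhds_prod_eq]
    by_cases hI : pt z x t ∈ D.I
    · have := (hcont.tendsto (x, t)).eventually (D.isOpen_I.mem_nhds hI)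
      filter_upwards [this] with e he _ using he
    · have ht0 : t = 0 := by
        by_contra hne
        have h0 : 0 < t := lt_of_le_of_ne ht.1 (Ne.symm hne)
        rcases ht.2.eq_or_lt with rfl | h1
        · rw [pt_one] at hI; exact hI hx
        · exact hI (hs.symm (pt_mem_openSegment h0 h1))
      subst ht0
      rw [pt_zero] at hI
      obtain ⟨w, f, hE, hzw⟩ := hz.resolve_left hI
      obtain ⟨h, hh, hw, hf, hx0⟩ := exists_aff_edge hE hzw hs
      have hz0 : h z = 0 := isAff_zero_on_segment hh hw hf (openSegment_subset_segment ℝ _ _ hzw)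
      have h1 := eventually_sides hE hzw hh hw hf hx0 hs
      have h2 : Tendsto (fun e : Plane × ℝ => pt z e.1 e.2) (𝓝 (x, 0)) (𝓝 z) := by
        have := hcont.tendsto (x, 0); simpa [pt_zero] using this
      have h3 : ∀ᶠ e : Plane × ℝ in 𝓝 (x, (0 : ℝ)), 0 < h e.1 :=
        (hh.continuous.comp continuous_fst).tendsto (x, (0 : ℝ)) |>.eventually (lt_mem_nhds hx0)
      filter_upwards [h2.eventually h1, h3] with e he1 he2 he3
      apply he1.1
      rw [hh.pt, hz0]
      have := mul_pos he3 he2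
      linarith
  have := isCompact_Icc.eventually_forall_of_forall_eventually (x₀ := x)
    (P := fun x' t => 0 < t → pt z x' t ∈ D.I) (K := Icc (0 : ℝ) 1)
    (by simpa only [nhds_prod_eq] using key)
  filter_upwards [this] with x' hx'
  refine Sees.symm fun y hy => ?_
  obtain ⟨t, h0, h1, rfl⟩ := mem_openSegment_iff_pt.1 hy
  exact hx' t ⟨h0.le, h1.le⟩ h0

/-- The rays from interior points hit the frontier. -/
theorem exists_hit {x y : Plane} (hx : x ∈ D.I) (hxy : x ≠ y) :
    ∃ t : ℝ, 0 < t ∧ pt x y t ∈ D.F ∧ ∀ s, 0 ≤ s → s < t → pt x y s ∈ D.I := by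
  obtain ⟨R, hR⟩ := D.bdd.subset_ball x
  have hd : 0 < ‖y - x‖ := norm_pos_iff.2 (sub_ne_zero.2 hxy.symm)
  set M := (|R| + 1) / ‖y - x‖ with hM
  have hM0 : 0 < M := by positivity
  have hfar : pt x y M ∉ D.I := by
    intro h
    have := hR h
    rw [Metric.mem_ball, dist_eq_norm] at this
    have h2 : ‖pt x y M - x‖ = |R| + 1 := by
      unfold pt
      rw [add_sub_cancel_left, norm_smul, Real.norm_of_nonneg hM0.le, hM, div_mul_cancel₀ _ hd.ne']
    rw [h2] at this
    have := le_abs_self R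
    linarith
  obtain ⟨t, ht0, -, htn, hts⟩ := exists_first_exit D.isOpen_I hx hfar
  have hts' : ∀ s, 0 ≤ s → s < t * M → pt x y s ∈ D.I := by
    intro s hs0 hs
    have := hts (s / M) (by positivity) (by rw [div_lt_iff₀ hM0]; exact hs)
    rwa [pt_pt_right, div_mul_cancel₀ _ hM0.ne'] at this
  rw [pt_pt_right] at htn
  refine ⟨t * M, by positivity, ?_, hts'⟩
  by_contra hF
  refine htn (D.sub_I (segment ℝ x (pt x y (t * M))) (isPreconnected_segment _ _) ?_
    ⟨x, left_mem_segment ℝ _ _, hx⟩ (right_mem_segment ℝ _ _))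
  refine disjoint_left.2 fun z hz hzF => ?_
  obtain ⟨s, hs0, hs1, rfl⟩ := mem_segment_iff_pt.1 hz
  rw [pt_pt_right] at hzF
  rcases hs1.eq_or_lt with rfl | hs1
  · rw [one_mul] at hzF; exact hF hzF
  · have htM : 0 < t * M := by positivity
    exact notMem_F (hts' (s * (t * M)) (by positivity) (by nlinarith)) hzF

end Region

namespace Region
variable {D : Region}

/-- The configuration obtained by slightly turning the ray from `ξ` through `z` towards a visible
point `z1`. -/
structure WedgeCfg (D : Region) (ξ z z1 : Plane) where
  A : Plane → ℝ
  B : Plane → ℝ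
  g : Plane → ℝ
  σ : Plane
  w : Plane
  f : Plane
  l : ℝ
  R : ℝ
  T : ℝ
  hA : IsAff A
  hB : IsAff B
  hg : IsAff g
  inj : ∀ x y, A x = A y → B x = B y → x = y
  Aξ : A ξ = 0
  Az : A z = 1
  Az1 : A z1 = 0
  Bξ : B ξ = 0
  Bz : B z = 0
  Bz1 : B z1 = 1
  hl0 : 0 < l
  hl1 : l < 1
  hR : 1 < R
  V1 : ∀ q ∈ D.Vs, 0 < B q → l * A q < (1 - l) * B q
  hE : D.E w f
  hσ : σ ∈ openSegment ℝ w f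
  Aσ : A σ = R * (1 - l)
  Bσ : B σ = R * l
  see : D.Sees ξ σ
  Bw : B w ≤ 0
  ηw : (1 - l) * B w - l * A w < 0
  Bf : 0 < B f
  ηf : 0 < (1 - l) * B f - l * A f
  hT : 1 ≤ T
  hβ : pt ξ z T ∈ segment ℝ w σ
  gw : g w = 0
  gf : g f = 0
  gξ : 0 < g ξ
  Z_sub : ∀ x, 0 < B x → (1 - l) * B x - l * A x < 0 → 0 < g x → x ∈ D.I

/-- The turned ray when `z` is hidden behind a vertex `α`. -/
structure WinCfg (D : Region) (ξ z z1 : Plane) extends WedgeCfg D ξ z z1 where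
  α : Plane
  s : ℝ
  hα : α ∈ D.Vs
  Aα : A α = s
  Bα : B α = 0
  hs0 : 0 < s
  hs1 : s < 1
  last : ∀ q ∈ D.Vs, B q = 0 → s < A q → 1 ≤ A q
  V2 : ∀ q ∈ D.Vs, B q < 0 → l * (|B q| + |A q - s|) < (1 - s) * |B q|

theorem triangle_sub {ξ z z1 : Plane} {A B : Plane → ℝ} (hA : IsAff A) (hB : IsAff B)
    (inj : ∀ x y, A x = A y → B x = B y → x = y) (Aξ : A ξ = 0) (Az : A z = 1) (Az1 : A z1 = 0)
    (Bξ : B ξ = 0) (Bz : B z = 0) (Bz1 : B z1 = 1)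
    (hV : ∀ q ∈ segment ℝ z1 z, q ≠ z → q ∈ D.I ∧ D.Sees ξ q) {x : Plane} (hx : 0 ≤ A x)
    (hx' : 0 < B x) (hx'' : A x + B x ≤ 1) : x ∈ D.I := by
  set t := A x + B x with ht
  have ht0 : 0 < t := by linarith
  set q := pt z z1 (B x / t) with hq
  have hqA : A q = A x / t := by
    rw [hq, hA.pt, Az, Az1]; field_simp; linarith
  have hqB : B q = B x / t := by
    rw [hq, hB.pt, Bz, Bz1]; ring
  have hmem : q ∈ segment ℝ z1 z := by
    rw [segment_symm]
    exact pt_mem_segment (by positivity) (by rw [div_le_one ht0]; linarith)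
  have hqz : q ≠ z := by
    intro e
    rw [e, Bz] at hqB
    have : 0 < B x / t := by positivity
    linarith
  obtain ⟨h1, h2⟩ := hV q hmem hqz
  have hxq : x = pt ξ q t := by
    apply inj
    · rw [hA.pt, Aξ, hqA]; field_simp; ring
    · rw [hB.pt, Bξ, hqB]; field_simp; ring
  rcases hx''.eq_or_lt with e | e
  · rw [hxq, e, pt_one]; exact h1
  · rw [hxq]; exact h2 (pt_mem_openSegment ht0 e)

theorem cfg_core_sub {ξ σ w f p : Plane} {A B g : Plane → ℝ} {l R : ℝ} (hA : IsAff A) (hB : IsAff B)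
    (hg : IsAff g) (inj : ∀ x y, A x = A y → B x = B y → x = y) (Aξ : A ξ = 0) (Bξ : B ξ = 0)
    (hl0 : 0 < l) (hR : 1 < R)
    (V1 : ∀ q ∈ D.Vs, 0 < B q → l * A q < (1 - l) * B q) (hE : D.E w f)
    (Aσ : A σ = R * (1 - l)) (Bσ : B σ = R * l) (see : D.Sees ξ σ) (Bw : B w ≤ 0)
    (ηw : (1 - l) * B w - l * A w < 0)
    (Bf : 0 < B f)
    (ηf : 0 < (1 - l) * B f - l * A f) (gw : g w = 0) (gf : g f = 0) (gσ : g σ = 0) (gξ : 0 < g ξ)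
    (hp : D.Sees ξ p) (pB : 0 < B p) (pη : (1 - l) * B p - l * A p < 0) {x : Plane}
    (hx1 : 0 < B x) (hx2 : (1 - l) * B x - l * A x < 0) (hx3 : 0 < g x) : x ∈ D.I := by
  obtain ⟨η, hη⟩ : ∃ η : Plane → ℝ, η = fun x => (1 - l) * B x + (-l) * A x + 0 := ⟨_, rfl⟩
  have hηe : ∀ x, η x = (1 - l) * B x - l * A x := fun x => by rw [hη]; ring
  have hηA : IsAff η := by rw [hη]; exact hB.lin hA _ _ _
  rw [← hηe] at ηw ηf pη hx2
  have hRl : 0 < R * l := by positivity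
  have hconv : Convex ℝ (({x | 0 < B x} ∩ {x | 0 < - η x}) ∩ {x | 0 < g x}) :=
    (hB.convex_pos.inter hηA.neg.convex_pos).inter hg.convex_pos
  refine D.sub_I _ hconv.isPreconnected ?_ ?_ ⟨⟨hx1, by show 0 < - η x; linarith⟩, hx3⟩
  · refine disjoint_left.2 ?_
    rintro q ⟨⟨hq1, hq2⟩, hq3⟩ hqF
    have hq1 : 0 < B q := hq1
    have hq2 : 0 < - η q := hq2
    have hq3 : 0 < g q := hq3
    have H : ∀ p1 p2, D.E p1 p2 → q ∈ segment ℝ p1 p2 → 0 < B p1 → False := by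
      intro p1 p2 hp12 hqs hp1
      have ηp1 : 0 < η p1 := by
        have := V1 p1 (D.E_left _ _ hp12) hp1
        rw [hηe]; linarith
      have hden : 0 < η p1 - η q := by linarith
      obtain ⟨u, hu⟩ : ∃ u, u = - η q / (η p1 - η q) := ⟨_, rfl⟩
      have hu0 : 0 < u := by rw [hu]; positivity
      have hu1 : u < 1 := by rw [hu, div_lt_one hden]; linarith
      obtain ⟨y, hy⟩ : ∃ y, y = pt q p1 u := ⟨_, rfl⟩
      have hyη : η y = 0 := by rw [hy, hηA.pt, hu]; field_simp; ring
      have hyB : 0 < B y := by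
        rw [hy, hB.pt]
        linarith [mul_pos hu0 hp1, mul_pos (sub_pos.2 hu1) hq1]
      have hys : y ∈ segment ℝ p1 p2 := by
        rw [hy]
        exact (convex_segment p1 p2).segment_subset hqs (left_mem_segment ℝ _ _)
          (pt_mem_segment hu0.le hu1.le)
      have hyc : y = pt ξ σ (B y / (R * l)) := by
        apply inj
        · have h1 := hηe y
          rw [hyη] at h1
          rw [hA.pt ξ, Aξ, Aσ, zero_add, sub_zero, div_mul_eq_mul_div, eq_div_iff hRl.ne']
          linear_combination R * h1
        · rw [hB.pt ξ, Bξ, Bσ]; field_simp; ring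
      rcases lt_or_ge 0 (g y) with h | h
      · have hg1 : g y = (1 - B y / (R * l)) * g ξ := by
          conv_lhs => rw [hyc, hg.pt, gσ]
          ring
        have hc1 : B y / (R * l) < 1 := by
          by_contra hge
          push Not at hge
          rw [hg1] at h
          have := pos_of_mul_pos_left h gξ.le
          linarith
        have := see (pt_mem_openSegment (div_pos hyB hRl) hc1)
        rw [← hyc] at this
        exact notMem_F this (D.seg_sub _ _ hp12 hys)
      · have hden' : 0 < g q - g y := by linarith
        obtain ⟨u', hu'⟩ : ∃ u', u' = g q / (g q - g y) := ⟨_, rfl⟩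
        have hu'0 : 0 < u' := by rw [hu']; positivity
        have hu'1 : u' ≤ 1 := by rw [hu', div_le_one hden']; linarith
        obtain ⟨y', hy'⟩ : ∃ y', y' = pt q y u' := ⟨_, rfl⟩
        have hy'g : g y' = 0 := by rw [hy', hg.pt, hu']; field_simp; ring
        have hy'B : 0 < B y' := by
          rw [hy', hB.pt]
          linarith [mul_pos hu'0 hyB, mul_nonneg (sub_nonneg.2 hu'1) hq1.le]
        have hy'η : η y' ≤ 0 := by
          rw [hy', hηA.pt, hyη]
          linarith [mul_nonneg (sub_nonneg.2 hu'1) hq2.le]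
        have hy's : y' ∈ segment ℝ p1 p2 := by
          rw [hy']
          exact (convex_segment p1 p2).segment_subset hqs hys (pt_mem_segment hu'0.le hu'1)
        obtain ⟨c, hc⟩ := hg.exists_pt (D.E_ne _ _ hE) gw gf gξ.ne' hy'g
        have hcB : B y' = B w + c * (B f - B w) := by rw [hc, hB.pt]
        have hcη : η y' = η w + c * (η f - η w) := by rw [hc, hηA.pt]
        have hc0 : 0 < c := by
          by_contra hle
          push Not at hle
          have := mul_nonneg (neg_nonneg.2 hle) (show 0 ≤ B f - B w by linarith)
          linarith
        have hc1 : c < 1 := by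
          by_contra hge
          push Not at hge
          have := mul_nonneg (sub_nonneg.2 hge) (show 0 ≤ η f - η w by linarith)
          linarith
        rcases D.uniq _ _ _ _ _ hE hp12 (by rw [hc]; exact pt_mem_openSegment hc0 hc1) hy's with
          ⟨rfl, rfl⟩ | ⟨rfl, rfl⟩
        · exact hq3.ne' (isAff_zero_on_segment hg gw gf hqs)
        · exact hq3.ne' (isAff_zero_on_segment hg gf gw hqs)
    obtain ⟨p1, p2, hp12, hqs⟩ := D.cover q hqF
    rcases lt_or_ge 0 (B p1) with h1 | h1
    · exact H p1 p2 hp12 hqs h1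
    rcases lt_or_ge 0 (B p2) with h2 | h2
    · exact H p2 p1 (D.E_symm _ _ hp12) (by rwa [segment_symm]) h2
    obtain ⟨t, ht0, ht1, rfl⟩ := mem_segment_iff_pt.1 hqs
    rw [hB.pt] at hq1
    linarith [mul_nonneg ht0 (neg_nonneg.2 h2), mul_nonneg (sub_nonneg.2 ht1) (neg_nonneg.2 h1)]
  · obtain ⟨t, ht0, ht1, ht⟩ := exists_near (x := ξ) p
      (hg.continuous.tendsto ξ |>.eventually (lt_mem_nhds gξ))
    refine ⟨pt ξ p t, ⟨⟨?_, ?_⟩, ht⟩, hp (pt_mem_openSegment ht0 ht1)⟩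
    · show 0 < B (pt ξ p t)
      rw [hB.pt, Bξ]
      have := mul_pos ht0 pB
      linarith
    · show 0 < - η (pt ξ p t)
      have : η ξ = 0 := by rw [hηe, Aξ, Bξ]; ring
      rw [hηA.pt, this]
      have := mul_pos ht0 (neg_pos.2 pη)
      linarith


theorem eventually_pos_right {φ : ℝ → ℝ} (hc : ContinuousAt φ 0) (h : 0 < φ 0) :
    ∀ᶠ l in 𝓝[>] (0 : ℝ), 0 < φ l :=
  (hc.tendsto.mono_left nhdsWithin_le_nhds).eventually (lt_mem_nhds h)

theorem exists_wedge {ξ z z1 : Plane} {A B : Plane → ℝ} (hA : IsAff A) (hB : IsAff B)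
    (inj : ∀ x y, A x = A y → B x = B y → x = y) (Aξ : A ξ = 0) (Az : A z = 1) (Az1 : A z1 = 0)
    (Bξ : B ξ = 0) (Bz : B z = 0) (Bz1 : B z1 = 1)
    (hV : ∀ q ∈ segment ℝ z1 z, q ≠ z → q ∈ D.I ∧ D.Sees ξ q) {Φ : ℝ → Prop}
    (hev2 : ∀ᶠ l in 𝓝[>] (0 : ℝ), Φ l) :
    ∃ W : WedgeCfg D ξ z z1, W.A = A ∧ W.B = B ∧ Φ W.l := by
  classical
  -- the turning parameter
  have hev1 : ∀ᶠ l in 𝓝[>] (0 : ℝ), ∀ q ∈ D.Vs, 0 < B q → l * A q < (1 - l) * B q := by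
    rw [Filter.eventually_all_finset]
    intro q _
    by_cases h : 0 < B q
    · have hc : ContinuousAt (fun l : ℝ => (1 - l) * B q - l * A q) 0 := by fun_prop
      filter_upwards [eventually_pos_right hc (by linarith)] with l hl _ using by linarith
    · exact Eventually.of_forall fun l h' => absurd h' h
  have hev3 : ∀ᶠ l in 𝓝[>] (0 : ℝ), l ∈ Ioo (0 : ℝ) 1 := Ioo_mem_nhdsGT zero_lt_one
  obtain ⟨l, ⟨V1, V2⟩, hl0, hl1⟩ := ((hev1.and hev2).and hev3).exists
  have hzz : z ≠ z1 := by rintro rfl; linarith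
  have hpl : ∀ u, 0 < u → u < 1 → pt z z1 u ∈ D.I ∧ D.Sees ξ (pt z z1 u) := by
    intro u hu0 hu1
    refine hV _ (by rw [segment_symm]; exact pt_mem_segment hu0.le hu1.le) fun e => ?_
    have : pt z z1 u = pt z z1 0 := by rw [e, pt_zero]
    exact hu0.ne' (pt_injective hzz this)
  obtain ⟨p, hp⟩ : ∃ p, p = pt z z1 l := ⟨_, rfl⟩
  have hpI := hpl l hl0 hl1
  rw [← hp] at hpI
  have Ap : A p = 1 - l := by rw [hp, hA.pt, Az, Az1]; ring
  have Bp : B p = l := by rw [hp, hB.pt, Bz, Bz1]; ring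
  have hξp : ξ ≠ p := by rintro rfl; linarith
  obtain ⟨t, ht0, htF, hts⟩ := D.exists_hit hpI.1 (y := pt ξ p 2) (by
    intro e
    have e' : pt ξ p 1 = pt ξ p 2 := by rw [pt_one]; exact e
    have := pt_injective hξp e'
    linarith)
  have hptp : ∀ v, pt p (pt ξ p 2) v = pt ξ p (1 + v) := by
    intro v
    have := pt_pt ξ p 1 2 v
    rw [pt_one] at this
    rw [this]; congr 1; ring
  simp only [hptp] at htF hts
  obtain ⟨R, hR⟩ : ∃ R, R = 1 + t := ⟨_, rfl⟩
  have hR1 : 1 < R := by linarith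
  rw [← hR] at htF
  obtain ⟨σ, hσ⟩ : ∃ σ, σ = pt ξ p R := ⟨_, rfl⟩
  rw [← hσ] at htF
  have Aσ : A σ = R * (1 - l) := by rw [hσ, hA.pt, Aξ, Ap]; ring
  have Bσ : B σ = R * l := by rw [hσ, hB.pt, Bξ, Bp]; ring
  have hRl : 0 < R * l := by positivity
  have see : D.Sees ξ σ := by
    intro y hy
    obtain ⟨v, hv0, hv1, rfl⟩ := mem_openSegment_iff_pt.1 hy
    rw [hσ, pt_pt_right]
    have hvR : 0 < v * R := by positivity
    have hvR' : v * R < R := by nlinarith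
    rcases lt_or_ge (v * R) 1 with h | h
    · exact hpI.2 (pt_mem_openSegment hvR h)
    · have := hts (v * R - 1) (by linarith) (by linarith)
      rwa [show 1 + (v * R - 1) = v * R by ring] at this
  have hreg : D.Reg σ := reg_of_mem_F htF fun hv => by
    have := V1 σ hv (by rw [Bσ]; exact hRl)
    rw [Aσ, Bσ] at this
    nlinarith
  obtain ⟨η, hη⟩ : ∃ η : Plane → ℝ, η = fun x => (1 - l) * B x + (-l) * A x + 0 := ⟨_, rfl⟩
  have hηe : ∀ x, η x = (1 - l) * B x - l * A x := fun x => by rw [hη]; ring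
  have hηA : IsAff η := by rw [hη]; exact hB.lin hA _ _ _
  have hησ : η σ = 0 := by rw [hηe, Aσ, Bσ]; ring
  obtain ⟨w, f, hE, hwf, hle⟩ : ∃ w f, D.E w f ∧ σ ∈ openSegment ℝ w f ∧ η w ≤ η f := by
    obtain ⟨w, f, hE, hm⟩ := hreg
    rcases le_total (η w) (η f) with h | h
    · exact ⟨w, f, hE, hm, h⟩
    · exact ⟨f, w, D.E_symm _ _ hE, by rwa [openSegment_symm], h⟩
  obtain ⟨g, hg, gw, gf, gξ⟩ := exists_aff_edge hE hwf see
  obtain ⟨c, hc0, hc1, hc⟩ := mem_openSegment_iff_pt.1 hwf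
  have ec : 0 = η w + c * (η f - η w) := by rw [← hησ]; conv_lhs => rw [hc, hηA.pt]
  have eB : R * l = B w + c * (B f - B w) := by rw [← Bσ]; conv_lhs => rw [hc, hB.pt]
  have Bw : B w ≤ 0 := by
    by_contra h
    push Not at h
    have h1 := V1 w (D.E_left _ _ hE) h
    have h2 := hηe w
    have := mul_nonneg hc0.le (sub_nonneg.2 hle)
    linarith
  have Bf : 0 < B f := by
    by_contra h
    push Not at h
    have h1 := mul_nonneg hc0.le (neg_nonneg.2 h)
    have h2 := mul_nonneg (sub_nonneg.2 hc1.le) (neg_nonneg.2 Bw)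
    linarith
  have ηf : 0 < η f := by
    have h1 := V1 f (E_right hE) Bf
    have h2 := hηe f
    linarith
  have ηw : η w < 0 := by
    by_contra h
    push Not at h
    have h1 := mul_pos hc0 ηf
    have h2 := mul_nonneg (sub_nonneg.2 hc1.le) h
    linarith
  have gσ : g σ = 0 := isAff_zero_on_segment hg gw gf (openSegment_subset_segment ℝ _ _ hwf)
  -- the intersection of the edge with the ray through `z`
  have hden : 0 < B σ - B w := by rw [Bσ]; linarith
  obtain ⟨u, hu⟩ : ∃ u, u = - B w / (B σ - B w) := ⟨_, rfl⟩
  have hu0 : 0 ≤ u := by rw [hu]; exact div_nonneg (by linarith) hden.le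
  have hu1 : u < 1 := by rw [hu, div_lt_one hden, Bσ]; linarith
  obtain ⟨β, hβ⟩ : ∃ β, β = pt w σ u := ⟨_, rfl⟩
  have Bβ : B β = 0 := by rw [hβ, hB.pt, hu]; field_simp; ring
  have hβs : β ∈ segment ℝ w σ := by rw [hβ]; exact pt_mem_segment hu0 hu1.le
  have ηβ : η β = (1 - u) * η w := by rw [hβ, hηA.pt, hησ]; ring
  have hβT : β = pt ξ z (A β) :=
    inj _ _ (by rw [hA.pt, Aξ, Az]; ring) (by rw [hB.pt, Bξ, Bz, Bβ]; ring)
  have hT0 : 0 < A β := by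
    have h1 := hηe β
    rw [Bβ, ηβ] at h1
    have h2 := mul_pos (sub_pos.2 hu1) (neg_pos.2 ηw)
    by_contra h
    push Not at h
    have := mul_nonneg hl0.le (neg_nonneg.2 h)
    linarith
  have hT : 1 ≤ A β := by
    by_contra h
    push Not at h
    have hRT : 0 < R - A β := by linarith
    obtain ⟨ε, hε⟩ : ∃ ε, ε = (1 - A β) / (R - A β) := ⟨_, rfl⟩
    have hε0 : 0 < ε := by rw [hε]; exact div_pos (by linarith) hRT
    have hε1 : ε < 1 := by rw [hε, div_lt_one hRT]; linarith
    have hεe : ε * (R - A β) = 1 - A β := by rw [hε]; field_simp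
    have hy := triangle_sub hA hB inj Aξ Az Az1 Bξ Bz Bz1 hV (x := pt β σ ε)
      (by
        rw [hA.pt, Aσ]
        have h1 := mul_nonneg hε0.le (mul_nonneg (show 0 ≤ R by linarith) (sub_nonneg.2 hl1.le))
        have h2 := mul_nonneg (sub_nonneg.2 hε1.le) hT0.le
        linarith)
      (by rw [hB.pt, Bσ, Bβ]; have := mul_pos hε0 hRl; linarith)
      (by rw [hA.pt, hB.pt, Aσ, Bσ, Bβ]; linarith)
    refine notMem_F hy (D.seg_sub _ _ hE ?_)
    have hσs := openSegment_subset_segment ℝ _ _ hwf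
    exact (convex_segment w f).segment_subset
      ((convex_segment w f).segment_subset (left_mem_segment ℝ _ _) hσs hβs) hσs
      (pt_mem_segment hε0.le hε1.le)
  have hp2 := hpl (l / 2) (by linarith) (by linarith)
  refine ⟨⟨A, B, g, σ, w, f, l, R, A β, hA, hB, hg, inj, Aξ, Az, Az1, Bξ, Bz, Bz1,
    hl0, hl1, hR1, V1, hE, hwf, Aσ, Bσ, see, Bw, ?_, Bf, ?_, hT, ?_, gw, gf,
    gξ, ?_⟩, rfl, rfl, V2⟩
  · rw [← hηe]; exact ηw
  · rw [← hηe]; exact ηf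
  · rw [← hβT]; exact hβs
  · intro x hx1 hx2 hx3
    refine cfg_core_sub hA hB hg inj Aξ Bξ hl0 hR1 V1 hE Aσ Bσ see Bw (by rw [← hηe]; exact ηw) Bf
      (by rw [← hηe]; exact ηf) gw gf gσ gξ hp2.2 ?_ ?_ hx1 hx2 hx3
    · rw [hB.pt, Bz, Bz1]; linarith
    · rw [hB.pt, hA.pt, Bz, Bz1, Az, Az1]; nlinarith

theorem exists_winCfg {ξ z z1 : Plane} (hdt : dt ξ z z1 ≠ 0)
    (hV : ∀ q ∈ segment ℝ z1 z, q ≠ z → q ∈ D.I ∧ D.Sees ξ q)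
    (hvert : ∃ q ∈ D.Vs, q ∈ openSegment ℝ ξ z) : Nonempty (WinCfg D ξ z z1) := by
  classical
  obtain ⟨A, B, hA, hB, Aξ, Az, Az1, Bξ, Bz, Bz1, inj⟩ := exists_frame hdt
  -- the last hiding vertex
  obtain ⟨α, hαm, hαmax⟩ := Finset.exists_max_image (D.Vs.filter (· ∈ openSegment ℝ ξ z)) A
    (by obtain ⟨q, hq, hq'⟩ := hvert; exact ⟨q, Finset.mem_filter.2 ⟨hq, hq'⟩⟩)
  obtain ⟨hα, hαo⟩ := Finset.mem_filter.1 hαm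
  obtain ⟨s, hs0, hs1, hαs⟩ := mem_openSegment_iff_pt.1 hαo
  have Aα : A α = s := by rw [hαs, hA.pt, Aξ, Az]; ring
  have Bα : B α = 0 := by rw [hαs, hB.pt, Bξ, Bz]; ring
  have last : ∀ q ∈ D.Vs, B q = 0 → s < A q → 1 ≤ A q := by
    intro q hq hBq hsq
    by_contra hlt
    push Not at hlt
    have : q = pt ξ z (A q) := inj _ _ (by rw [hA.pt, Aξ, Az]; ring) (by rw [hB.pt, Bξ, Bz, hBq]; ring)
    have := hαmax q (Finset.mem_filter.2 ⟨hq, by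
      rw [this]; exact pt_mem_openSegment (by linarith) hlt⟩)
    linarith
  have hev2 : ∀ᶠ l in 𝓝[>] (0 : ℝ), ∀ q ∈ D.Vs, B q < 0 →
      l * (|B q| + |A q - s|) < (1 - s) * |B q| := by
    rw [Filter.eventually_all_finset]
    intro q _
    by_cases h : B q < 0
    · have hc : ContinuousAt (fun l : ℝ => (1 - s) * |B q| - l * (|B q| + |A q - s|)) 0 := by
        fun_prop
      have h0 : (0 : ℝ) < (1 - s) * |B q| - 0 * (|B q| + |A q - s|) := by
        have := mul_pos (sub_pos.2 hs1) (abs_pos.2 h.ne)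
        linarith
      filter_upwards [eventually_pos_right hc h0] with l hl _ using by linarith
    · exact Eventually.of_forall fun l h' => absurd h' h
  obtain ⟨W, hWA, hWB, V2⟩ := exists_wedge hA hB inj Aξ Az Az1 Bξ Bz Bz1 hV hev2
  subst hWA hWB
  exact ⟨⟨W, α, s, hα, Aα, Bα, hs0, hs1, last, V2⟩⟩

end Region

/-- A regular point `σ` of the edge `w f` seeing a vertex `a`, with a neighbour `r` of `a` on the
side of `w` of the chord `a σ`. -/
structure Pocket (D : Region) where
  a : Plane
  σ : Plane
  w : Plane
  f : Plane
  r : Plane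
  hc : Plane → ℝ
  he : Plane → ℝ
  ha : a ∈ D.Vs
  hE : D.E w f
  hσ : σ ∈ openSegment ℝ w f
  see : D.Sees a σ
  hcA : IsAff hc
  heA : IsAff he
  hca : hc a = 0
  hcσ : hc σ = 0
  hcw : 0 < hc w
  hcr : 0 < hc r
  har : D.E a r
  hew : he w = 0
  hef : he f = 0
  hea : 0 < he a
  r_mem : r ∈ connectedComponentIn (D.P \ segment ℝ a σ) w
  S2 : ∀ x ∈ openSegment ℝ a σ, ∀ᶠ y in 𝓝 x,
    (0 < hc y → y ∈ connectedComponentIn (D.P \ segment ℝ a σ) w) ∧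
    (hc y < 0 → y ∉ connectedComponentIn (D.P \ segment ℝ a σ) w)

/-- The part of the region cut off by the chord of a pocket. -/
def Pocket.U {D : Region} (Q : Pocket D) : Set Plane :=
  connectedComponentIn (D.P \ segment ℝ Q.a Q.σ) Q.w

/-- The pocket which contains `z`, hidden from `ξ`; `z1` determines the turning direction. -/
structure Win (D : Region) (ξ z z1 : Plane) extends Pocket D where
  T : ℝ
  ρ : Plane → ℝ
  η : Plane → ℝ
  ρA : IsAff ρ
  ηA : IsAff η
  a_mem : a ∈ openSegment ℝ ξ z
  see_ξσ : D.Sees ξ σ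
  see_ξ : ∀ x ∈ openSegment ℝ a σ, D.Sees ξ x
  hcf : hc f < 0
  hcξ : hc ξ < 0
  hcz : 0 < hc z
  heξ : 0 < he ξ
  ρξ : ρ ξ = 0
  ρz : ρ z = 0
  ρz1 : 0 < ρ z1
  ρσ : 0 < ρ σ
  ρw : ρ w ≤ 0
  ρf : 0 < ρ f
  ρa : ∀ n, D.E a n → ρ n ≤ 0
  ηξ : η ξ = 0
  ησ : η σ = 0
  ηz : η z < 0
  ηa : η a < 0
  ηz1 : 0 < η z1
  ηρ : ∀ q ∈ D.Vs, 0 < ρ q → 0 < η q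
  ξU : ξ ∉ toPocket.U
  fU : f ∉ toPocket.U
  zU : z ∈ toPocket.U
  hV : ∀ q ∈ segment ℝ z1 z, q ≠ z → q ∈ D.I ∧ D.Sees ξ q
  hT : 1 ≤ T
  hβ : pt ξ z T ∈ segment ℝ w σ
  SL : ∀ x ∈ openSegment ℝ a σ, ∀ y, D.Sees x y → 0 < hc y → 0 < ρ y → D.Sees ξ y
  cross : ∃ x ∈ openSegment ℝ a σ, x ∈ openSegment ℝ z1 z
  posA : ∀ g, IsAff g → g ξ = 0 → 0 < g z → 0 < g z1 → 0 < g σ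

theorem mem_openSegment_symm_pt (x y : Plane) (ε : ℝ) : x ∈ segment ℝ (pt x y ε) (pt x y (-ε)) := by
  rw [mem_segment_iff_pt]
  refine ⟨1 / 2, by norm_num, by norm_num, ?_⟩
  rw [pt_pt, show ε + 1 / 2 * (-ε - ε) = 0 by ring, pt_zero]

namespace Region.WinCfg
variable {D : Region} {ξ z z1 : Plane} (C : WinCfg D ξ z z1)

def η (x : Plane) : ℝ := (1 - C.l) * C.B x - C.l * C.A x

def ψ (x : Plane) : ℝ := C.l * C.R * (C.A x - C.s) - (C.R * (1 - C.l) - C.s) * C.B x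

theorem ηA : IsAff C.η := by
  have : C.η = fun x => (1 - C.l) * C.B x + (-C.l) * C.A x + 0 := by
    funext x; unfold η; ring
  rw [this]; exact C.hB.lin C.hA _ _ _

theorem ψA : IsAff C.ψ := by
  have : C.ψ = fun x => (C.l * C.R) * C.A x + (-(C.R * (1 - C.l) - C.s)) * C.B x +
      (- (C.l * C.R * C.s)) := by
    funext x; unfold ψ; ring
  rw [this]; exact C.hA.lin C.hB _ _ _

theorem lR : 0 < C.l * C.R := mul_pos C.hl0 (by linarith [C.hR])

theorem gσ : C.g C.σ = 0 :=
  isAff_zero_on_segment C.hg C.gw C.gf (openSegment_subset_segment ℝ _ _ C.hσ)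

theorem ησ : C.η C.σ = 0 := by unfold η; rw [C.Aσ, C.Bσ]; ring
theorem ηξ : C.η ξ = 0 := by unfold η; rw [C.Aξ, C.Bξ]; ring
theorem ηα : C.η C.α = -(C.l * C.s) := by unfold η; rw [C.Aα, C.Bα]; ring
theorem ηα_neg : C.η C.α < 0 := by rw [ηα]; linarith [mul_pos C.hl0 C.hs0]
theorem ψσ : C.ψ C.σ = 0 := by unfold ψ; rw [C.Aσ, C.Bσ]; ring
theorem ψα : C.ψ C.α = 0 := by unfold ψ; rw [C.Aα, C.Bα]; ring
theorem ψξ : C.ψ ξ < 0 := by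
  unfold ψ; rw [C.Aξ, C.Bξ]; linarith [mul_pos C.lR C.hs0]
theorem ψ_of_B {x : Plane} (h : C.B x = 0) (h' : C.s < C.A x) : 0 < C.ψ x := by
  unfold ψ; rw [h]; linarith [mul_pos C.lR (sub_pos.2 h')]
theorem ψz : 0 < C.ψ z := C.ψ_of_B C.Bz (by rw [C.Az]; exact C.hs1)
theorem Bσ_pos : 0 < C.B C.σ := by rw [C.Bσ]; linarith [C.lR]

theorem gβ : C.g (pt ξ z C.T) = 0 := by
  have := C.hβ
  refine isAff_zero_on_segment C.hg C.gw C.gσ this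

theorem Aβ : C.A (pt ξ z C.T) = C.T := by rw [C.hA.pt, C.Aξ, C.Az]; ring
theorem Bβ : C.B (pt ξ z C.T) = 0 := by rw [C.hB.pt, C.Bξ, C.Bz]; ring

theorem gz : 0 ≤ C.g z := by
  have h := C.gβ
  rw [C.hg.pt] at h
  have h1 := C.hT
  have h2 := C.gξ
  have h3 := mul_nonneg (sub_nonneg.2 h1) h2.le
  have : 0 ≤ C.T * C.g z := by linarith
  exact nonneg_of_mul_nonneg_right this (by linarith)

theorem α_eq : C.α = pt ξ z C.s :=
  C.inj _ _ (by rw [C.hA.pt, C.Aξ, C.Az, C.Aα]; ring) (by rw [C.hB.pt, C.Bξ, C.Bz, C.Bα]; ring)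

theorem gα : 0 < C.g C.α := by
  rw [α_eq, C.hg.pt]
  have h1 := mul_pos (sub_pos.2 C.hs1) C.gξ
  have h2 := mul_nonneg C.hs0.le C.gz
  linarith

theorem ψw : 0 < C.ψ C.w := by
  obtain ⟨u, hu0, hu1, hu⟩ := mem_segment_iff_pt.1 C.hβ
  have h1 : 0 < C.ψ (pt ξ z C.T) := C.ψ_of_B C.Bβ (by rw [C.Aβ]; linarith [C.hs1, C.hT])
  rw [hu, C.ψA.pt, C.ψσ] at h1
  have h2 : 0 < (1 - u) * C.ψ C.w := by linarith
  exact pos_of_mul_pos_right h2 (by linarith)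

theorem ψf : C.ψ C.f < 0 := by
  obtain ⟨c, hc0, hc1, hc⟩ := mem_openSegment_iff_pt.1 C.hσ
  have h1 := C.ψσ
  rw [hc, C.ψA.pt] at h1
  have h2 := mul_pos (sub_pos.2 hc1) C.ψw
  by_contra h
  push Not at h
  have := mul_nonneg hc0.le h
  linarith

/-- The open triangle seen by `ξ`. -/
def Z : Set Plane := ({x | 0 < C.B x} ∩ {x | 0 < - C.η x}) ∩ {x | 0 < C.g x}

theorem convex_Z : Convex ℝ C.Z :=
  (C.hB.convex_pos.inter C.ηA.neg.convex_pos).inter C.hg.convex_pos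

theorem isOpen_Z : IsOpen C.Z :=
  (C.hB.isOpen_pos.inter C.ηA.neg.isOpen_pos).inter C.hg.isOpen_pos

theorem mem_Z {x : Plane} (h1 : 0 < C.B x) (h2 : C.η x < 0) (h3 : 0 < C.g x) : x ∈ C.Z :=
  ⟨⟨h1, by show 0 < - C.η x; linarith⟩, h3⟩

theorem Z_sub_I {x : Plane} (h : x ∈ C.Z) : x ∈ D.I :=
  C.Z_sub x h.1.1 (by have : 0 < - C.η x := h.1.2; unfold η at this; linarith) h.2

theorem Z_sees {x : Plane} (h : x ∈ C.Z) : D.Sees ξ x := by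
  intro y hy
  obtain ⟨t, ht0, ht1, rfl⟩ := mem_openSegment_iff_pt.1 hy
  have h1 : 0 < C.B x := h.1.1
  have h2 : 0 < - C.η x := h.1.2
  have h3 : 0 < C.g x := h.2
  apply C.Z_sub_I
  apply C.mem_Z
  · rw [C.hB.pt, C.Bξ]; linarith [mul_pos ht0 h1]
  · rw [C.ηA.pt, C.ηξ]; linarith [mul_pos ht0 h2]
  · rw [C.hg.pt]; linarith [mul_pos ht0 h3, mul_pos (sub_pos.2 ht1) C.gξ]

theorem chord_Z {x : Plane} (h : x ∈ openSegment ℝ C.α C.σ) : x ∈ C.Z := by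
  obtain ⟨t, ht0, ht1, rfl⟩ := mem_openSegment_iff_pt.1 h
  apply C.mem_Z
  · rw [C.hB.pt, C.Bα]; linarith [mul_pos ht0 C.Bσ_pos]
  · rw [C.ηA.pt, C.ησ]; linarith [mul_pos (sub_pos.2 ht1) (neg_pos.2 C.ηα_neg)]
  · rw [C.hg.pt, C.gσ]; linarith [mul_pos (sub_pos.2 ht1) C.gα]

theorem seg_ψ {x : Plane} (h : x ∈ segment ℝ C.α C.σ) : C.ψ x = 0 :=
  isAff_zero_on_segment C.ψA C.ψα C.ψσ h

theorem mid_mem : pt C.α C.σ (1 / 2) ∈ openSegment ℝ C.α C.σ :=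
  pt_mem_openSegment (by norm_num) (by norm_num)

/-- A point lies in `P` if points of the region accumulate at it along a segment. -/
theorem _root_.Region.mem_P_of_near {D : Region} {x y : Plane}
    (h : ∀ᶠ t in 𝓝[>] (0 : ℝ), pt x y t ∈ D.P) : x ∈ D.P :=
  D.isClosed_P.mem_of_tendsto (tendsto_pt_zero x y) h

theorem K_sub {x : Plane} (h1 : 0 ≤ C.B x) (h2 : C.η x ≤ 0) (h3 : 0 ≤ C.g x) : x ∈ D.P := by
  have h0 := C.chord_Z C.mid_mem
  set y := pt C.α C.σ (1 / 2)
  have k1 : 0 < C.B y := h0.1.1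
  have k2 : 0 < - C.η y := h0.1.2
  have k3 : 0 < C.g y := h0.2
  apply mem_P_of_near (y := y)
  filter_upwards [Ioo_mem_nhdsGT (zero_lt_one' ℝ)] with t ht
  left
  apply C.Z_sub_I
  have ht1 := sub_nonneg.2 ht.2.le
  apply C.mem_Z
  · rw [C.hB.pt]; linarith [mul_pos ht.1 k1, mul_nonneg ht1 h1]
  · rw [C.ηA.pt]; linarith [mul_pos ht.1 k2, mul_nonneg ht1 (neg_nonneg.2 h2)]
  · rw [C.hg.pt]; linarith [mul_pos ht.1 k3, mul_nonneg ht1 h3]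

def U : Set Plane := connectedComponentIn (D.P \ segment ℝ C.α C.σ) C.w

theorem mem_base {x : Plane} (hx : x ∈ D.P) (h : C.ψ x ≠ 0) : x ∈ D.P \ segment ℝ C.α C.σ :=
  ⟨hx, fun h' => h (C.seg_ψ h')⟩

theorem absorb {K : Set Plane} {x : Plane} (hK : Convex ℝ K) (hP : ∀ y ∈ K, y ∈ D.P)
    (hψ : ∀ y ∈ K, C.ψ y ≠ 0) (hxK : x ∈ K) (hx : x ∈ C.U) : K ⊆ C.U :=
  comp_absorb hK.isPreconnected (fun y hy => C.mem_base (hP y hy) (hψ y hy)) hxK hx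

theorem w_mem : C.w ∈ C.U :=
  mem_connectedComponentIn (C.mem_base (Or.inr (vertex_mem_F (D.E_left _ _ C.hE))) C.ψw.ne')

theorem β_mem : pt ξ z C.T ∈ C.U := by
  have hsub : ∀ y ∈ segment ℝ C.w (pt ξ z C.T), y ∈ segment ℝ C.w C.σ := fun y hy =>
    (convex_segment _ _).segment_subset (left_mem_segment ℝ _ _) C.hβ hy
  refine C.absorb (convex_segment C.w (pt ξ z C.T)) ?_ ?_ (left_mem_segment ℝ _ _) C.w_mem
    (right_mem_segment ℝ _ _)
  · intro y hy
    exact Or.inr (D.seg_sub _ _ C.hE ((convex_segment _ _).segment_subset (left_mem_segment ℝ _ _)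
      (openSegment_subset_segment ℝ _ _ C.hσ) (hsub y hy)))
  · intro y hy
    obtain ⟨t, ht0, ht1, rfl⟩ := mem_segment_iff_pt.1 hy
    have h1 : 0 < C.ψ (pt ξ z C.T) := C.ψ_of_B C.Bβ (by rw [C.Aβ]; linarith [C.hs1, C.hT])
    have h2 := C.ψw
    rw [C.ψA.pt]
    rcases ht0.eq_or_lt with rfl | ht0
    · simpa using h2.ne'
    · have := mul_pos ht0 h1
      have := mul_nonneg (sub_nonneg.2 ht1) h2.le
      linarith

theorem K4_sub {x : Plane} (h1 : 0 ≤ C.B x) (h2 : C.η x ≤ 0) (h3 : 0 ≤ C.g x) (h4 : 0 < C.ψ x) :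
    x ∈ C.U := by
  have hconv : Convex ℝ ((({x | 0 ≤ C.B x} ∩ {x | 0 ≤ - C.η x}) ∩ {x | 0 ≤ C.g x}) ∩
      {x | 0 < C.ψ x}) :=
    ((C.hB.convex_nonneg.inter C.ηA.neg.convex_nonneg).inter C.hg.convex_nonneg).inter
      C.ψA.convex_pos
  refine C.absorb hconv ?_ ?_ ?_ C.β_mem ⟨⟨⟨h1, ?_⟩, h3⟩, h4⟩
  · rintro y ⟨⟨⟨k1, k2⟩, k3⟩, -⟩
    have k2 : 0 ≤ - C.η y := k2
    exact C.K_sub k1 (by linarith) k3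
  · rintro y ⟨-, k⟩; exact ne_of_gt k
  · refine ⟨⟨⟨C.Bβ.ge, ?_⟩, C.gβ.ge⟩, C.ψ_of_B C.Bβ (by rw [C.Aβ]; linarith [C.hs1, C.hT])⟩
    show 0 ≤ - C.η (pt ξ z C.T)
    unfold η
    rw [C.Aβ, C.Bβ]
    have := mul_pos C.hl0 (show 0 < C.T by linarith [C.hT])
    linarith
  · show 0 ≤ - C.η x; linarith

theorem sees_ασ : D.Sees C.α C.σ := fun _ hx => C.Z_sub_I (C.chord_Z hx)

theorem exists_both_sides : ∃ A0 B0, A0 ∈ C.Z ∧ B0 ∈ C.Z ∧ 0 < C.ψ A0 ∧ C.ψ B0 < 0 ∧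
    pt C.α C.σ (1 / 2) ∈ segment ℝ A0 B0 := by
  set y := pt C.α C.σ (1 / 2)
  have hy : y ∈ C.Z := C.chord_Z C.mid_mem
  have hψy : C.ψ y = 0 := C.seg_ψ (openSegment_subset_segment ℝ _ _ C.mid_mem)
  have hc1 : ∀ᶠ ε in 𝓝[>] (0 : ℝ), pt y z ε ∈ C.Z :=
    (tendsto_pt_zero y z).eventually (C.isOpen_Z.mem_nhds hy)
  have hc2 : ∀ᶠ ε in 𝓝[>] (0 : ℝ), pt y z (-ε) ∈ C.Z := by
    have h1 : ContinuousAt (fun ε : ℝ => pt y z (-ε)) 0 := by unfold pt; fun_prop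
    have h2 := h1.tendsto
    rw [neg_zero, pt_zero] at h2
    exact (h2.mono_left nhdsWithin_le_nhds).eventually (C.isOpen_Z.mem_nhds hy)
  have hc3 : ∀ᶠ ε in 𝓝[>] (0 : ℝ), 0 < ε := eventually_mem_nhdsWithin
  obtain ⟨ε, ⟨h1, h2⟩, h3⟩ := ((hc1.and hc2).and hc3).exists
  have := mul_pos h3 C.ψz
  refine ⟨_, _, h1, h2, ?_, ?_, mem_openSegment_symm_pt y z ε⟩
  · rw [C.ψA.pt, hψy]; linarith
  · rw [C.ψA.pt, hψy]; linarith

theorem K3_disj {x : Plane} (h1 : 0 ≤ C.B x) (h2 : C.η x ≤ 0) (h3 : 0 ≤ C.g x) (h4 : C.ψ x < 0) :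
    x ∉ C.U := by
  intro hx
  obtain ⟨A0, B0, hA, hB, hψA, hψB, hm⟩ := C.exists_both_sides
  have hA' : A0 ∈ C.U := C.K4_sub (le_of_lt hA.1.1)
    (by have : 0 < - C.η A0 := hA.1.2; linarith) (le_of_lt hA.2) hψA
  refine D.sep C.α C.w C.f C.σ C.hα C.hE C.hσ C.sees_ασ C.ψ C.ψA C.ψα C.ψσ A0 B0
    (pt C.α C.σ (1 / 2)) C.U ?_ C.mid_mem hm hψA hψB isPreconnected_connectedComponentIn
    (connectedComponentIn_subset _ _) hA' ?_
  · intro y hy; exact C.Z_sub_I (C.convex_Z.segment_subset hA hB hy)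
  have hconv : Convex ℝ ((({x | 0 ≤ C.B x} ∩ {x | 0 ≤ - C.η x}) ∩ {x | 0 ≤ C.g x}) ∩
      {x | 0 < - C.ψ x}) :=
    ((C.hB.convex_nonneg.inter C.ηA.neg.convex_nonneg).inter C.hg.convex_nonneg).inter
      C.ψA.neg.convex_pos
  refine C.absorb hconv ?_ ?_ ⟨⟨⟨h1, ?_⟩, h3⟩, ?_⟩ hx
    ⟨⟨⟨show 0 ≤ C.B B0 from le_of_lt hB.1.1, show 0 ≤ - C.η B0 from le_of_lt hB.1.2⟩,
    show 0 ≤ C.g B0 from le_of_lt hB.2⟩, ?_⟩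
  · rintro y ⟨⟨⟨k1, k2⟩, k3⟩, -⟩
    have k2 : 0 ≤ - C.η y := k2
    exact C.K_sub k1 (by linarith) k3
  · rintro y ⟨-, k⟩
    have k : 0 < - C.ψ y := k
    linarith
  · show 0 ≤ - C.η x; linarith
  · show 0 < - C.ψ x; linarith
  · show 0 < - C.ψ B0; linarith

theorem ξ_notMem : ξ ∉ C.U := C.K3_disj C.Bξ.ge C.ηξ.le C.gξ.le C.ψξ

theorem z_mem : z ∈ C.U :=
  C.K4_sub C.Bz.ge (by unfold η; rw [C.Bz, C.Az]; linarith [C.hl0]) C.gz C.ψz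

theorem f_notMem : C.f ∉ C.U := by
  intro hf
  have hψf := C.ψf
  have hev := eventually_sides C.hE C.hσ C.hg C.gw C.gf C.gξ C.see
  obtain ⟨ε, hε, hball⟩ := Metric.eventually_nhds_iff_ball.1 hev
  have hmem : ∀ᶠ x in 𝓝 C.σ, x ∈ Metric.ball C.σ ε := Metric.ball_mem_nhds _ hε
  obtain ⟨t, ht0, ht1, ht⟩ := exists_near C.f hmem
  obtain ⟨t', ht0', ht1', ht'⟩ := exists_near ξ hmem
  -- from `f` to a point near `σ` on the edge
  have h1 : pt C.σ C.f t ∈ C.U := by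
    refine C.absorb (convex_segment (pt C.σ C.f t) C.f) ?_ ?_ (right_mem_segment ℝ _ _) hf
      (left_mem_segment ℝ _ _)
    · intro y hy
      have hσs := openSegment_subset_segment ℝ _ _ C.hσ
      refine Or.inr (D.seg_sub _ _ C.hE ((convex_segment _ _).segment_subset
        ((convex_segment _ _).segment_subset hσs (right_mem_segment ℝ _ _)
          (pt_mem_segment ht0.le ht1.le)) (right_mem_segment ℝ _ _) hy))
    · intro y hy
      obtain ⟨v, hv0, hv1, rfl⟩ := mem_segment_iff_pt.1 hy
      rw [C.ψA.pt, C.ψA.pt, C.ψσ]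
      have e1 := mul_pos ht0 (neg_pos.2 hψf)
      have e2 := mul_nonneg hv0 (mul_nonneg (sub_nonneg.2 ht1.le) (neg_nonneg.2 hψf.le))
      have : 0 + t * (C.ψ C.f - 0) + v * (C.ψ C.f - (0 + t * (C.ψ C.f - 0))) < 0 := by linarith
      exact this.ne
  have hconv : Convex ℝ (({x | 0 ≤ C.g x} ∩ {x | 0 < - C.ψ x}) ∩ Metric.ball C.σ ε) :=
    (C.hg.convex_nonneg.inter C.ψA.neg.convex_pos).inter (convex_ball _ _)
  have h2 : pt C.σ ξ t' ∈ C.U := by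
    refine C.absorb hconv ?_ ?_ ⟨⟨?_, ?_⟩, ht⟩ h1 ⟨⟨?_, ?_⟩, ht'⟩
    · rintro y ⟨⟨k1, -⟩, k2⟩
      have k1 : 0 ≤ C.g y := k1
      apply mem_P_of_near (y := ξ)
      have : ∀ᶠ t in 𝓝[>] (0 : ℝ), pt y ξ t ∈ Metric.ball C.σ ε :=
        (tendsto_pt_zero y ξ).eventually (Metric.isOpen_ball.mem_nhds k2)
      filter_upwards [this, Ioo_mem_nhdsGT (zero_lt_one' ℝ)] with u hu hu'
      refine Or.inl ((hball _ hu).1 ?_)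
      rw [C.hg.pt]
      linarith [mul_pos hu'.1 C.gξ, mul_nonneg (sub_nonneg.2 hu'.2.le) k1]
    · rintro y ⟨⟨-, k⟩, -⟩
      have k : 0 < - C.ψ y := k
      linarith
    · show 0 ≤ C.g (pt C.σ C.f t); rw [C.hg.pt, C.gσ, C.gf]; linarith
    · show 0 < - C.ψ (pt C.σ C.f t); rw [C.ψA.pt, C.ψσ]
      linarith [mul_pos ht0 (neg_pos.2 hψf)]
    · show 0 ≤ C.g (pt C.σ ξ t'); rw [C.hg.pt, C.gσ]; linarith [mul_pos ht0' C.gξ]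
    · show 0 < - C.ψ (pt C.σ ξ t'); rw [C.ψA.pt, C.ψσ]
      linarith [mul_pos ht0' (neg_pos.2 C.ψξ)]
  refine C.K3_disj ?_ ?_ ?_ ?_ h2
  · rw [C.hB.pt, C.Bξ]; linarith [mul_pos (sub_pos.2 ht1') C.Bσ_pos]
  · rw [C.ηA.pt, C.ηξ, C.ησ]; linarith
  · rw [C.hg.pt, C.gσ]; linarith [mul_pos ht0' C.gξ]
  · rw [C.ψA.pt, C.ψσ]; linarith [mul_pos ht0' (neg_pos.2 C.ψξ)]


theorem nbr_B {n : Plane} (hn : D.E C.α n) : C.B n ≤ 0 := by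
  by_contra h
  push Not at h
  have h1 : ∀ᶠ y in 𝓝 C.α, 0 < - C.η y :=
    (C.ηA.neg.continuous.tendsto C.α).eventually (lt_mem_nhds (neg_pos.2 C.ηα_neg))
  have h2 : ∀ᶠ y in 𝓝 C.α, 0 < C.g y :=
    (C.hg.continuous.tendsto C.α).eventually (lt_mem_nhds C.gα)
  obtain ⟨t, ht0, ht1, k1, k2⟩ := exists_near n (h1.and h2)
  refine notMem_F (C.Z_sub_I (C.mem_Z (x := pt C.α n t) ?_ (by linarith) k2))
    (D.seg_sub _ _ hn (pt_mem_segment ht0.le ht1.le))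
  rw [C.hB.pt, C.Bα]
  linarith [mul_pos ht0 h]

theorem nbr_ne {n : Plane} (hn : D.E C.α n) (hB : C.B n = 0) : C.A n ≠ C.s := fun h =>
  D.E_ne _ _ hn (C.inj _ _ (by rw [h, C.Aα]) (by rw [hB, C.Bα]))

theorem ψ_of_neg {n : Plane} (hn : n ∈ D.Vs) (hB : C.B n < 0) : 0 < C.ψ n := by
  have h2 := C.V2 n hn hB
  have hR0 : 0 < C.R := by linarith [C.hR]
  have h3 := mul_lt_mul_of_pos_left h2 hR0
  have h4 := mul_nonneg C.lR.le (by linarith [neg_abs_le (C.A n - C.s)] :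
    0 ≤ C.A n - C.s + |C.A n - C.s|)
  rw [abs_of_neg hB] at h3
  have h5 := mul_pos (mul_pos (sub_pos.2 C.hR) C.hs0) (neg_pos.2 hB)
  unfold ψ
  nlinarith

theorem exists_r_aux {n m : Plane} (hn : D.E C.α n) (hBn : C.B n < 0)
    (hall : ∀ v, D.E C.α v → v = n ∨ v = m)
    (hm : (C.A m - C.s) * (-C.B n) ≤ (C.A n - C.s) * (-C.B m)) : n ∈ C.U := by
  have hψn := C.ψ_of_neg (E_right hn) hBn
  obtain ⟨Y, hY⟩ : ∃ Y : Plane → ℝ, Y = fun x => (1 / C.B n) * C.B x + 0 * C.A x + 0 := ⟨_, rfl⟩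
  have YA : IsAff Y := by rw [hY]; exact C.hB.lin C.hA _ _ _
  obtain ⟨X, hX⟩ : ∃ X : Plane → ℝ, X = fun x => 1 * C.A x + (-(C.A n - C.s)) * Y x + (-C.s) :=
    ⟨_, rfl⟩
  have XA : IsAff X := by rw [hX]; exact C.hA.lin YA _ _ _
  have Yα : Y C.α = 0 := by rw [hY]; simp [C.Bα]
  have Yz : Y z = 0 := by rw [hY]; simp [C.Bz]
  have Yn : Y n = 1 := by rw [hY]; simp; field_simp [hBn.ne]
  have Xα : X C.α = 0 := by rw [hX]; simp [C.Aα, Yα]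
  have Xz : X z = 1 - C.s := by rw [hX]; simp [C.Az, Yz]; ring
  have Xn : X n = 0 := by rw [hX]; simp [Yn]
  have Xm : X m ≤ 0 := by
    have e : X m * (- C.B n) = (C.A m - C.s) * (-C.B n) - (C.A n - C.s) * (-C.B m) := by
      rw [hX, hY]; field_simp [hBn.ne]; ring
    by_contra h
    push Not at h
    have := mul_pos h (neg_pos.2 hBn)
    linarith
  have hXz : 0 < X z := by rw [Xz]; linarith [C.hs1]
  have hev := eventually_edge_vertex C.hα
  have hη : ∀ᶠ y in 𝓝 C.α, 0 < - C.η y :=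
    (C.ηA.neg.continuous.tendsto C.α).eventually (lt_mem_nhds (neg_pos.2 C.ηα_neg))
  have hg : ∀ᶠ y in 𝓝 C.α, 0 < C.g y :=
    (C.hg.continuous.tendsto C.α).eventually (lt_mem_nhds C.gα)
  obtain ⟨ε, hε, hball⟩ := Metric.eventually_nhds_iff_ball.1 (hev.and (hη.and hg))
  have hmem : ∀ᶠ x in 𝓝 C.α, x ∈ Metric.ball C.α ε := Metric.ball_mem_nhds _ hε
  obtain ⟨t, ht0, ht1, ht⟩ := exists_near z hmem
  obtain ⟨t', ht0', ht1', ht'⟩ := exists_near n hmem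
  have hnoF : ∀ y ∈ Metric.ball C.α ε, 0 < X y → y ∉ D.F := by
    intro y hy hXy hyF
    obtain ⟨v, hv, hyv⟩ := (hball y hy).1 hyF
    have hXv : X v ≤ 0 := by
      rcases hall v hv with rfl | rfl
      · exact Xn.le
      · exact Xm
    obtain ⟨c, hc0, hc1, rfl⟩ := mem_segment_iff_pt.1 hyv
    rw [XA.pt, Xα] at hXy
    linarith [mul_nonneg hc0 (neg_nonneg.2 hXv)]
  have htB : C.B (pt C.α z t) = 0 := by rw [C.hB.pt, C.Bα, C.Bz]; ring
  have htη : C.η (pt C.α z t) < 0 := by linarith [(hball _ ht).2.1]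
  have htX : 0 < X (pt C.α z t) := by rw [XA.pt, Xα]; linarith [mul_pos ht0 hXz]
  have htψ : 0 < C.ψ (pt C.α z t) := by rw [C.ψA.pt, C.ψα]; linarith [mul_pos ht0 C.ψz]
  have htI : pt C.α z t ∈ D.I :=
    (C.K_sub htB.ge htη.le (hball _ ht).2.2.le).resolve_right (hnoF _ ht htX)
  have hcone : (({x | 0 < X x} ∩ {x | 0 ≤ Y x}) ∩ Metric.ball C.α ε) ⊆ D.I := by
    refine D.sub_I _ ((XA.convex_pos.inter YA.convex_nonneg).inter (convex_ball _ _)).isPreconnected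
      (disjoint_left.2 fun y hy => hnoF y hy.2 hy.1.1) ⟨pt C.α z t, ⟨⟨htX, ?_⟩, ht⟩, htI⟩
    show 0 ≤ Y (pt C.α z t)
    rw [YA.pt, Yα, Yz]; linarith
  have hconv : Convex ℝ ((({x | 0 ≤ X x} ∩ {x | 0 ≤ Y x}) ∩ {x | 0 < C.ψ x}) ∩
      Metric.ball C.α ε) :=
    ((XA.convex_nonneg.inter YA.convex_nonneg).inter C.ψA.convex_pos).inter (convex_ball _ _)
  have hU : pt C.α n t' ∈ C.U := by
    refine C.absorb hconv ?_ (fun y hy => ne_of_gt hy.1.2) (x := pt C.α z t)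
      ⟨⟨⟨le_of_lt htX, ?_⟩, htψ⟩, ht⟩ (C.K4_sub htB.ge htη.le (hball _ ht).2.2.le htψ)
      ⟨⟨⟨?_, ?_⟩, ?_⟩, ht'⟩
    · rintro y ⟨⟨⟨k1, k2⟩, -⟩, k4⟩
      have k1 : 0 ≤ X y := k1
      have k2 : 0 ≤ Y y := k2
      apply mem_P_of_near (y := z)
      have : ∀ᶠ t in 𝓝[>] (0 : ℝ), pt y z t ∈ Metric.ball C.α ε :=
        (tendsto_pt_zero y z).eventually (Metric.isOpen_ball.mem_nhds k4)
      filter_upwards [this, Ioo_mem_nhdsGT (zero_lt_one' ℝ)] with u hu hu'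
      refine Or.inl (hcone ⟨⟨?_, ?_⟩, hu⟩)
      · show 0 < X (pt y z u)
        rw [XA.pt]
        linarith [mul_pos hu'.1 hXz, mul_nonneg (sub_nonneg.2 hu'.2.le) k1]
      · show 0 ≤ Y (pt y z u)
        rw [YA.pt, Yz]
        linarith [mul_nonneg (sub_nonneg.2 hu'.2.le) k2]
    · show 0 ≤ Y (pt C.α z t); rw [YA.pt, Yα, Yz]; linarith
    · show 0 ≤ X (pt C.α n t'); rw [XA.pt, Xα, Xn]; linarith
    · show 0 ≤ Y (pt C.α n t'); rw [YA.pt, Yα, Yn]; linarith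
    · show 0 < C.ψ (pt C.α n t'); rw [C.ψA.pt, C.ψα]; linarith [mul_pos ht0' hψn]
  refine C.absorb (convex_segment (pt C.α n t') n) ?_ ?_ (left_mem_segment ℝ _ _) hU
    (right_mem_segment ℝ _ _)
  · intro y hy
    exact Or.inr (D.seg_sub _ _ hn ((convex_segment _ _).segment_subset
      (pt_mem_segment ht0'.le ht1'.le) (right_mem_segment ℝ _ _) hy))
  · intro y hy
    obtain ⟨v, hv0, hv1, rfl⟩ := mem_segment_iff_pt.1 hy
    rw [C.ψA.pt, C.ψA.pt, C.ψα]
    have e1 := mul_pos ht0' hψn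
    have e2 := mul_nonneg hv0 (mul_nonneg (sub_nonneg.2 ht1'.le) hψn.le)
    have : 0 < 0 + t' * (C.ψ n - 0) + v * (C.ψ n - (0 + t' * (C.ψ n - 0))) := by linarith
    exact this.ne'

theorem exists_r : ∃ r, D.E C.α r ∧ r ∈ C.U ∧ 0 < C.ψ r := by
  by_cases hcase : ∃ n, D.E C.α n ∧ C.B n = 0 ∧ C.s < C.A n
  · obtain ⟨n, hn, hB, hA⟩ := hcase
    have hA1 := C.last n (E_right hn) hB hA
    refine ⟨n, hn, ?_, C.ψ_of_B hB hA⟩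
    have hzn : ∀ y ∈ segment ℝ z n, C.B y = 0 ∧ 1 ≤ C.A y ∧ C.A y ≤ C.A n := by
      intro y hy
      obtain ⟨v, hv0, hv1, rfl⟩ := mem_segment_iff_pt.1 hy
      rw [C.hB.pt, C.hA.pt, C.Bz, C.Az, hB]
      have := mul_nonneg hv0 (sub_nonneg.2 hA1)
      have := mul_nonneg (sub_nonneg.2 hv1) (sub_nonneg.2 hA1)
      exact ⟨by ring, by linarith, by linarith⟩
    refine C.absorb (convex_segment z n) ?_ ?_ (left_mem_segment ℝ _ _) C.z_mem
      (right_mem_segment ℝ _ _)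
    · intro y hy
      obtain ⟨h1, h2, h3⟩ := hzn y hy
      refine Or.inr (D.seg_sub _ _ hn (mem_segment_iff_pt.2
        ⟨(C.A y - C.s) / (C.A n - C.s), ?_, ?_, ?_⟩))
      · exact div_nonneg (by linarith [C.hs1]) (by linarith)
      · rw [div_le_one (by linarith)]; linarith
      · apply C.inj
        · rw [C.hA.pt, C.Aα, div_mul_cancel₀ _ (by linarith)]; ring
        · rw [C.hB.pt, C.Bα, hB, h1]; ring
    · intro y hy
      obtain ⟨h1, h2, h3⟩ := hzn y hy
      exact (C.ψ_of_B h1 (by linarith [C.hs1])).ne'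
  push Not at hcase
  have hneg : ∀ v, D.E C.α v → C.B v < 0 ∨ (C.B v = 0 ∧ C.A v < C.s) := by
    intro v hv
    rcases (C.nbr_B hv).lt_or_eq with h | h
    · exact Or.inl h
    · exact Or.inr ⟨h, lt_of_le_of_ne (hcase v hv h) (C.nbr_ne hv h)⟩
  obtain ⟨p, q, hpq, hp, hq, hall⟩ := D.nbrs C.α C.hα
  have key : ∀ n m, D.E C.α n → D.E C.α m → (∀ v, D.E C.α v → v = n ∨ v = m) → C.B n < 0 →
      (C.A m - C.s) * (-C.B n) ≤ (C.A n - C.s) * (-C.B m) →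
      ∃ r, D.E C.α r ∧ r ∈ C.U ∧ 0 < C.ψ r := fun n m hn _ hall hB h =>
    ⟨n, hn, C.exists_r_aux hn hB hall h, C.ψ_of_neg (E_right hn) hB⟩
  rcases hneg p hp with h1 | ⟨h1, h1'⟩ <;> rcases hneg q hq with h2 | ⟨h2, h2'⟩
  · rcases le_total ((C.A q - C.s) * (-C.B p)) ((C.A p - C.s) * (-C.B q)) with h | h
    · exact key p q hp hq hall h1 h
    · exact key q p hq hp (fun v hv => (hall v hv).symm) h2 h
  · refine key p q hp hq hall h1 ?_
    rw [h2]
    have := mul_pos (sub_pos.2 h2') (neg_pos.2 h1)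
    linarith
  · refine key q p hq hp (fun v hv => (hall v hv).symm) h2 ?_
    rw [h1]
    have := mul_pos (sub_pos.2 h1') (neg_pos.2 h2)
    linarith
  · exfalso
    have hint := D.inter C.α p q hp hq hpq
    have H : ∀ n m, D.E C.α n → D.E C.α m → C.B n = 0 → C.A n < C.s → C.B m = 0 →
        C.A n ≤ C.A m → C.A m < C.s → m ∈ segment ℝ C.α n := by
      intro n m _ _ hBn hAn hBm hnm hAm
      refine mem_segment_iff_pt.2 ⟨(C.s - C.A m) / (C.s - C.A n), ?_, ?_, ?_⟩
      · exact div_nonneg (by linarith) (by linarith)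
      · rw [div_le_one (by linarith)]; linarith
      · apply C.inj
        · rw [C.hA.pt, C.Aα, show C.A n - C.s = -(C.s - C.A n) by ring, mul_neg,
            div_mul_cancel₀ _ (by linarith)]; ring
        · rw [C.hB.pt, C.Bα, hBn, hBm]; ring
    rcases le_total (C.A p) (C.A q) with h | h
    · have : q ∈ segment ℝ C.α p ∩ segment ℝ C.α q :=
        ⟨H p q hp hq h1 h1' h2 h h2', right_mem_segment ℝ _ _⟩
      rw [hint] at this
      exact D.E_ne _ _ hq this.symm
    · have : p ∈ segment ℝ C.α p ∩ segment ℝ C.α q :=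
        ⟨right_mem_segment ℝ _ _, H q p hq hp h2 h2' h1 h h1'⟩
      rw [hint] at this
      exact D.E_ne _ _ hp this.symm


/-- A point with `B > 0`, `η ≤ 0` on the line of the edge lies on the edge. -/
theorem mem_edge {y : Plane} (hB : 0 < C.B y) (hη : C.η y ≤ 0) (hg : C.g y = 0) : y ∈ D.F := by
  obtain ⟨c, hc⟩ := C.hg.exists_pt (D.E_ne _ _ C.hE) C.gw C.gf C.gξ.ne' hg
  have hcB : C.B y = C.B C.w + c * (C.B C.f - C.B C.w) := by rw [hc, C.hB.pt]
  have hcη : C.η y = C.η C.w + c * (C.η C.f - C.η C.w) := by rw [hc, C.ηA.pt]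
  have ηw : C.η C.w < 0 := C.ηw
  have ηf : 0 < C.η C.f := C.ηf
  have hc0 : 0 < c := by
    by_contra hle
    push Not at hle
    have := mul_nonneg (neg_nonneg.2 hle) (show 0 ≤ C.B C.f - C.B C.w by linarith [C.Bf, C.Bw])
    linarith [C.Bw]
  have hc1 : c < 1 := by
    by_contra hge
    push Not at hge
    have := mul_nonneg (sub_nonneg.2 hge) (show 0 ≤ C.η C.f - C.η C.w by linarith)
    linarith
  rw [hc]
  exact D.seg_sub _ _ C.hE (pt_mem_segment hc0.le hc1.le)

theorem on_ray {y : Plane} (h : C.η y = 0) : y = pt ξ C.σ (C.B y / (C.l * C.R)) := by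
  have hlR := C.lR
  apply C.inj
  · unfold η at h
    rw [C.hA.pt ξ, C.Aξ, C.Aσ, zero_add, sub_zero, div_mul_eq_mul_div, eq_div_iff hlR.ne']
    linear_combination (-C.R) * h
  · rw [C.hB.pt ξ, C.Bξ, C.Bσ, mul_comm C.R, zero_add, sub_zero, div_mul_cancel₀ _ hlR.ne']

theorem g_neg_of_on_ray {y : Plane} (h : C.η y = 0) (hψ : 0 < C.ψ y) : C.g y < 0 := by
  obtain ⟨v, hv⟩ : ∃ v, y = pt ξ C.σ v := ⟨_, C.on_ray h⟩
  rw [hv, C.ψA.pt, C.ψσ] at hψ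
  have hv1 : 1 < v := by
    by_contra hle
    push Not at hle
    have := mul_nonneg (sub_nonneg.2 hle) (neg_nonneg.2 C.ψξ.le)
    linarith
  rw [hv, C.hg.pt, C.gσ]
  linarith [mul_pos (sub_pos.2 hv1) C.gξ]

theorem SL {x y : Plane} (hx : x ∈ openSegment ℝ C.α C.σ) (hxy : D.Sees x y) (hψ : 0 < C.ψ y)
    (hB : 0 < C.B y) : D.Sees ξ y := by
  have hxZ := C.chord_Z hx
  have xB : 0 < C.B x := hxZ.1.1
  have xη : C.η x < 0 := by have : 0 < - C.η x := hxZ.1.2; linarith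
  have xg : 0 < C.g x := hxZ.2
  have xψ : C.ψ x = 0 := C.seg_ψ (openSegment_subset_segment ℝ _ _ hx)
  have hBp : ∀ t, 0 ≤ t → t ≤ 1 → 0 < C.B (pt x y t) := by
    intro t h0 h1
    rw [C.hB.pt]
    rcases h0.eq_or_lt with rfl | h0
    · linarith
    · linarith [mul_pos h0 hB, mul_nonneg (sub_nonneg.2 h1) xB.le]
  -- the segment does not cross the edge line before reaching the ray
  have main : ∀ t, 0 < t → t ≤ 1 → C.η (pt x y t) ≤ 0 → 0 ≤ C.g (pt x y t) := by
    intro t h0 h1 hη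
    by_contra hg
    push Not at hg
    obtain ⟨v, hv⟩ : ∃ v, v = C.g x / (C.g x - C.g (pt x y t)) := ⟨_, rfl⟩
    have hden : 0 < C.g x - C.g (pt x y t) := by linarith
    have hv0 : 0 < v := by rw [hv]; positivity
    have hv1 : v < 1 := by rw [hv, div_lt_one hden]; linarith
    have hve : v * (C.g x - C.g (pt x y t)) = C.g x := by rw [hv]; field_simp
    have hvt : v * t < 1 := by nlinarith
    have hF : pt x (pt x y t) v ∈ D.F := by
      apply C.mem_edge
      · rw [pt_pt_right]; exact hBp _ (by positivity) hvt.le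
      · rw [C.ηA.pt]
        linarith [mul_nonneg hv0.le (neg_nonneg.2 hη),
          mul_pos (sub_pos.2 hv1) (neg_pos.2 xη)]
      · rw [C.hg.pt]; linarith
    rw [pt_pt_right] at hF
    exact notMem_F (hxy (pt_mem_openSegment (by positivity) hvt)) hF
  have hyη : C.η y ≤ 0 := by
    by_contra h
    push Not at h
    obtain ⟨v, hv⟩ : ∃ v, v = - C.η x / (C.η y - C.η x) := ⟨_, rfl⟩
    have hden : 0 < C.η y - C.η x := by linarith
    have hv0 : 0 < v := by rw [hv]; exact div_pos (by linarith) hden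
    have hv1 : v < 1 := by rw [hv, div_lt_one hden]; linarith
    have hve : v * (C.η y - C.η x) = - C.η x := by rw [hv]; field_simp
    have h0 : C.η (pt x y v) = 0 := by rw [C.ηA.pt]; linarith
    have h1 := main v hv0 hv1.le h0.le
    have h2 := C.g_neg_of_on_ray h0 (by rw [C.ψA.pt, xψ]; linarith [mul_pos hv0 hψ])
    linarith
  have hyg : 0 ≤ C.g y := by
    have := main 1 zero_lt_one le_rfl
    rw [pt_one] at this
    exact this hyη
  rcases hyη.lt_or_eq with h | h
  · intro q hq
    obtain ⟨t, ht0, ht1, rfl⟩ := mem_openSegment_iff_pt.1 hq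
    apply C.Z_sub_I
    apply C.mem_Z
    · rw [C.hB.pt, C.Bξ]; linarith [mul_pos ht0 hB]
    · rw [C.ηA.pt, C.ηξ]; linarith [mul_pos ht0 (neg_pos.2 h)]
    · rw [C.hg.pt]; linarith [mul_nonneg ht0.le hyg, mul_pos (sub_pos.2 ht1) C.gξ]
  · exact absurd (C.g_neg_of_on_ray h hψ) (not_lt.2 hyg)

theorem exists_cross : ∃ x ∈ openSegment ℝ C.α C.σ, x ∈ openSegment ℝ z1 z := by
  have hRs : 0 < C.R - C.s := by linarith [C.hR, C.hs1]
  obtain ⟨t, ht⟩ : ∃ t, t = (1 - C.s) / (C.R - C.s) := ⟨_, rfl⟩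
  have ht0 : 0 < t := by rw [ht]; exact div_pos (by linarith [C.hs1]) hRs
  have ht1 : t < 1 := by rw [ht, div_lt_one hRs]; linarith [C.hR]
  have hte : t * (C.R - C.s) = 1 - C.s := by rw [ht]; field_simp
  refine ⟨pt C.α C.σ t, pt_mem_openSegment ht0 ht1, ?_⟩
  have eA : C.A (pt C.α C.σ t) = C.s + t * (C.R * (1 - C.l) - C.s) := by
    rw [C.hA.pt, C.Aα, C.Aσ]
  have eB : C.B (pt C.α C.σ t) = t * (C.R * C.l) := by rw [C.hB.pt, C.Bα, C.Bσ]; ring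
  have e1 : C.A (pt C.α C.σ t) + C.B (pt C.α C.σ t) = 1 := by rw [eA, eB]; linarith
  have hR0 : 0 < C.R := by linarith [C.hR]
  refine mem_openSegment_iff_pt.2 ⟨C.A (pt C.α C.σ t), ?_, ?_, ?_⟩
  · rw [eA]
    have := mul_pos ht0 (mul_pos hR0 (sub_pos.2 C.hl1))
    have := mul_pos (sub_pos.2 ht1) C.hs0
    linarith
  · have := mul_pos ht0 (mul_pos hR0 C.hl0)
    linarith
  · apply C.inj
    · rw [C.hA.pt z1, C.Az1, C.Az]; ring
    · rw [C.hB.pt z1, C.Bz1, C.Bz]; linarith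

theorem σ_eq : C.σ = pt ξ (pt z z1 C.l) C.R := by
  apply C.inj
  · rw [C.hA.pt, C.hA.pt, C.Aξ, C.Az, C.Az1, C.Aσ]; ring
  · rw [C.hB.pt, C.hB.pt, C.Bξ, C.Bz, C.Bz1, C.Bσ]; ring

theorem toWin (C : WinCfg D ξ z z1)
    (hV : ∀ q ∈ segment ℝ z1 z, q ≠ z → q ∈ D.I ∧ D.Sees ξ q) : Nonempty (Win D ξ z z1) := by
  obtain ⟨r, hr, hrU, hrψ⟩ := C.exists_r
  refine ⟨{
    a := C.α, σ := C.σ, w := C.w, f := C.f, r := r, hc := C.ψ, he := C.g, ha := C.hα, hE := C.hE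
    hσ := C.hσ, see := C.sees_ασ, hcA := C.ψA, heA := C.hg, hca := C.ψα, hcσ := C.ψσ
    hcw := C.ψw, hcr := hrψ, har := hr, hew := C.gw, hef := C.gf, hea := C.gα, r_mem := hrU
    S2 := ?_, T := C.T, ρ := C.B, η := C.η, ρA := C.hB, ηA := C.ηA, a_mem := ?_
    see_ξσ := C.see, see_ξ := fun x hx => C.Z_sees (C.chord_Z hx), hcf := C.ψf, hcξ := C.ψξ
    hcz := C.ψz, heξ := C.gξ, ρξ := C.Bξ, ρz := C.Bz, ρz1 := by rw [C.Bz1]; norm_num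
    ρσ := C.Bσ_pos, ρw := C.Bw, ρf := C.Bf, ρa := fun n hn => C.nbr_B hn, ηξ := C.ηξ
    ησ := C.ησ, ηz := ?_, ηa := C.ηα_neg, ηz1 := ?_, ηρ := ?_, ξU := C.ξ_notMem
    fU := C.f_notMem, zU := C.z_mem, hV := hV, hT := C.hT, hβ := C.hβ
    SL := fun x hx y h1 h2 h3 => C.SL hx h1 h2 h3, cross := C.exists_cross, posA := ?_ }⟩
  · intro x hx
    filter_upwards [C.isOpen_Z.mem_nhds (C.chord_Z hx)] with y hy
    have h2 : C.η y ≤ 0 := by have : 0 < - C.η y := hy.1.2; linarith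
    exact ⟨fun h => C.K4_sub (le_of_lt hy.1.1) h2 (le_of_lt hy.2) h,
      fun h => C.K3_disj (le_of_lt hy.1.1) h2 (le_of_lt hy.2) h⟩
  · show C.α ∈ openSegment ℝ ξ z
    rw [C.α_eq]; exact pt_mem_openSegment C.hs0 C.hs1
  · show C.η z < 0
    unfold η; rw [C.Bz, C.Az]; linarith [C.hl0]
  · show 0 < C.η z1
    unfold η; rw [C.Bz1, C.Az1]; linarith [C.hl1]
  · intro q hq h
    have := C.V1 q hq h
    show 0 < C.η q
    unfold η; linarith
  · intro g hg h0 h1 h2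
    show 0 < g C.σ
    rw [C.σ_eq, hg.pt, hg.pt, h0]
    have e1 := mul_pos (sub_pos.2 C.hl1) h1
    have e2 := mul_pos C.hl0 h2
    have e3 := mul_pos (show 0 < C.R by linarith [C.hR]) (add_pos e1 e2)
    linarith

end Region.WinCfg

theorem exists_win {D : Region} {ξ z z1 : Plane} (hdt : dt ξ z z1 ≠ 0)
    (hV : ∀ q ∈ segment ℝ z1 z, q ≠ z → q ∈ D.I ∧ D.Sees ξ q)
    (hvert : ∃ q ∈ D.Vs, q ∈ openSegment ℝ ξ z) : Nonempty (Win D ξ z z1) := by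
  obtain ⟨C⟩ := Region.exists_winCfg hdt hV hvert
  exact C.toWin hV

theorem openSegment_pt_sub {x y : Plane} {s t : ℝ} (hs0 : 0 ≤ s) (hs1 : s ≤ 1) (ht0 : 0 ≤ t)
    (ht1 : t ≤ 1) (hst : s ≠ t) :
    openSegment ℝ (pt x y s) (pt x y t) ⊆ openSegment ℝ x y := by
  intro p hp
  obtain ⟨u, hu0, hu1, rfl⟩ := mem_openSegment_iff_pt.1 hp
  rw [pt_pt]
  rcases hst.lt_or_gt with h | h
  · have h1 := mul_pos hu0 (sub_pos.2 h)
    have h2 := mul_pos (sub_pos.2 hu1) (sub_pos.2 h)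
    exact pt_mem_openSegment (by linarith) (by linarith)
  · have h1 := mul_pos hu0 (sub_pos.2 h)
    have h2 := mul_pos (sub_pos.2 hu1) (sub_pos.2 h)
    exact pt_mem_openSegment (by linarith) (by linarith)

theorem isPreconnected_ray (x y : Plane) : IsPreconnected (pt x y '' Ioc 0 1) :=
  isPreconnected_Ioc.image _ (continuous_pt x y).continuousOn

namespace Region
variable {D : Region}

/-- Points of `P` reached from `s` along at most `k` segments. -/
def Reach (D : Region) (s : Plane) : ℕ → Plane → Prop
  | 0, z => z = s
  | k + 1, z => Reach D s k z ∨ ∃ y, Reach D s k y ∧ (y = s ∨ D.Reg y) ∧ D.Sees y z ∧ z ∈ D.P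

theorem Reach.mono {s z : Plane} {k l : ℕ} (h : D.Reach s k z) (hkl : k ≤ l) : D.Reach s l z := by
  induction l, hkl using Nat.le_induction with
  | base => exact h
  | succ l _ ih => exact Or.inl ih

theorem Reach.step {s y z : Plane} {k : ℕ} (h : D.Reach s k y) (hy : D.Reg y) (hs : D.Sees y z)
    (hz : z ∈ D.P) : D.Reach s (k + 1) z := Or.inr ⟨y, h, Or.inr hy, hs, hz⟩

theorem Sees.pt_pt {x y : Plane} (h : D.Sees x y) {s t : ℝ} (hs0 : 0 ≤ s) (hs1 : s ≤ 1)
    (ht0 : 0 ≤ t) (ht1 : t ≤ 1) (hst : s ≠ t) : D.Sees (pt x y s) (pt x y t) :=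
  (openSegment_pt_sub hs0 hs1 ht0 ht1 hst).trans h

theorem Sees.pt_mem {x y : Plane} (h : D.Sees x y) {t : ℝ} (ht0 : 0 < t) (ht1 : t < 1) :
    pt x y t ∈ D.I := h (pt_mem_openSegment ht0 ht1)

theorem sees_self {x : Plane} (hx : x ∈ D.I) : D.Sees x x := by
  unfold Sees; rw [openSegment_same]; simpa using hx

/-- Seeing `x` beyond which `y` is seen gives sight of `y` along a common line. -/
theorem dt_ne_zero_of_not_sees {ξ x y : Plane} (hx : x ∈ D.I) (h1 : D.Sees ξ x) (h2 : D.Sees x y)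
    (h3 : ¬ D.Sees ξ y) (hne : y ≠ ξ) : dt ξ x y ≠ 0 := by
  intro h0
  by_cases hxξ : ξ = x
  · subst hxξ; exact h3 h2
  obtain ⟨t, rfl⟩ := exists_pt_of_dt_eq_zero hxξ h0
  apply h3
  intro p hp
  obtain ⟨u, hu0, hu1, rfl⟩ := mem_openSegment_iff_pt.1 hp
  rw [pt_pt_right]
  have hpt : ∀ k, pt x (pt ξ x t) k = pt ξ x (1 + k * (t - 1)) := by
    intro k
    nth_rewrite 1 [← pt_one ξ x]
    rw [pt_pt]
  have hseg : ∀ v, (1 < v ∧ v < t) ∨ (t < v ∧ v < 1) → pt ξ x v ∈ D.I := by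
    intro v hv
    have ht : t - 1 ≠ 0 := by rcases hv with hv | hv <;> intro h <;> linarith [hv.1, hv.2]
    have : pt ξ x v = pt x (pt ξ x t) ((v - 1) / (t - 1)) := by
      rw [hpt]; congr 1; field_simp; ring
    rw [this]
    apply h2.pt_mem
    · rcases hv with hv | hv
      · exact div_pos (by linarith) (by linarith)
      · exact div_pos_of_neg_of_neg (by linarith) (by linarith)
    · rcases hv with hv | hv
      · rw [div_lt_one (by linarith)]; linarith
      · rw [div_lt_one_of_neg (by linarith)]; linarith
  rcases lt_trichotomy t 0 with ht | ht | ht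
  · have := mul_neg_of_pos_of_neg hu0 ht
    have := mul_neg_of_pos_of_neg (sub_pos.2 hu1) ht
    exact hseg _ (Or.inr ⟨by linarith, by linarith⟩)
  · exact absurd (by rw [ht, pt_zero]) hne
  · have h5 := mul_pos hu0 ht
    have h6 := mul_pos (sub_pos.2 hu1) ht
    rcases lt_trichotomy (u * t) 1 with h | h | h
    · exact h1.pt_mem h5 h
    · rw [h, pt_one]; exact hx
    · exact hseg _ (Or.inl ⟨h, by linarith⟩)

/-- If a segment `[z1, z)` is visible from `ξ` but `z` is not, then a vertex hides `z`, or both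
points lie on a common edge. -/
theorem hidden_cases {ξ z z1 : Plane} (hdt : dt ξ z z1 ≠ 0)
    (hV : ∀ q ∈ segment ℝ z1 z, q ≠ z → q ∈ D.I ∧ D.Sees ξ q) (hns : ¬ D.Sees ξ z) :
    (∃ q ∈ D.Vs, q ∈ openSegment ℝ ξ z) ∨
      ∃ p q, D.E p q ∧ ξ ∈ segment ℝ p q ∧ z ∈ segment ℝ p q := by
  obtain ⟨A, B, hA, hB, Aξ, Az, Az1, Bξ, Bz, Bz1, inj⟩ := exists_frame hdt
  have hξz : ξ ≠ z := by rintro rfl; rw [Aξ] at Az; norm_num at Az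
  obtain ⟨b, hb, hbI⟩ := not_subset.1 hns
  have bB : B b = 0 := isAff_zero_on_segment hB Bξ Bz (openSegment_subset_segment ℝ _ _ hb)
  have bA : 0 < A b ∧ A b < 1 := by
    obtain ⟨s, hs0, hs1, rfl⟩ := mem_openSegment_iff_pt.1 hb
    rw [hA.pt, Aξ, Az]; constructor <;> linarith
  have key : ∀ v, 0 < B v → ∀ᶠ τ in 𝓝[>] (0 : ℝ), pt b v τ ∈ D.I := by
    intro v hv
    have c1 : ContinuousAt (fun τ : ℝ => A (pt b v τ)) 0 :=
      (hA.continuous.comp (continuous_pt b v)).continuousAt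
    have c2 : ContinuousAt (fun τ : ℝ => 1 - (A (pt b v τ) + B (pt b v τ))) 0 :=
      (continuous_const.sub ((hA.continuous.comp (continuous_pt b v)).add
        (hB.continuous.comp (continuous_pt b v)))).continuousAt
    filter_upwards [eventually_pos_right c1 (by simpa only [pt_zero] using bA.1),
      eventually_pos_right c2 (by simp only [pt_zero, bB]; linarith [bA.2]),
      self_mem_nhdsWithin] with τ h1 h2 h3
    have h3 : 0 < τ := h3
    refine triangle_sub hA hB inj Aξ Az Az1 Bξ Bz Bz1 hV h1.le ?_ (by linarith)
    rw [hB.pt, bB]; linarith [mul_pos h3 hv]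
  have bP : b ∈ D.P := mem_P_of_near (y := z1)
    ((key z1 (by rw [Bz1]; norm_num)).mono fun τ h => Or.inl h)
  have bF : b ∈ D.F := bP.resolve_left hbI
  obtain ⟨p, q, hE, hbpq⟩ := D.cover b bF
  by_cases hv : b ∈ D.Vs
  · exact Or.inl ⟨b, hv, hb⟩
  have edge : ∀ v, D.E p q → (v = p ∨ v = q) → ¬ 0 < B v := by
    intro v _ hvpq hBv
    have hlt : ∀ᶠ τ in 𝓝[>] (0 : ℝ), τ < 1 :=
      mem_nhdsWithin_of_mem_nhds (Iio_mem_nhds (by norm_num))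
    obtain ⟨τ, ⟨hτI, hτ1⟩, hτ0⟩ := (((key v hBv).and hlt).and self_mem_nhdsWithin).exists
    refine notMem_F hτI (D.seg_sub _ _ hE ?_)
    have hvm : v ∈ segment ℝ p q := by
      rcases hvpq with rfl | rfl
      · exact left_mem_segment ℝ _ _
      · exact right_mem_segment ℝ _ _
    exact (convex_segment p q).segment_subset hbpq hvm
      (pt_mem_segment (le_of_lt hτ0) (le_of_lt hτ1))
  have h1 := edge p hE (Or.inl rfl)
  have h2 := edge q hE (Or.inr rfl)
  obtain ⟨t, ht0, ht1, rfl⟩ := mem_segment_iff_pt.1 hbpq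
  have ht0' : 0 < t := ht0.lt_of_ne (by rintro rfl; rw [pt_zero] at hv; exact hv (D.E_left _ _ hE))
  have ht1' : t < 1 := ht1.lt_of_ne (by rintro rfl; rw [pt_one] at hv; exact hv (E_right hE))
  rw [hB.pt] at bB
  push Not at h1 h2
  have e1 := mul_nonneg (sub_pos.2 ht1').le (neg_nonneg.2 h1)
  have e2 := mul_nonneg ht0 (neg_nonneg.2 h2)
  have Bp : B p = 0 := by
    have : (1 - t) * B p = 0 := by linarith
    rcases mul_eq_zero.1 this with h | h
    · linarith
    · exact h
  have Bq : B q = 0 := by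
    have : t * B q = 0 := by rw [Bp] at bB; linarith
    rcases mul_eq_zero.1 this with h | h
    · linarith
    · exact h
  have hp : p = pt ξ z (A p) := inj _ _ (by rw [hA.pt, Aξ, Az]; ring) (by rw [hB.pt, Bξ, Bz, Bp]; ring)
  have hq : q = pt ξ z (A q) := inj _ _ (by rw [hA.pt, Aξ, Az]; ring) (by rw [hB.pt, Bξ, Bz, Bq]; ring)
  by_cases hAp : 0 < A p ∧ A p < 1
  · exact Or.inl ⟨p, D.E_left _ _ hE, by rw [hp]; exact pt_mem_openSegment hAp.1 hAp.2⟩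
  by_cases hAq : 0 < A q ∧ A q < 1
  · exact Or.inl ⟨q, E_right hE, by rw [hq]; exact pt_mem_openSegment hAq.1 hAq.2⟩
  right
  rw [hA.pt] at bA
  have mem : ∀ p q : Plane, p = pt ξ z (A p) → q = pt ξ z (A q) → A p ≤ 0 → 1 ≤ A q →
      ξ ∈ segment ℝ p q ∧ z ∈ segment ℝ p q := by
    intro p q hp hq h1 h2
    have hpos : 0 < A q - A p := by linarith
    constructor
    · refine mem_segment_iff_pt.2 ⟨-A p / (A q - A p), div_nonneg (by linarith) hpos.le, ?_, ?_⟩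
      · rw [div_le_one hpos]; linarith
      · rw [hp, hq, pt_pt, ← hp, ← hq, div_mul_cancel₀ _ hpos.ne', add_neg_cancel, pt_zero]
    · refine mem_segment_iff_pt.2 ⟨(1 - A p) / (A q - A p), div_nonneg (by linarith) hpos.le, ?_, ?_⟩
      · rw [div_le_one hpos]; linarith
      · rw [hp, hq, pt_pt, ← hp, ← hq, div_mul_cancel₀ _ hpos.ne', add_sub_cancel, pt_one]
  rcases le_or_gt (A p) 0 with h | h
  · have hq1 : 1 ≤ A q := by
      by_contra hlt
      push Not at hlt hAq
      have h0 : A q ≤ 0 := by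
        by_contra h0
        push Not at h0
        linarith [hAq h0]
      have := mul_nonneg (sub_pos.2 ht1').le (neg_nonneg.2 h)
      have := mul_nonneg ht0 (neg_nonneg.2 h0)
      linarith [bA.1]
    exact ⟨p, q, hE, mem p q hp hq h hq1⟩
  · have hp1 : 1 ≤ A p := by
      by_contra hlt
      exact hAp ⟨h, not_le.1 hlt⟩
    have hq0 : A q ≤ 0 := by
      by_contra h0
      push Not at h0 hAq
      have h3 := hAq h0
      have := mul_nonneg (sub_pos.2 ht1').le (sub_nonneg.2 hp1)
      have := mul_nonneg ht0 (sub_nonneg.2 h3)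
      linarith [bA.2]
    exact ⟨q, p, D.E_symm _ _ hE, mem q p hq hp hq0 hp1⟩

theorem edge_openSegment_of_valid {ξ p q : Plane} (hξ : D.Valid ξ) (hE : D.E p q)
    (h : ξ ∈ segment ℝ p q) : ξ ∈ openSegment ℝ p q := by
  rcases hξ with hξ | ⟨p', q', hE', h'⟩
  · exact absurd (D.seg_sub _ _ hE h) (notMem_F hξ)
  · rcases D.uniq _ _ _ _ _ hE' hE h' h with ⟨rfl, rfl⟩ | ⟨rfl, rfl⟩
    · exact h'
    · rwa [openSegment_symm]

theorem isOpen_visible {ξ : Plane} (hξ : D.Valid ξ) : IsOpen {q | q ∈ D.I ∧ D.Sees ξ q} := by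
  rw [isOpen_iff_mem_nhds]
  rintro x ⟨hx, hs⟩
  filter_upwards [D.isOpen_I.mem_nhds hx, eventually_sees hξ hx hs.symm] with y h1 h2
  exact ⟨h1, h2.symm⟩

/-- Moving from a point visible from `ξ` towards a hidden point `y`, the first hidden point is
hidden by a vertex, or it is `y` and lies on the same edge as `ξ`. -/
theorem exists_exit {ξ x y : Plane} (hξ : D.Valid ξ) (hx : x ∈ D.I) (h1 : D.Sees ξ x)
    (h2 : D.Sees x y) (hy : D.Valid y) (h3 : ¬ D.Sees ξ y) (hne : y ≠ ξ) :
    ∃ t : ℝ, 0 < t ∧ t ≤ 1 ∧ (∀ u, 0 ≤ u → u < t → pt x y u ∈ D.I ∧ D.Sees ξ (pt x y u)) ∧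
      ((∀ u, 0 ≤ u → u < t → Nonempty (Win D ξ (pt x y t) (pt x y u))) ∨
        (t = 1 ∧ ∃ p q, D.E p q ∧ ξ ∈ openSegment ℝ p q ∧ y ∈ openSegment ℝ p q)) := by
  have hd := dt_ne_zero_of_not_sees hx h1 h2 h3 hne
  obtain ⟨t, ht0, ht1, hT, hb⟩ := exists_first_exit (isOpen_visible hξ) (x := x) (y := y)
    ⟨hx, h1⟩ (fun h => h3 h.2)
  have hns : ¬ D.Sees ξ (pt x y t) := by
    intro h
    rcases ht1.lt_or_eq with h' | h'
    · exact hT ⟨h2.pt_mem ht0 h', h⟩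
    · rw [h', pt_one] at h; exact h3 h
  have hV : ∀ u, 0 ≤ u → u < t → ∀ q ∈ segment ℝ (pt x y u) (pt x y t), q ≠ pt x y t →
      q ∈ D.I ∧ D.Sees ξ q := by
    intro u hu0 hut q hq hqz
    obtain ⟨s, hs0, hs1, rfl⟩ := mem_segment_iff_pt.1 hq
    have hs1' : s < 1 := hs1.lt_of_ne (by rintro rfl; exact hqz (pt_one _ _))
    rw [pt_pt]
    have e1 := mul_nonneg hs0 (sub_pos.2 hut).le
    have e2 := mul_pos (sub_pos.2 hs1') (sub_pos.2 hut)
    exact hb _ (by linarith) (by linarith)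
  have hdt : ∀ u, u < t → dt ξ (pt x y t) (pt x y u) ≠ 0 := by
    intro u hut h0
    have : dt ξ (pt x y t) (pt x y u) = (u - t) * dt ξ x y := by
      unfold dt; simp only [pt_apply]; ring
    rw [this] at h0
    rcases mul_eq_zero.1 h0 with h | h
    · linarith
    · exact hd h
  refine ⟨t, ht0, ht1, hb, ?_⟩
  rcases hidden_cases (hdt 0 ht0) (hV 0 le_rfl ht0) hns with h | ⟨p, q, hE, hp, hq⟩
  · exact Or.inl fun u hu0 hut => exists_win (hdt u hut) (hV u hu0 hut) h
  · right
    have ht : t = 1 := by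
      by_contra h
      exact notMem_F (h2.pt_mem ht0 (ht1.lt_of_ne h)) (D.seg_sub _ _ hE hq)
    subst ht
    rw [pt_one] at hq
    exact ⟨rfl, p, q, hE, edge_openSegment_of_valid hξ hE hp, edge_openSegment_of_valid hy hE hq⟩

/-- Two points of a common edge, one of which sees a segment ending at the other one, see a common
regular point. -/
theorem exists_common_reg {w f σ y z1 : Plane} (hE : D.E w f) (hσ : σ ∈ openSegment ℝ w f)
    (hy : y ∈ openSegment ℝ w f) (hdt : dt σ y z1 ≠ 0)
    (hV : ∀ q ∈ segment ℝ z1 y, q ≠ y → q ∈ D.I ∧ D.Sees σ q) :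
    ∃ σ', D.Reg σ' ∧ D.Sees σ σ' ∧ D.Sees y σ' := by
  obtain ⟨A, B, hA, hB, Aξ, Az, Az1, Bξ, Bz, Bz1, inj⟩ := exists_frame hdt
  obtain ⟨W, -, -, -⟩ := exists_wedge (Φ := fun _ => True) hA hB inj Aξ Az Az1 Bξ Bz Bz1 hV
    (Eventually.of_forall fun _ => trivial)
  clear inj Aξ Az Az1 Bξ Bz Bz1 hA hB A B
  refine ⟨W.σ, ⟨_, _, W.hE, W.hσ⟩, W.see, ?_⟩
  have gσ : W.g W.σ = 0 :=
    isAff_zero_on_segment W.hg W.gw W.gf (openSegment_subset_segment ℝ _ _ W.hσ)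
  have gβ : W.g (pt σ y W.T) = 0 := isAff_zero_on_segment W.hg W.gw gσ W.hβ
  rw [W.hg.pt] at gβ
  have hT := W.hT
  have gy : 0 < W.g y := by
    by_contra hle
    push Not at hle
    have hp1 := mul_nonneg (sub_nonneg.2 hT) W.gξ.le
    have hp2 := mul_nonneg (show 0 ≤ W.T by linarith) (neg_nonneg.2 hle)
    have h4 : (W.T - 1) * W.g σ = 0 := by linarith
    have hT1 : W.T = 1 := by
      rcases mul_eq_zero.1 h4 with h | h
      · linarith
      · linarith [W.gξ]
    have hβ := W.hβ
    rw [hT1, pt_one] at hβ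
    have hyseg : y ∈ segment ℝ W.w W.f := (convex_segment W.w W.f).segment_subset
      (left_mem_segment ℝ _ _) (openSegment_subset_segment ℝ _ _ W.hσ) hβ
    have hσy : σ ≠ y := by rintro rfl; unfold dt at hdt; simp at hdt
    obtain ⟨s, hs0, hs1, es⟩ := mem_openSegment_iff_pt.1 hσ
    obtain ⟨t, ht0, ht1, et⟩ := mem_openSegment_iff_pt.1 hy
    have hst : s ≠ t := by rintro rfl; exact hσy (es.trans et.symm)
    have b1 : W.B w + s * (W.B f - W.B w) = 0 := by rw [← W.hB.pt, ← es, W.Bξ]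
    have b2 : W.B w + t * (W.B f - W.B w) = 0 := by rw [← W.hB.pt, ← et, W.Bz]
    have b3 : W.B f - W.B w = 0 := by
      have : (s - t) * (W.B f - W.B w) = 0 := by linarith
      exact (mul_eq_zero.1 this).resolve_left (sub_ne_zero.2 hst)
    have b4 : W.B w = 0 := by rw [b3] at b1; linarith
    have b5 : W.B f = 0 := by linarith
    have hf := W.Bf
    rcases D.uniq _ _ _ _ _ hE W.hE hy hyseg with ⟨e1, e2⟩ | ⟨e1, e2⟩
    · rw [← e2] at hf; linarith
    · rw [← e1] at hf; linarith
  have hBσ : 0 < W.B W.σ := by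
    rw [W.Bσ]; exact mul_pos (by linarith [W.hR]) W.hl0
  intro p hp
  obtain ⟨u, hu0, hu1, rfl⟩ := mem_openSegment_iff_pt.1 hp
  have e1 := mul_pos hu0 hBσ
  have e2 := mul_pos (sub_pos.2 hu1) W.hl0
  have e3 := mul_pos (sub_pos.2 hu1) gy
  apply W.Z_sub
  · rw [W.hB.pt, W.Bz]; linarith
  · rw [W.hB.pt, W.hA.pt, W.Bz, W.Az, W.Aσ, W.Bσ]; linarith
  · rw [W.hg.pt, gσ]; linarith

end Region

namespace Region
variable {D : Region}

theorem exists_path_exit {ξ x0 t0 : Plane} (hξ : D.Valid ξ) (hx0 : x0 ∈ D.I) (hs : D.Sees ξ x0)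
    (ht0 : t0 ∈ D.I) (hns : ¬ D.Sees ξ t0) :
    ∃ z ∈ D.I, (∃ K : Set Plane, IsPreconnected K ∧ K ⊆ D.I ∧ (∀ q ∈ K, ¬ D.Sees ξ q) ∧
      z ∈ K ∧ t0 ∈ K) ∧ ∀ N ∈ 𝓝 z, ∃ z1 ∈ N, Nonempty (Win D ξ z z1) := by
  have hVo := isOpen_visible hξ
  have hpc : IsPathConnected D.I :=
    (IsOpen.isConnected_iff_isPathConnected D.isOpen_I).1 ⟨⟨x0, hx0⟩, D.preconn⟩
  obtain ⟨γ, hγ⟩ := hpc.joinedIn t0 ht0 x0 hx0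
  obtain ⟨V, hVdef⟩ : ∃ V, V = {q | q ∈ D.I ∧ D.Sees ξ q} := ⟨_, rfl⟩
  rw [← hVdef] at hVo
  have hSc : IsCompact {t : unitInterval | γ t ∈ closure V} :=
    (isClosed_closure.preimage γ.continuous).isCompact
  have hSn : {t : unitInterval | γ t ∈ closure V}.Nonempty :=
    ⟨1, by
      show γ 1 ∈ closure V
      rw [γ.target, hVdef]; exact subset_closure ⟨hx0, hs⟩⟩
  obtain ⟨τ, hτS, hτ⟩ := hSc.exists_isLeast hSn
  have hτS : γ τ ∈ closure V := hτS
  have hlt : ∀ t < τ, γ t ∉ closure V := fun t ht h => not_lt.2 (hτ h) ht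
  have hle : ∀ t ≤ τ, γ t ∉ V := by
    intro t ht hV
    rcases ht.lt_or_eq with h | rfl
    · exact hlt t h (subset_closure hV)
    · by_cases h0 : t = 0
      · rw [h0, γ.source, hVdef] at hV; exact hns hV.2
      · have h1 : ∀ᶠ t' in 𝓝 t, γ t' ∈ V := γ.continuous.continuousAt (hVo.mem_nhds hV)
        have hpos : (0 : unitInterval) < t := unitInterval.pos_iff_ne_zero.2 h0
        obtain ⟨l, hl, hl'⟩ := exists_Ioc_subset_of_mem_nhds h1 ⟨0, hpos⟩
        obtain ⟨m, hm⟩ := exists_between hl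
        exact hlt m hm.2 (subset_closure (hl' ⟨hm.1, hm.2.le⟩))
  have hnsee : ∀ t ≤ τ, ¬ D.Sees ξ (γ t) := fun t ht h => hle t ht (by rw [hVdef]; exact ⟨hγ t, h⟩)
  obtain ⟨z, hz⟩ : ∃ z, z = γ τ := ⟨_, rfl⟩
  have hzI : z ∈ D.I := hz ▸ hγ τ
  have hzs : ¬ D.Sees ξ z := hz ▸ hnsee τ le_rfl
  have hzξ : z ≠ ξ := by rintro rfl; exact hzs (sees_self hzI)
  refine ⟨z, hzI, ⟨γ '' Iic τ, isPreconnected_Iic.image _ γ.continuous.continuousOn, ?_, ?_,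
    ⟨τ, self_mem_Iic, hz.symm⟩, ⟨0, unitInterval.nonneg _, γ.source⟩⟩, ?_⟩
  · rintro _ ⟨t, -, rfl⟩; exact hγ t
  · rintro _ ⟨t, ht, rfl⟩; exact hnsee t ht
  · intro N hN
    have hav : ∀ᶠ y in 𝓝 z, ∀ q ∈ D.Vs, dt ξ q z ≠ 0 → dt ξ q y ≠ 0 := by
      rw [Filter.eventually_all_finset]
      intro q _
      by_cases h : dt ξ q z = 0
      · exact Eventually.of_forall fun _ h' => absurd h h'
      · filter_upwards [(isAff_dt ξ q).continuous.continuousAt.eventually_ne h] with y hy _ using hy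
    have hevN : ∀ᶠ y in 𝓝 z, y ∈ N := hN
    have hevI : ∀ᶠ y in 𝓝 z, y ∈ D.I := D.isOpen_I.mem_nhds hzI
    obtain ⟨ε, hε, hball⟩ := Metric.eventually_nhds_iff_ball.1 (hevN.and (hevI.and hav))
    have hzV : z ∈ closure V := hz ▸ hτS
    obtain ⟨y0, hy0b, hy0V⟩ := mem_closure_iff_nhds.1 hzV _ (Metric.ball_mem_nhds z hε)
    obtain ⟨z1, hz1b, hz1V, hz1d⟩ : ∃ z1, z1 ∈ Metric.ball z ε ∧ z1 ∈ V ∧ dt ξ z z1 ≠ 0 := by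
      by_cases h0 : dt ξ z y0 = 0
      · obtain ⟨v, hv⟩ : ∃ v, dt ξ z v ≠ 0 := by
          by_contra hall
          push Not at hall
          have h1 := hall (!₂[ξ 0 - (z 1 - ξ 1), ξ 1 + (z 0 - ξ 0)])
          have h2 : (z 0 - ξ 0) ^ 2 + (z 1 - ξ 1) ^ 2 = 0 := by
            unfold dt at h1
            simp at h1
            linarith
          apply hzξ
          apply plane_ext <;> nlinarith [sq_nonneg (z 0 - ξ 0), sq_nonneg (z 1 - ξ 1)]
        have hevb : ∀ᶠ y in 𝓝 y0, y ∈ Metric.ball z ε := Metric.isOpen_ball.mem_nhds hy0b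
        have hevV : ∀ᶠ y in 𝓝 y0, y ∈ V := hVo.mem_nhds hy0V
        obtain ⟨t, ht0, -, ht⟩ := exists_near v (hevb.and hevV)
        refine ⟨_, ht.1, ht.2, ?_⟩
        rw [(isAff_dt ξ z).pt, h0]
        simpa using ⟨ht0.ne', hv⟩
      · exact ⟨y0, hy0b, hy0V, h0⟩
    rw [hVdef] at hz1V
    have hseg : segment ℝ z1 z ⊆ Metric.ball z ε :=
      (convex_ball z ε).segment_subset hz1b (Metric.mem_ball_self hε)
    have hsee : D.Sees z1 z := fun p hp =>
      (hball p (hseg (openSegment_subset_segment ℝ _ _ hp))).2.1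
    obtain ⟨t, ht0, ht1, -, h⟩ := exists_exit hξ hz1V.1 hz1V.2 hsee (Or.inl hzI) hzs hzξ
    rcases h with h | ⟨-, p, q, hE, -, hq⟩
    · have ht : t = 1 := by
        by_contra hne
        have hlt : t < 1 := ht1.lt_of_ne hne
        obtain ⟨W⟩ := h 0 le_rfl ht0
        have hz'b := hball _ (hseg (pt_mem_segment ht0.le ht1))
        obtain ⟨c, hc0, hc1, hc⟩ := mem_openSegment_iff_pt.1 W.a_mem
        have hd0 : dt ξ W.a (pt z1 z t) = 0 := by
          rw [hc]; unfold dt; simp only [pt_apply]; ring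
        have haz : dt ξ W.a z = 0 := by
          by_contra h'
          exact hz'b.2.2 _ W.ha h' hd0
        have h1 : dt ξ z (pt z1 z t) = (1 - t) * dt ξ z z1 := by
          rw [(isAff_dt ξ z).pt, dt_self_right]; ring
        have h2 : dt ξ z W.a = 0 := by
          have : dt ξ z W.a = - dt ξ W.a z := by unfold dt; ring
          rw [this, haz, neg_zero]
        have h3 : dt ξ z W.a = c * dt ξ z (pt z1 z t) := by
          rw [hc, (isAff_dt ξ z).pt, dt_self_left]; ring
        rw [h2, h1] at h3
        have := mul_ne_zero hc0.ne' (mul_ne_zero (by linarith : (1 - t) ≠ 0) hz1d)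
        exact this h3.symm
      subst ht
      obtain ⟨W⟩ := h 0 le_rfl one_pos
      rw [pt_one, pt_zero] at W
      exact ⟨z1, (hball z1 hz1b).1, ⟨W⟩⟩
    · exact absurd (D.seg_sub _ _ hE (openSegment_subset_segment ℝ _ _ hq)) (notMem_F hzI)

end Region

namespace Win
open Region
variable {D : Region} {ξ z z1 : Plane}

theorem ξ_ne (W : Win D ξ z z1) : ξ ≠ z := by
  rintro rfl
  linarith [W.hcξ, W.hcz]

theorem dt_ne (W : Win D ξ z z1) : dt ξ z z1 ≠ 0 :=
  dt_ne_zero_of_isAff W.ρA W.ξ_ne W.ρξ W.ρz W.ρz1.ne'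

theorem fan (W : Win D ξ z z1) {b v : Plane} (hb : b ∈ openSegment ℝ ξ z) (hv : 0 < W.ρ v) :
    ∀ᶠ τ in 𝓝[>] (0 : ℝ), pt b v τ ∈ D.I := by
  obtain ⟨A, B, hA, hB, Aξ, Az, Az1, Bξ, Bz, Bz1, inj⟩ := exists_frame W.dt_ne
  obtain ⟨c, hc, hBρ⟩ := hB.proportional W.ρA W.ξ_ne Bξ Bz W.ρξ W.ρz
    (show 0 < B z1 by rw [Bz1]; norm_num) W.ρz1
  have hBv : 0 < B v := by rw [hBρ]; exact mul_pos hc hv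
  have bB : B b = 0 := isAff_zero_on_segment hB Bξ Bz (openSegment_subset_segment ℝ _ _ hb)
  have bA : 0 < A b ∧ A b < 1 := by
    obtain ⟨s, hs0, hs1, rfl⟩ := mem_openSegment_iff_pt.1 hb
    rw [hA.pt, Aξ, Az]; constructor <;> linarith
  have c1 : ContinuousAt (fun τ : ℝ => A (pt b v τ)) 0 :=
    (hA.continuous.comp (continuous_pt b v)).continuousAt
  have c2 : ContinuousAt (fun τ : ℝ => 1 - (A (pt b v τ) + B (pt b v τ))) 0 :=
    (continuous_const.sub ((hA.continuous.comp (continuous_pt b v)).add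
      (hB.continuous.comp (continuous_pt b v)))).continuousAt
  filter_upwards [eventually_pos_right c1 (by simpa only [pt_zero] using bA.1),
    eventually_pos_right c2 (by simp only [pt_zero, bB]; linarith [bA.2]),
    self_mem_nhdsWithin] with τ h1 h2 h3
  have h3 : 0 < τ := h3
  refine triangle_sub hA hB inj Aξ Az Az1 Bξ Bz Bz1 W.hV h1.le ?_ (by linarith)
  rw [hB.pt, bB]; linarith [mul_pos h3 hBv]

/-- No edge issues from a point between `ξ` and `z` into the side of `z1`. -/
theorem fan_edge (W : Win D ξ z z1) {b v p q : Plane} (hb : b ∈ openSegment ℝ ξ z) (hE : D.E p q)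
    (hbE : b ∈ segment ℝ p q) (hvE : v ∈ segment ℝ p q) : W.ρ v ≤ 0 := by
  by_contra hv
  have hlt : ∀ᶠ τ in 𝓝[>] (0 : ℝ), τ < 1 :=
    mem_nhdsWithin_of_mem_nhds (Iio_mem_nhds (by norm_num))
  obtain ⟨τ, ⟨hτI, hτ1⟩, hτ0⟩ := (((W.fan hb (not_le.1 hv)).and hlt).and self_mem_nhdsWithin).exists
  exact notMem_F hτI (D.seg_sub _ _ hE ((convex_segment p q).segment_subset hbE hvE
    (pt_mem_segment (le_of_lt hτ0) (le_of_lt hτ1))))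

end Win

namespace Pocket
open Region
variable {D : Region} (Q : Pocket D)

theorem a_mem_F : Q.a ∈ D.F := vertex_mem_F Q.ha

theorem σ_reg : D.Reg Q.σ := ⟨_, _, Q.hE, Q.hσ⟩

theorem σ_mem_F : Q.σ ∈ D.F := Q.σ_reg.mem_F

theorem a_ne_σ : Q.a ≠ Q.σ := fun h => vertex_not_reg Q.ha (h ▸ Q.σ_reg)

theorem chord_sub_P : segment ℝ Q.a Q.σ ⊆ D.P := by
  intro x hx
  obtain ⟨t, h0, h1, rfl⟩ := mem_segment_iff_pt.1 hx
  rcases h0.eq_or_lt with rfl | h0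
  · rw [pt_zero]; exact Or.inr Q.a_mem_F
  rcases h1.eq_or_lt with rfl | h1
  · rw [pt_one]; exact Or.inr Q.σ_mem_F
  exact Or.inl (Q.see.pt_mem h0 h1)

theorem hc_zero {x : Plane} (hx : x ∈ segment ℝ Q.a Q.σ) : Q.hc x = 0 :=
  isAff_zero_on_segment Q.hcA Q.hca Q.hcσ hx

theorem hc_zero' {x : Plane} (hx : x ∈ openSegment ℝ Q.a Q.σ) : Q.hc x = 0 :=
  Q.hc_zero (openSegment_subset_segment ℝ _ _ hx)

theorem mem_I {x : Plane} (hx : x ∈ openSegment ℝ Q.a Q.σ) : x ∈ D.I := Q.see hx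

theorem heσ : Q.he Q.σ = 0 :=
  isAff_zero_on_segment Q.heA Q.hew Q.hef (openSegment_subset_segment ℝ _ _ Q.hσ)

theorem he_chord {x : Plane} (hx : x ∈ openSegment ℝ Q.a Q.σ) : 0 < Q.he x := by
  obtain ⟨t, h0, h1, rfl⟩ := mem_openSegment_iff_pt.1 hx
  rw [Q.heA.pt, Q.heσ]
  linarith [mul_pos (sub_pos.2 h1) Q.hea]

theorem U_sub_P : Q.U ⊆ D.P := fun _ hx => (connectedComponentIn_subset _ _ hx).1

theorem notMem_chord {x : Plane} (hx : x ∈ Q.U) : x ∉ segment ℝ Q.a Q.σ :=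
  (connectedComponentIn_subset _ _ hx).2

theorem absorb {K : Set Plane} {x : Plane} (hK : IsPreconnected K) (hKP : K ⊆ D.P)
    (hKc : ∀ p ∈ K, p ∉ segment ℝ Q.a Q.σ) (hxK : x ∈ K) (hx : x ∈ Q.U) : K ⊆ Q.U :=
  comp_absorb hK (fun p hp => ⟨hKP hp, hKc p hp⟩) hxK hx

theorem notMem_chord_of_hc {x : Plane} (hx : Q.hc x ≠ 0) : x ∉ segment ℝ Q.a Q.σ :=
  fun h => hx (Q.hc_zero h)

theorem isPreconnected_U : IsPreconnected Q.U := isPreconnected_connectedComponentIn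

theorem w_mem_U : Q.w ∈ Q.U :=
  mem_connectedComponentIn ⟨Or.inr (vertex_mem_F (D.E_left _ _ Q.hE)),
    Q.notMem_chord_of_hc Q.hcw.ne'⟩

theorem exists_param {x : Plane} (hx : Q.hc x = 0) : ∃ t, x = pt Q.a Q.σ t :=
  Q.hcA.exists_pt Q.a_ne_σ Q.hca Q.hcσ Q.hcw.ne' hx

theorem sides_σ : ∀ᶠ x in 𝓝 Q.σ, (0 < Q.he x → x ∈ D.I) ∧ (Q.he x < 0 → x ∉ D.P) ∧
    (x ∈ D.F → x ∈ segment ℝ Q.w Q.f) :=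
  eventually_sides Q.hE Q.hσ Q.heA Q.hew Q.hef Q.hea Q.see

theorem he_pos {q : Plane} (hq : D.Sees Q.σ q) : 0 < Q.he q := by
  have h0 := aff_ne_zero_of_sees Q.hE Q.hσ Q.heA Q.hew Q.hef ⟨_, Q.hea.ne'⟩ hq.symm
  by_contra hle
  have hlt : Q.he q < 0 := lt_of_le_of_ne (not_lt.1 hle) h0
  have hl1 : ∀ᶠ τ in 𝓝[>] (0 : ℝ), τ < 1 :=
    mem_nhdsWithin_of_mem_nhds (Iio_mem_nhds (by norm_num))
  obtain ⟨τ, ⟨h1, h2⟩, h3⟩ := ((((tendsto_pt_zero Q.σ q).eventually Q.sides_σ).and hl1).and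
    self_mem_nhdsWithin).exists
  have h3 : 0 < τ := h3
  refine h1.2.1 ?_ (Or.inl (hq.pt_mem h3 h2))
  rw [Q.heA.pt, Q.heσ]
  linarith [mul_neg_of_pos_of_neg h3 hlt]

theorem mem_of_sees {x : Plane} (hx : x ∈ openSegment ℝ Q.a Q.σ) {z : Plane} (hz : z ∈ D.P)
    (hs : D.Sees x z) (hcz : 0 < Q.hc z) {u : ℝ} (hu0 : 0 < u) (hu1 : u ≤ 1) : pt x z u ∈ Q.U := by
  have hsub : pt x z '' Ioc 0 1 ⊆ D.P := by
    rintro _ ⟨v, ⟨h0, h1⟩, rfl⟩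
    rcases h1.eq_or_lt with rfl | h1
    · rw [pt_one]; exact hz
    · exact Or.inl (hs.pt_mem h0 h1)
  have hpos : ∀ v : ℝ, 0 < v → 0 < Q.hc (pt x z v) := by
    intro v hv
    rw [Q.hcA.pt, Q.hc_zero' hx]; linarith [mul_pos hv hcz]
  have hl1 : ∀ᶠ τ in 𝓝[>] (0 : ℝ), τ < 1 :=
    mem_nhdsWithin_of_mem_nhds (Iio_mem_nhds (by norm_num))
  obtain ⟨τ, ⟨h1, h2⟩, h3⟩ := ((((tendsto_pt_zero x z).eventually (Q.S2 x hx)).and hl1).and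
    self_mem_nhdsWithin).exists
  have h3 : 0 < τ := h3
  refine Q.absorb (isPreconnected_ray x z) hsub ?_ ⟨τ, ⟨h3, h2.le⟩, rfl⟩ (h1.1 (hpos _ h3))
    ⟨u, ⟨hu0, hu1⟩, rfl⟩
  rintro _ ⟨v, ⟨h0, -⟩, rfl⟩
  exact Q.notMem_chord_of_hc (hpos v h0).ne'

/-- A ray starting on the chord into its negative side stays out of the pocket. -/
theorem notMem_of_neg {x q : Plane} (hx : x ∈ openSegment ℝ Q.a Q.σ) (hq : Q.hc q < 0)
    (hsub : pt x q '' Ioc 0 1 ⊆ D.P) : q ∉ Q.U := by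
  intro hqU
  have hneg : ∀ v : ℝ, 0 < v → Q.hc (pt x q v) < 0 := by
    intro v hv
    rw [Q.hcA.pt, Q.hc_zero' hx]; linarith [mul_neg_of_pos_of_neg hv hq]
  have hl1 : ∀ᶠ τ in 𝓝[>] (0 : ℝ), τ < 1 :=
    mem_nhdsWithin_of_mem_nhds (Iio_mem_nhds (by norm_num))
  obtain ⟨τ, ⟨h1, h2⟩, h3⟩ := ((((tendsto_pt_zero x q).eventually (Q.S2 x hx)).and hl1).and
    self_mem_nhdsWithin).exists
  have h3 : 0 < τ := h3
  refine h1.2 (hneg _ h3) (Q.absorb (isPreconnected_ray x q) hsub ?_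
    ⟨1, ⟨one_pos, le_rfl⟩, pt_one _ _⟩ hqU ⟨τ, ⟨h3, h2.le⟩, rfl⟩)
  rintro _ ⟨v, ⟨h0, -⟩, rfl⟩
  exact Q.notMem_chord_of_hc (hneg v h0).ne

theorem ray_sub_P {x q : Plane} (hs : D.Sees x q) (hq : q ∈ D.P) : pt x q '' Ioc 0 1 ⊆ D.P := by
  rintro _ ⟨v, ⟨h0, h1⟩, rfl⟩
  rcases h1.eq_or_lt with rfl | h1
  · rw [pt_one]; exact hq
  · exact Or.inl (hs.pt_mem h0 h1)

/-- Whatever is seen inside the pocket from its chord or its regular end lies on the positive side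
of the chord. -/
theorem hc_pos_of_sees {ξ q : Plane} (hξ : ξ ∈ openSegment ℝ Q.a Q.σ ∨ ξ = Q.σ) (hq : q ∈ Q.U)
    (hs : D.Sees ξ q) : 0 < Q.hc q := by
  have hqP := Q.U_sub_P hq
  have hξ0 : Q.hc ξ = 0 := by
    rcases hξ with h | rfl
    · exact Q.hc_zero' h
    · exact Q.hcσ
  rcases lt_trichotomy (Q.hc q) 0 with h | h | h
  · exfalso
    rcases hξ with hξ | rfl
    · exact Q.notMem_of_neg hξ h (ray_sub_P hs hqP) hq
    · have heq := Q.he_pos hs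
      obtain ⟨ε, hε, hball⟩ := Metric.eventually_nhds_iff_ball.1 Q.sides_σ
      have hev : ∀ y, ∀ᶠ τ in 𝓝[>] (0 : ℝ), pt Q.σ y τ ∈ Metric.ball Q.σ ε := fun y =>
        (tendsto_pt_zero Q.σ y).eventually (Metric.ball_mem_nhds _ hε)
      have hl1 : ∀ᶠ τ in 𝓝[>] (0 : ℝ), τ < 1 :=
        mem_nhdsWithin_of_mem_nhds (Iio_mem_nhds (by norm_num))
      obtain ⟨τ, ⟨⟨b1, b2⟩, h2⟩, h3⟩ := ((((hev q).and (hev Q.a)).and hl1).and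
        self_mem_nhdsWithin).exists
      have h3 : 0 < τ := h3
      have e1 : 0 < Q.he (pt Q.σ q τ) := by
        rw [Q.heA.pt, Q.heσ]; linarith [mul_pos h3 heq]
      have e2 : 0 < Q.he (pt Q.σ Q.a τ) := by
        rw [Q.heA.pt, Q.heσ]; linarith [mul_pos h3 Q.hea]
      have hx : pt Q.σ Q.a τ ∈ openSegment ℝ Q.a Q.σ := by
        rw [openSegment_symm]; exact pt_mem_openSegment h3 h2
      have hneg : ∀ v : ℝ, 0 < v → Q.hc (pt Q.σ q v) < 0 := by
        intro v hv
        rw [Q.hcA.pt, hξ0]; linarith [mul_neg_of_pos_of_neg hv h]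
      refine Q.notMem_of_neg hx (hneg τ h3) ?_ (Q.absorb (isPreconnected_ray Q.σ q)
        (ray_sub_P hs hqP) ?_ ⟨1, ⟨one_pos, le_rfl⟩, pt_one _ _⟩ hq ⟨τ, ⟨h3, h2.le⟩, rfl⟩)
      · rintro _ ⟨v, ⟨v0, v1⟩, rfl⟩
        refine Or.inl ((hball _ ?_).1 ?_)
        · exact (convex_ball Q.σ ε).segment_subset b2 b1 (pt_mem_segment v0.le v1)
        · rw [Q.heA.pt]
          linarith [mul_pos v0 e1, mul_nonneg (sub_nonneg.2 v1) e2.le]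
      · rintro _ ⟨v, ⟨h0, -⟩, rfl⟩
        exact Q.notMem_chord_of_hc (hneg v h0).ne
  · exfalso
    obtain ⟨u, rfl⟩ := Q.exists_param h
    have hu := Q.notMem_chord hq
    obtain ⟨v, hv0, hv1, rfl⟩ : ∃ v : ℝ, 0 < v ∧ v ≤ 1 ∧ ξ = pt Q.a Q.σ v := by
      rcases hξ with hξ | rfl
      · obtain ⟨v, h0, h1, rfl⟩ := mem_openSegment_iff_pt.1 hξ
        exact ⟨v, h0, h1.le, rfl⟩
      · exact ⟨1, one_pos, le_rfl, (pt_one _ _).symm⟩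
    have hout : u < 0 ∨ 1 < u := by
      by_contra hc
      push Not at hc
      exact hu (pt_mem_segment hc.1 hc.2)
    rcases hout with hu0 | hu1
    · refine notMem_F (hs.pt_mem (t := v / (v - u)) (div_pos hv0 (by linarith))
        (by rw [div_lt_one (by linarith)]; linarith)) ?_
      rw [pt_pt]
      have : v + v / (v - u) * (u - v) = 0 := by
        have : v - u ≠ 0 := by intro h; linarith
        field_simp; ring
      rw [this, pt_zero]; exact Q.a_mem_F
    · rcases hv1.lt_or_eq with hv1 | rfl
      · refine notMem_F (hs.pt_mem (t := (1 - v) / (u - v)) (div_pos (by linarith) (by linarith))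
          (by rw [div_lt_one (by linarith)]; linarith)) ?_
        rw [pt_pt, div_mul_cancel₀ _ (by intro h; linarith), add_sub_cancel, pt_one]
        exact Q.σ_mem_F
      · rw [pt_one] at hs
        have := Q.he_pos hs
        rw [Q.heA.pt, Q.heσ] at this
        linarith [mul_pos (sub_pos.2 hu1) Q.hea]
  · exact h

end Pocket

theorem IsAff.nonneg_of_half_open {h : Plane → ℝ} (hh : IsAff h) {x y : Plane} (hxy : x ≠ y)
    (H : ∀ q ∈ segment ℝ x y, q ≠ y → 0 < h q) : 0 ≤ h y := by
  by_contra hlt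
  push Not at hlt
  have hx := H x (left_mem_segment ℝ _ _) hxy
  have hpos : 0 < h x - h y := by linarith
  have ht1 : h x / (h x - h y) < 1 := by rw [div_lt_one hpos]; linarith
  have ht0 : 0 < h x / (h x - h y) := div_pos hx hpos
  have h0 : h (_root_.pt x y (h x / (h x - h y))) = 0 := by
    rw [hh.pt]; field_simp; ring
  have := H _ (pt_mem_segment ht0.le ht1.le) (by
    intro he
    rw [he] at h0; linarith)
  linarith

namespace Pocket
open Region
variable {D : Region} (Q : Pocket D)

open Classical in
/-- The number of vertices in the pocket. -/
noncomputable def J : ℕ := (D.Vs.filter (· ∈ Q.U)).card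

theorem card_gain {Q Q' : Pocket D} (hsub : Q'.U ⊆ Q.U) (S : Finset Plane)
    (hS : ∀ v ∈ S, v ∈ D.Vs ∧ v ∈ Q.U ∧ v ∉ Q'.U) : Q'.J + S.card ≤ Q.J := by
  classical
  unfold J
  rw [← Finset.card_union_of_disjoint]
  · apply Finset.card_le_card
    intro v hv
    rcases Finset.mem_union.1 hv with h | h
    · rw [Finset.mem_filter] at h ⊢
      exact ⟨h.1, hsub h.2⟩
    · exact Finset.mem_filter.2 ⟨(hS v h).1, (hS v h).2.1⟩
  · rw [Finset.disjoint_left]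
    intro v h1 h2
    exact (hS v h2).2.2 (Finset.mem_filter.1 h1).2

theorem J_pos : 1 ≤ Q.J := by
  classical
  exact Finset.card_pos.2 ⟨Q.w, Finset.mem_filter.2 ⟨D.E_left _ _ Q.hE, Q.w_mem_U⟩⟩

/-- How the pocket of a window seen from the chord of `Q` sits in `Q`. -/
structure Nested {D : Region} (Q Q' : Pocket D) : Prop where
  hca : 0 < Q.hc Q'.a
  hcσ : 0 < Q.hc Q'.σ
  U_sub : Q'.U ⊆ Q.U
  a_mem : Q'.a ∈ Q.U
  a_notMem : Q'.a ∉ Q'.U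
  w_gain : Q.w ≠ Q'.a → Q'.σ ∉ segment ℝ Q.σ Q.w → Q.w ∉ Q'.U
  r_mem : Q.r ∈ Q.U
  r_gain : Q.r ≠ Q'.a → Q'.σ ∉ segment ℝ Q.a Q.r → Q.r ∉ Q'.U

theorem Nested.hc_chord {Q Q' : Pocket D} (h : Nested Q Q') {x : Plane}
    (hx : x ∈ segment ℝ Q'.a Q'.σ) : 0 < Q.hc x :=
  Q.hcA.convex_pos.segment_subset (x := Q'.a) (y := Q'.σ) h.hca h.hcσ hx

theorem Nested.J_lt {Q Q' : Pocket D} (h : Nested Q Q') : Q'.J + 1 ≤ Q.J :=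
  card_gain h.U_sub {Q'.a} (by simpa using ⟨Q'.ha, h.a_mem, h.a_notMem⟩)

theorem Nested.J_gain_w {Q Q' : Pocket D} (h : Nested Q Q') (h1 : Q.w ≠ Q'.a)
    (h2 : Q'.σ ∉ segment ℝ Q.σ Q.w) : Q'.J + 2 ≤ Q.J := by
  classical
  have := card_gain h.U_sub {Q.w, Q'.a} (by
    simp only [Finset.mem_insert, Finset.mem_singleton, forall_eq_or_imp, forall_eq]
    exact ⟨⟨D.E_left _ _ Q.hE, Q.w_mem_U, h.w_gain h1 h2⟩, Q'.ha, h.a_mem, h.a_notMem⟩)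
  rwa [Finset.card_pair h1] at this

theorem Nested.J_gain_r {Q Q' : Pocket D} (h : Nested Q Q') (h1 : Q.r ≠ Q'.a)
    (h2 : Q'.σ ∉ segment ℝ Q.a Q.r) : Q'.J + 2 ≤ Q.J := by
  classical
  have := card_gain h.U_sub {Q.r, Q'.a} (by
    simp only [Finset.mem_insert, Finset.mem_singleton, forall_eq_or_imp, forall_eq]
    exact ⟨⟨E_right Q.har, h.r_mem, h.r_gain h1 h2⟩, Q'.ha, h.a_mem, h.a_notMem⟩)
  rwa [Finset.card_pair h1] at this

variable {ξ z z1 : Plane}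

theorem hc_zero_of_mem {Q : Pocket D} (hξ : ξ ∈ openSegment ℝ Q.a Q.σ ∨ ξ = Q.σ) : Q.hc ξ = 0 := by
  rcases hξ with h | rfl
  · exact Q.hc_zero' h
  · exact Q.hcσ

theorem hc_pos_target (hξ : ξ ∈ openSegment ℝ Q.a Q.σ ∨ ξ = Q.σ) (W : Win D ξ z z1)
    (hz1 : ∀ q ∈ segment ℝ z1 z, q ≠ z → q ∈ Q.U) : 0 < Q.hc z := by
  have hzz : z1 ≠ z := by
    rintro rfl; linarith [W.ρz, W.ρz1]
  have hξ0 := hc_zero_of_mem hξ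
  have hpos : ∀ q ∈ segment ℝ z1 z, q ≠ z → 0 < Q.hc q := fun q hq hqz =>
    Q.hc_pos_of_sees hξ (hz1 q hq hqz) (W.hV q hq hqz).2
  have hc1 : 0 < Q.hc z1 := hpos z1 (left_mem_segment ℝ _ _) hzz
  refine lt_of_le_of_ne (Q.hcA.nonneg_of_half_open hzz hpos) fun hz0 => ?_
  have hz0 := hz0.symm
  obtain ⟨c, hc, hprop⟩ := W.ρA.proportional Q.hcA W.ξ_ne W.ρξ W.ρz hξ0 hz0 W.ρz1 hc1
  obtain ⟨u, hu⟩ := Q.exists_param hz0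
  obtain ⟨v, hv0, hv1, hv⟩ : ∃ v : ℝ, 0 < v ∧ v ≤ 1 ∧ ξ = pt Q.a Q.σ v := by
    rcases hξ with hξ | rfl
    · obtain ⟨v, h0, h1, h⟩ := mem_openSegment_iff_pt.1 hξ
      exact ⟨v, h0, h1.le, h⟩
    · exact ⟨1, one_pos, le_rfl, (pt_one _ _).symm⟩
  obtain ⟨k, hk0, hk1, hk⟩ := mem_openSegment_iff_pt.1 W.a_mem
  obtain ⟨κ, hκ⟩ : ∃ κ, κ = v + k * (u - v) := ⟨_, rfl⟩
  replace hk : W.a = pt Q.a Q.σ κ := hk.trans (by rw [hκ, ← pt_pt, ← hv, ← hu])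
  have hκI : ¬ (0 < κ ∧ κ < 1) := fun h =>
    notMem_F (Q.see.pt_mem h.1 h.2) (hk ▸ vertex_mem_F W.ha)
  have hκ1 : κ ≠ 1 := by
    rintro h
    rw [h, pt_one] at hk
    exact vertex_not_reg W.ha (hk ▸ Q.σ_reg)
  rcases le_or_gt κ 0 with h | h
  · have huv : u < 0 := by
      by_contra hu0
      push Not at hu0
      have := mul_pos (sub_pos.2 hk1) hv0
      have := mul_nonneg hk0.le hu0
      linarith
    have ha : Q.a ∈ openSegment ℝ ξ z := by
      refine mem_openSegment_iff_pt.2 ⟨v / (v - u), div_pos hv0 (by linarith), ?_, ?_⟩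
      · rw [div_lt_one (by linarith)]; linarith
      · have e : v + v / (v - u) * (u - v) = 0 := by
          have : v - u ≠ 0 := by intro h; linarith
          field_simp; ring
        rw [hv, hu, pt_pt, e, pt_zero]
    have := W.fan_edge ha Q.har (left_mem_segment ℝ _ _) (right_mem_segment ℝ _ _)
    rw [hprop] at this
    linarith [mul_pos hc Q.hcr]
  · have hκ2 : 1 < κ := by
      by_contra h'
      exact hκI ⟨h, lt_of_le_of_ne (not_lt.1 h') hκ1⟩
    have huv : 1 < u := by
      by_contra hu0
      push Not at hu0
      have := mul_nonneg (sub_pos.2 hk1).le (sub_nonneg.2 hv1)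
      have := mul_nonneg hk0.le (sub_nonneg.2 hu0)
      linarith
    rcases hv1.lt_or_eq with hv1 | rfl
    · have ha : Q.σ ∈ openSegment ℝ ξ z := by
        refine mem_openSegment_iff_pt.2 ⟨(1 - v) / (u - v), div_pos (by linarith) (by linarith), ?_, ?_⟩
        · rw [div_lt_one (by linarith)]; linarith
        · rw [hv, hu, pt_pt, div_mul_cancel₀ _ (by intro h; linarith), add_sub_cancel, pt_one]
      have := W.fan_edge ha Q.hE (openSegment_subset_segment ℝ _ _ Q.hσ) (left_mem_segment ℝ _ _)
      rw [hprop] at this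
      linarith [mul_pos hc Q.hcw]
    · rw [pt_one] at hv
      have := Q.heA.nonneg_of_half_open hzz fun q hq hqz => Q.he_pos (hv ▸ (W.hV q hq hqz).2)
      rw [hu, Q.heA.pt, Q.heσ] at this
      linarith [mul_pos (sub_pos.2 huv) Q.hea]

theorem nested (hξ : ξ ∈ openSegment ℝ Q.a Q.σ ∨ ξ = Q.σ) (W : Win D ξ z z1)
    (hz1 : ∀ q ∈ segment ℝ z1 z, q ≠ z → q ∈ Q.U) : Nested Q W.toPocket := by
  have hzz : z1 ≠ z := by
    rintro rfl; linarith [W.ρz, W.ρz1]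
  have hξ0 := hc_zero_of_mem hξ
  have hcz := Q.hc_pos_target hξ W hz1
  have hpos : ∀ q ∈ segment ℝ z1 z, q ≠ z → 0 < Q.hc q := fun q hq hqz =>
    Q.hc_pos_of_sees hξ (hz1 q hq hqz) (W.hV q hq hqz).2
  have hc1 : 0 < Q.hc z1 := hpos z1 (left_mem_segment ℝ _ _) hzz
  have hca : 0 < Q.hc W.a := by
    obtain ⟨k, hk0, hk1, hk⟩ := mem_openSegment_iff_pt.1 W.a_mem
    rw [hk, Q.hcA.pt, hξ0]; linarith [mul_pos hk0 hcz]
  have hcσ : 0 < Q.hc W.σ := W.posA Q.hc Q.hcA hξ0 hcz hc1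
  have hchord : ∀ x ∈ segment ℝ W.a W.σ, 0 < Q.hc x := fun x hx =>
    Q.hcA.convex_pos.segment_subset (x := W.a) (y := W.σ) hca hcσ hx
  have hξmem : ξ ∈ segment ℝ Q.a Q.σ := by
    rcases hξ with h | rfl
    · exact openSegment_subset_segment ℝ _ _ h
    · exact right_mem_segment ℝ _ _
  have hzQ : z ∈ Q.U := by
    refine Q.absorb (isPreconnected_segment z1 z) ?_ ?_ (left_mem_segment ℝ _ _)
      (hz1 z1 (left_mem_segment ℝ _ _) hzz) (right_mem_segment ℝ _ _)
    · intro q hq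
      by_cases hqz : q = z
      · rw [hqz]; exact W.U_sub_P W.zU
      · exact Or.inl (W.hV q hq hqz).1
    · intro q hq
      by_cases hqz : q = z
      · rw [hqz]; exact Q.notMem_chord_of_hc hcz.ne'
      · exact Q.notMem_chord_of_hc (hpos q hq hqz).ne'
  have hdisj : ∀ p ∈ W.U, p ∉ segment ℝ Q.a Q.σ := by
    intro p hp hpc
    refine W.ξU (W.absorb (isPreconnected_segment Q.a Q.σ) Q.chord_sub_P ?_ hpc hp hξmem)
    intro q hq hq'
    linarith [hchord q hq', Q.hc_zero hq]
  have hsub : W.U ⊆ Q.U := Q.absorb W.isPreconnected_U W.U_sub_P hdisj W.zU hzQ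
  have haU : W.a ∈ Q.U := by
    obtain ⟨x, hx, hx'⟩ := W.cross
    obtain ⟨k, hk0, hk1, rfl⟩ := mem_openSegment_iff_pt.1 hx'
    refine Q.absorb (isPreconnected_segment W.a W.σ) W.chord_sub_P
      (fun p hp => Q.notMem_chord_of_hc (hchord p hp).ne') (openSegment_subset_segment ℝ _ _ hx)
      (hz1 _ (openSegment_subset_segment ℝ _ _ hx') ?_) (left_mem_segment ℝ _ _)
    intro he
    have h1 := pt_injective hzz (he.trans (pt_one _ _).symm)
    linarith
  have edge : ∀ p q b v, D.E p q → b ∈ segment ℝ Q.a Q.σ → segment ℝ b v ⊆ segment ℝ p q →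
      v ∈ segment ℝ b v → (W.a ∉ segment ℝ b v) → W.σ ∉ segment ℝ b v → v ∉ W.U := by
    intro p q b v hE hb hsubE hv h1 h2 hvU
    refine hdisj b (W.absorb (isPreconnected_segment b v)
      (fun x hx => Or.inr (D.seg_sub _ _ hE (hsubE hx))) ?_ hv hvU (left_mem_segment ℝ _ _)) hb
    intro x hx hx'
    obtain ⟨t, t0, t1, rfl⟩ := mem_segment_iff_pt.1 hx'
    rcases t0.eq_or_lt with rfl | t0
    · rw [pt_zero] at hx; exact h1 hx
    rcases t1.eq_or_lt with rfl | t1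
    · rw [pt_one] at hx; exact h2 hx
    exact notMem_F (W.see.pt_mem t0 t1) (D.seg_sub _ _ hE (hsubE hx))
  refine ⟨hca, hcσ, hsub, haU, fun h => W.notMem_chord h (left_mem_segment ℝ _ _), ?_, Q.r_mem, ?_⟩
  · intro hwa hσ
    have hsubE : segment ℝ Q.σ Q.w ⊆ segment ℝ Q.w Q.f :=
      (convex_segment _ _).segment_subset (openSegment_subset_segment ℝ _ _ Q.hσ)
        (left_mem_segment ℝ _ _)
    refine edge Q.w Q.f Q.σ Q.w Q.hE (right_mem_segment ℝ _ _) hsubE (right_mem_segment ℝ _ _)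
      (fun h => ?_) hσ
    rcases vertex_mem_segment W.ha Q.hE (hsubE h) with h' | h'
    · exact hwa h'.symm
    · obtain ⟨t, t0, t1, ht⟩ := mem_openSegment_iff_pt.1 Q.hσ
      have e := Q.hcσ
      rw [ht, Q.hcA.pt, ← h'] at e
      linarith [mul_pos (sub_pos.2 t1) Q.hcw, mul_pos t0 hca]
  · intro hra hσ
    refine edge Q.a Q.r Q.a Q.r Q.har (left_mem_segment ℝ _ _) Subset.rfl (right_mem_segment ℝ _ _)
      (fun h => ?_) hσ
    rcases vertex_mem_segment W.ha Q.har h with h' | h'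
    · rw [h', Q.hca] at hca; exact lt_irrefl _ hca
    · exact hra h'.symm

end Pocket

namespace Region
open Pocket
variable {D : Region} {s : Plane}

theorem _root_.Win.cross_ray {ξ x y : Plane} {t u : ℝ} (W : Win D ξ (pt x y t) (pt x y u))
    (hxy : D.Sees x y) (hu : 0 ≤ u) (hut : u < t) (ht1 : t ≤ 1) :
    ∃ x' ∈ openSegment ℝ W.a W.σ, D.Sees x' y ∧ 0 < W.hc y := by
  obtain ⟨x', hx', hx'z⟩ := W.cross
  obtain ⟨k, k0, k1, rfl⟩ := mem_openSegment_iff_pt.1 hx'z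
  rw [pt_pt] at hx'
  obtain ⟨κ, hκ⟩ : ∃ κ, κ = u + k * (t - u) := ⟨_, rfl⟩
  have hut' := sub_pos.2 hut
  rw [← hκ] at hx'
  have hκ0 : 0 < κ := by linarith [mul_pos k0 hut']
  have hκt : κ < t := by linarith [mul_pos (sub_pos.2 k1) hut']
  have hsee' : D.Sees (pt x y κ) y := by
    have := hxy.pt_pt hκ0.le (by linarith) zero_le_one le_rfl (by linarith)
    rwa [pt_one] at this
  refine ⟨_, hx', hsee', ?_⟩
  have h1 := W.hc_zero' hx'
  have h2 := W.hcz
  rw [W.hcA.pt] at h1 h2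
  have h3 : 0 < (t - κ) * (W.hc y - W.hc x) := by linarith
  have h4 := pos_of_mul_pos_right h3 (by linarith)
  have h5 := mul_pos (show 0 < 1 - κ by linarith) h4
  linarith

/-- From the regular end of a pocket every regular point seen through its chord can be reached. -/
theorem Reach.through (n : ℕ) : ∀ (Q : Pocket D), Q.J ≤ n → ∀ m, D.Reach s m Q.σ → ∀ x y, D.Reg y →
    x ∈ openSegment ℝ Q.a Q.σ → D.Sees x y → 0 < Q.hc y →
    D.Reach s (m + Q.J) y ∨ (D.Reach s (m + Q.J + 1) y ∧ Q.he y ≤ 0) := by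
  induction n with
  | zero => intro Q hQ; have := Q.J_pos; omega
  | succ n ih =>
  intro Q hQ m hm x y hy hx hxy hcy
  have hJ := Q.J_pos
  have hyP : y ∈ D.P := Or.inr hy.mem_F
  by_cases hsee : D.Sees Q.σ y
  · exact Or.inl ((hm.step Q.σ_reg hsee hyP).mono (by omega))
  have hyσ : y ≠ Q.σ := by rintro rfl; rw [Q.hcσ] at hcy; exact lt_irrefl _ hcy
  have hσx : D.Sees Q.σ x := by
    obtain ⟨k, k0, k1, rfl⟩ := mem_openSegment_iff_pt.1 hx
    have := Q.see.pt_pt zero_le_one le_rfl k0.le k1.le k1.ne'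
    rwa [pt_one] at this
  obtain ⟨t, ht0, ht1, hvis, hcase⟩ := exists_exit (Or.inr Q.σ_reg) (Q.mem_I hx) hσx hxy
    (Or.inr hy) hsee hyσ
  rcases hcase with hwin | ⟨rfl, p, q, hE, hp, hq⟩
  · obtain ⟨W⟩ := hwin (t / 2) (by linarith) (by linarith)
    have hN : Nested Q W.toPocket := by
      refine Q.nested (Or.inr rfl) W fun p hp _ => ?_
      obtain ⟨k, k0, k1, rfl⟩ := mem_segment_iff_pt.1 hp
      rw [pt_pt]
      have := mul_nonneg k0 (show 0 ≤ t - t / 2 by linarith)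
      have := mul_nonneg (sub_nonneg.2 k1) (show 0 ≤ t - t / 2 by linarith)
      exact Q.mem_of_sees hx hyP hxy hcy (by linarith) (by linarith)
    have hJ1 := hN.J_lt
    obtain ⟨x', hx', hsee', hcy'⟩ := W.cross_ray hxy (by linarith) (by linarith) ht1
    have hm' : D.Reach s (m + 1) W.σ := hm.step Q.σ_reg W.see_ξσ (Or.inr W.σ_mem_F)
    by_cases haw : Q.w = W.a
    · have hez : Q.he y ≤ 0 := by
        obtain ⟨k, k0, k1, hk⟩ := mem_openSegment_iff_pt.1 W.a_mem
        have h1 : Q.he (pt x y t) = 0 := by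
          have h0 := Q.hew
          rw [haw, hk, Q.heA.pt, Q.heσ] at h0
          have : k * Q.he (pt x y t) = 0 := by linarith
          exact (mul_eq_zero.1 this).resolve_left k0.ne'
        rw [Q.heA.pt] at h1
        have h2 := Q.he_chord hx
        by_contra hpos
        push Not at hpos
        have := mul_pos ht0 hpos
        have := mul_nonneg (sub_nonneg.2 ht1) h2.le
        linarith
      rcases ih W.toPocket (by omega) (m + 1) hm' _ y hy hx' hsee' hcy' with h | h
      · exact Or.inl (h.mono (by omega))
      · exact Or.inr ⟨h.1.mono (by omega), hez⟩
    · have hJ2 := hN.J_gain_w haw fun h => by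
        have h1 := Q.he_pos W.see_ξσ
        have h2 : Q.he W.σ = 0 := isAff_zero_on_segment Q.heA Q.heσ Q.hew h
        linarith
      rcases ih W.toPocket (by omega) (m + 1) hm' _ y hy hx' hsee' hcy' with h | h
      · exact Or.inl (h.mono (by omega))
      · exact Or.inl (h.1.mono (by omega))
  · have hen : Q.he y = 0 := by
      rcases D.uniq _ _ _ _ _ Q.hE hE Q.hσ (openSegment_subset_segment ℝ _ _ hp) with
        ⟨rfl, rfl⟩ | ⟨rfl, rfl⟩
      · exact isAff_zero_on_segment Q.heA Q.hew Q.hef (openSegment_subset_segment ℝ _ _ hq)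
      · exact isAff_zero_on_segment Q.heA Q.hef Q.hew (openSegment_subset_segment ℝ _ _ hq)
    obtain ⟨σ', hr, h1, h2⟩ := exists_common_reg (z1 := x) hE hp hq
      (dt_ne_zero_of_isAff Q.heA hyσ.symm Q.heσ hen (Q.he_chord hx).ne') fun p hp hpy => by
        obtain ⟨k, k0, k1, rfl⟩ := mem_segment_iff_pt.1 hp
        exact hvis k k0 (k1.lt_of_ne (by rintro rfl; exact hpy (pt_one _ _)))
    exact Or.inr ⟨((hm.step Q.σ_reg h1 (Or.inr hr.mem_F)).step hr h2.symm hyP).mono (by omega),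
      hen.le⟩

end Region

theorem exists_dt_ne {p q : Plane} (h : p ≠ q) : ∃ v, dt p q v ≠ 0 := by
  by_contra! H
  have h0 : ∀ x : Plane, (q 0 - p 0) * (x 1 - p 1) - (q 1 - p 1) * (x 0 - p 0) = 0 := by
    intro x
    have := H x
    simp only [dt] at this
    linarith
  have e1 := h0 (!₂[p 0 + 1, p 1])
  have e2 := h0 (!₂[p 0, p 1 + 1])
  simp at e1 e2
  exact h (plane_ext (by linarith) (by linarith))

theorem IsAff.frame_formula {g A B : Plane → ℝ} {o x y : Plane} (hg : IsAff g) (go : g o = 0)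
    (hA : IsAff A) (hB : IsAff B) (Ao : A o = 0) (Ax : A x = 1) (Ay : A y = 0)
    (Bo : B o = 0) (Bx : B x = 0) (By : B y = 1)
    (inj : ∀ p q, A p = A q → B p = B q → p = q) (p : Plane) : g p = g x * A p + g y * B p := by
  have hp : p = _root_.pt (_root_.pt o x (2 * A p)) (_root_.pt o y (2 * B p)) (1 / 2) := by
    apply inj
    · simp only [hA.pt, Ao, Ax, Ay]; ring
    · simp only [hB.pt, Bo, Bx, By]; ring
  have : g p = g (_root_.pt (_root_.pt o x (2 * A p)) (_root_.pt o y (2 * B p)) (1 / 2)) := congrArg g hp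
  rw [this]
  simp only [hg.pt, go]; ring

namespace Win
open Region
variable {D : Region} {ξ z z1 z4 z5 : Plane}

theorem tri_sub (W : Win D ξ z z1) (hξ : D.Valid ξ) {x : Plane} (hx : x ∈ segment ℝ W.a W.σ) :
    segment ℝ ξ x ⊆ D.P := by
  have hopen : ∀ y, D.Sees ξ y → y ∈ D.P → segment ℝ ξ y ⊆ D.P := by
    intro y hs hy q hq
    obtain ⟨t, h0, h1, rfl⟩ := mem_segment_iff_pt.1 hq
    rcases h0.eq_or_lt with rfl | h0
    · rw [pt_zero]; exact hξ.mem_P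
    rcases h1.eq_or_lt with rfl | h1
    · rw [pt_one]; exact hy
    exact Or.inl (hs.pt_mem h0 h1)
  obtain ⟨k, k0, k1, rfl⟩ := mem_segment_iff_pt.1 hx
  rcases k1.eq_or_lt with rfl | k1
  · rw [pt_one]; exact hopen _ W.see_ξσ (Or.inr W.toPocket.σ_mem_F)
  rcases k0.eq_or_lt with rfl | k0
  · rw [pt_zero]
    intro q hq
    obtain ⟨t, h0, h1, rfl⟩ := mem_segment_iff_pt.1 hq
    have hlim : Tendsto (fun τ : ℝ => pt ξ (pt W.a W.σ τ) t) (𝓝[>] 0) (𝓝 (pt ξ W.a t)) := by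
      have hc : Continuous fun τ : ℝ => pt ξ (pt W.a W.σ τ) t := by
        have e : (fun τ : ℝ => pt ξ (pt W.a W.σ τ) t) =
            fun τ => pt (pt ξ W.a t) (pt ξ W.σ t) τ := by
          funext τ
          apply plane_ext <;> simp only [pt_apply] <;> ring
        rw [e]
        exact continuous_pt _ _
      have := hc.tendsto 0
      simp only [pt_zero] at this
      exact this.mono_left nhdsWithin_le_nhds
    have hl1 : ∀ᶠ τ in 𝓝[>] (0 : ℝ), τ < 1 :=
      mem_nhdsWithin_of_mem_nhds (Iio_mem_nhds (by norm_num))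
    refine D.isClosed_P.mem_of_tendsto hlim ?_
    filter_upwards [hl1, self_mem_nhdsWithin] with τ h2 h3
    have hm := pt_mem_openSegment (x := W.a) (y := W.σ) h3 h2
    exact hopen _ (W.see_ξ _ hm) (Or.inl (W.toPocket.mem_I hm)) (pt_mem_segment h0 h1)
  · have hm := pt_mem_openSegment (x := W.a) (y := W.σ) k0 k1
    exact hopen _ (W.see_ξ _ hm) (Or.inl (W.toPocket.mem_I hm))

/-- Two windows of the same viewpoint, the second one further along the turning direction. -/
structure Sib (W : Win D ξ z z1) (W2 : Win D ξ z4 z5) : Prop where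
  ρz4 : 0 < W.ρ z4
  ρz5 : 0 < W.ρ z5
  ηz4 : 0 < W.η z4
  ηz5 : 0 < W.η z5
  ρ2 : ∃ x ∈ openSegment ℝ W.a W.σ, 0 < W2.ρ x

theorem η_chord (W : Win D ξ z z1) {x : Plane} (hx : x ∈ segment ℝ W.a W.σ) : W.η x ≤ 0 := by
  obtain ⟨k, k0, k1, rfl⟩ := mem_segment_iff_pt.1 hx
  rw [W.ηA.pt, W.ησ]
  linarith [mul_nonneg (sub_nonneg.2 k1) (neg_nonneg.2 W.ηa.le)]

theorem Sib.chord2 {W : Win D ξ z z1} {W2 : Win D ξ z4 z5} (S : Sib W W2) {x : Plane}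
    (hx : x ∈ segment ℝ W2.a W2.σ) : 0 < W.η x ∧ 0 < W.ρ x := by
  obtain ⟨k, k0, k1, hk⟩ := mem_openSegment_iff_pt.1 W2.a_mem
  have ha : 0 < W.η W2.a := by
    rw [hk, W.ηA.pt, W.ηξ]; linarith [mul_pos k0 S.ηz4]
  have hb : 0 < W.ρ W2.a := by
    rw [hk, W.ρA.pt, W.ρξ]; linarith [mul_pos k0 S.ρz4]
  have ha' := W2.posA W.η W.ηA W.ηξ S.ηz4 S.ηz5
  have hb' := W2.posA W.ρ W.ρA W.ρξ S.ρz4 S.ρz5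
  exact ⟨W.ηA.convex_pos.segment_subset (x := W2.a) (y := W2.σ) ha ha' hx,
    W.ρA.convex_pos.segment_subset (x := W2.a) (y := W2.σ) hb hb' hx⟩

theorem Sib.chord2_notMem {W : Win D ξ z z1} {W2 : Win D ξ z4 z5} (S : Sib W W2)
    (hξ : D.Valid ξ) {x : Plane} (hx : x ∈ segment ℝ W2.a W2.σ) : x ∉ W.U := by
  intro hxU
  refine W.ξU (W.absorb (isPreconnected_segment ξ x) (W2.tri_sub hξ hx) ?_
    (right_mem_segment ℝ _ _) hxU (left_mem_segment ℝ _ _))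
  intro p hp hpc
  obtain ⟨t, h0, h1, rfl⟩ := mem_segment_iff_pt.1 hp
  rcases h0.eq_or_lt with rfl | h0
  · rw [pt_zero] at hpc
    linarith [W.hc_zero hpc, W.hcξ]
  · have := W.η_chord hpc
    rw [W.ηA.pt, W.ηξ] at this
    linarith [mul_pos h0 (S.chord2 hx).1]

theorem Sib.chord_notMem {W : Win D ξ z z1} {W2 : Win D ξ z4 z5} (S : Sib W W2)
    (hξ : D.Valid ξ) {x : Plane} (hx : x ∈ segment ℝ W.a W.σ) : x ∉ W2.U := by
  intro hxU
  refine W2.ξU (W2.absorb (isPreconnected_segment ξ x) (W.tri_sub hξ hx) ?_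
    (right_mem_segment ℝ _ _) hxU (left_mem_segment ℝ _ _))
  intro p hp hpc
  obtain ⟨t, h0, h1, rfl⟩ := mem_segment_iff_pt.1 hp
  have := (S.chord2 hpc).1
  rw [W.ηA.pt, W.ηξ] at this
  linarith [mul_nonneg h0 (neg_nonneg.2 (W.η_chord hx))]

theorem Sib.disjoint {W : Win D ξ z z1} {W2 : Win D ξ z4 z5} (S : Sib W W2)
    (hξ : D.Valid ξ) {p : Plane} (hp : p ∈ W.U) (hp2 : p ∈ W2.U) : False := by
  have hsub : W.U ⊆ W2.U := W2.absorb W.isPreconnected_U W.U_sub_P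
    (fun q hq hqc => S.chord2_notMem hξ hqc hq) hp hp2
  obtain ⟨x, hx, -⟩ := W.cross
  have hxs := openSegment_subset_segment ℝ _ _ hx
  have hx2 : x ∈ (segment ℝ W2.a W2.σ)ᶜ := fun h => by
    linarith [(S.chord2 h).1, W.η_chord hxs]
  have hopen : IsOpen (D.I ∩ (segment ℝ W2.a W2.σ)ᶜ) :=
    D.isOpen_I.inter (isClosed_segment _ _).isOpen_compl
  obtain ⟨ε, hε, hball⟩ := Metric.isOpen_iff.1 hopen x ⟨W.mem_I hx, hx2⟩
  have h1 : ∀ᶠ q in 𝓝 x, q ∈ Metric.ball x ε := Metric.ball_mem_nhds x hε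
  obtain ⟨t, t0, t1, h2, h3⟩ := exists_near z ((W.S2 x hx).and h1)
  have hy : pt x z t ∈ W.U := h2.1 (by
    rw [W.hcA.pt, W.hc_zero hxs]; linarith [mul_pos t0 W.hcz])
  have hseg : segment ℝ (pt x z t) x ⊆ Metric.ball x ε :=
    (convex_ball x ε).segment_subset h3 (Metric.mem_ball_self hε)
  exact S.chord_notMem hξ hxs (W2.absorb (isPreconnected_segment (pt x z t) x)
    (fun q hq => Or.inl (hball (hseg hq)).1) (fun q hq => (hball (hseg hq)).2)
    (left_mem_segment ℝ _ _) (hsub hy) (right_mem_segment ℝ _ _))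

theorem Sib.a_ne {W : Win D ξ z z1} {W2 : Win D ξ z4 z5} (S : Sib W W2) : W.a ≠ W2.a := by
  intro h
  have := (S.chord2 (left_mem_segment ℝ _ _)).1
  rw [← h] at this
  linarith [W.ηa]

/-- Signs of both turning coordinates of a sibling. -/
theorem Sib.frame {W : Win D ξ z z1} {W2 : Win D ξ z4 z5} (S : Sib W W2) :
    ∃ A B : Plane → ℝ, IsAff A ∧ IsAff B ∧ A ξ = 0 ∧ B ξ = 0 ∧
      (∀ g, IsAff g → g ξ = 0 → ∀ x, g x = g z * A x + g z4 * B x) ∧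
      0 < A W.σ ∧ 0 < A W2.σ ∧ 0 < W2.ρ z ∧ 0 < W2.η z ∧ 0 < W2.η W.σ := by
  obtain ⟨A, B, hA, hB, Aξ, Az, Az4, Bξ, Bz, Bz4, inj⟩ := exists_frame
    (dt_ne_zero_of_isAff W.ρA W.ξ_ne W.ρξ W.ρz S.ρz4.ne')
  have F : ∀ g, IsAff g → g ξ = 0 → ∀ x, g x = g z * A x + g z4 * B x := fun g hg hg0 x =>
    hg.frame_formula hg0 hA hB Aξ Az Az4 Bξ Bz Bz4 inj x
  have hρ := F W.ρ W.ρA W.ρξ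
  have hη := F W.η W.ηA W.ηξ
  have hρ2 := F W2.ρ W2.ρA W2.ρξ
  have hη2 := F W2.η W2.ηA W2.ηξ
  simp only [W.ρz, W2.ρz, zero_mul, zero_add, add_zero] at hρ hρ2
  have hBσ : 0 < B W.σ := by
    have := W.ρσ; rw [hρ] at this
    exact pos_of_mul_pos_right this S.ρz4.le
  have hAσ : 0 < A W.σ := by
    have h1 := hη W.σ; rw [W.ησ] at h1
    have h2 : 0 < (-W.η z) * A W.σ := by linarith [mul_pos S.ηz4 hBσ]
    exact pos_of_mul_pos_right h2 (by linarith [W.ηz])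
  have hAa : 0 < A W.a := by
    obtain ⟨k, k0, k1, hk⟩ := mem_openSegment_iff_pt.1 W.a_mem
    rw [hk, hA.pt, Aξ, Az]; linarith
  have hρ2z : 0 < W2.ρ z := by
    obtain ⟨x, hx, hx2⟩ := S.ρ2
    rw [hρ2] at hx2
    exact pos_of_mul_pos_left hx2 (hA.convex_pos.segment_subset (x := W.a) (y := W.σ) hAa hAσ
      (openSegment_subset_segment ℝ _ _ hx)).le
  have hAσ2 : 0 < A W2.σ := by
    have := W2.ρσ; rw [hρ2] at this
    exact pos_of_mul_pos_right this hρ2z.le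
  have h2 := S.chord2 (right_mem_segment ℝ _ _)
  have hBσ2 : 0 < B W2.σ := by
    have := h2.2; rw [hρ] at this
    exact pos_of_mul_pos_right this S.ρz4.le
  have hη2z : 0 < W2.η z := by
    have h1 := hη2 W2.σ; rw [W2.ησ] at h1
    have h2 : 0 < W2.η z * A W2.σ := by linarith [mul_pos (neg_pos.2 W2.ηz) hBσ2]
    exact pos_of_mul_pos_left h2 hAσ2.le
  refine ⟨A, B, hA, hB, Aξ, Bξ, F, hAσ, hAσ2, hρ2z, hη2z, ?_⟩
  have e1 := hη W.σ
  have e2 := hη W2.σ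
  have e3 := hη2 W2.σ
  have e4 := hη2 W.σ
  rw [W.ησ] at e1
  rw [W2.ησ] at e3
  have key : W2.η W.σ * (A W2.σ * W.η z4) = (-W2.η z4) * A W.σ * W.η W2.σ := by
    rw [e2, e4]
    linear_combination (-(A W.σ * W.η z4)) * e3 - (A W2.σ * W2.η z4) * e1
  refine pos_of_mul_pos_left (b := A W2.σ * W.η z4) ?_ (mul_pos hAσ2 S.ηz4).le
  rw [key]
  exact mul_pos (mul_pos (neg_pos.2 W2.ηz) hAσ) h2.1

/-- The two windows end on different edges. -/
def EdgeNe (W : Win D ξ z z1) (W2 : Win D ξ z4 z5) : Prop :=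
  ¬ ((W.w = W2.w ∧ W.f = W2.f) ∨ (W.w = W2.f ∧ W.f = W2.w))

theorem EdgeNe.symm {W : Win D ξ z z1} {W2 : Win D ξ z4 z5} (h : EdgeNe W W2) :
    EdgeNe W2 W := by
  rintro (⟨h1, h2⟩ | ⟨h1, h2⟩)
  · exact h (Or.inl ⟨h1.symm, h2.symm⟩)
  · exact h (Or.inr ⟨h2.symm, h1.symm⟩)

theorem EdgeNe.σ_notMem {W : Win D ξ z z1} {W2 : Win D ξ z4 z5} (h : EdgeNe W W2) :
    W.σ ∉ segment ℝ W2.w W2.f :=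
  fun h' => h (D.uniq _ _ _ _ _ W.hE W2.hE W.hσ h')

theorem σf_sub (W : Win D ξ z z1) : segment ℝ W.σ W.f ⊆ segment ℝ W.w W.f :=
  (convex_segment _ _).segment_subset (openSegment_subset_segment ℝ _ _ W.hσ)
    (right_mem_segment ℝ _ _)

theorem σf_sub_F (W : Win D ξ z z1) : segment ℝ W.σ W.f ⊆ D.F :=
  W.σf_sub.trans (D.seg_sub _ _ W.hE)

theorem w_notMem_σf (W : Win D ξ z z1) : W.w ∉ segment ℝ W.σ W.f := by
  intro h
  obtain ⟨t, h0, h1, ht⟩ := mem_segment_iff_pt.1 h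
  have := W.hcw
  rw [ht, W.hcA.pt, W.hcσ] at this
  linarith [mul_nonneg h0 (neg_nonneg.2 W.hcf.le)]

theorem f_notMem {W : Win D ξ z z1} {W2 : Win D ξ z4 z5} (hρ : 0 < W.ρ W2.σ) (hU : W2.σ ∉ W.U)
    (hne : EdgeNe W W2) : W2.f ≠ W.a ∧ W2.f ∉ W.U := by
  have hfa : W2.f ≠ W.a := by
    intro h
    have hE := D.E_symm _ _ W2.hE
    rw [h] at hE
    have h1 := W.ρa _ hE
    have h2 : W.ρ W2.f = 0 := by
      obtain ⟨k, k0, k1, hk⟩ := mem_openSegment_iff_pt.1 W.a_mem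
      rw [h, hk, W.ρA.pt, W.ρξ, W.ρz]; ring
    obtain ⟨t, h0, h1', ht⟩ := mem_openSegment_iff_pt.1 W2.hσ
    rw [ht, W.ρA.pt, h2] at hρ
    linarith [mul_nonneg (sub_pos.2 h1').le (neg_nonneg.2 h1)]
  refine ⟨hfa, fun hfU => hU (W.absorb (isPreconnected_segment W2.σ W2.f)
    (fun p hp => Or.inr (W2.σf_sub_F hp)) ?_ (right_mem_segment ℝ _ _) hfU
    (left_mem_segment ℝ _ _))⟩
  intro p hp hpc
  obtain ⟨t, h0, h1, rfl⟩ := mem_segment_iff_pt.1 hpc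
  rcases h0.eq_or_lt with rfl | h0
  · rw [pt_zero] at hp
    rcases vertex_mem_segment W.ha W2.hE (W2.σf_sub hp) with h | h
    · rw [h] at hp; exact W2.w_notMem_σf hp
    · exact hfa h.symm
  rcases h1.eq_or_lt with rfl | h1
  · rw [pt_one] at hp
    exact hne.σ_notMem (W2.σf_sub hp)
  exact notMem_F (W.see.pt_mem h0 h1) (W2.σf_sub_F hp)

end Win

namespace Win
open Region
variable {D : Region} {ξ z z1 z4 z5 : Plane}

/-- The far ends of two sibling windows are not both cut off by a line through the viewpoint. -/
theorem Sib.no_cross {W : Win D ξ z z1} {W2 : Win D ξ z4 z5} (S : Sib W W2) (hne : EdgeNe W W2)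
    {hc : Plane → ℝ} (hhc : IsAff hc) (hξ : hc ξ = 0) (hz : 0 < hc z) (hz4 : 0 < hc z4)
    {b1 b2 : Plane} (hb1 : b1 ∈ segment ℝ W.σ W.f) (h1 : hc b1 = 0)
    (hb2 : b2 ∈ segment ℝ W2.σ W2.f) (h2 : hc b2 = 0) : False := by
  obtain ⟨A, B, hA, hB, Aξ, Bξ, F, Aσ, Aσ2, ρ2z, η2z, η2σ⟩ := S.frame
  have hησ2 := (S.chord2 (right_mem_segment ℝ _ _)).1
  have Fρ := F W.ρ W.ρA W.ρξ
  have Fρ2 := F W2.ρ W2.ρA W2.ρξ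
  simp only [W.ρz, W2.ρz, zero_mul, zero_add, add_zero] at Fρ Fρ2
  have Fη := F W.η W.ηA W.ηξ
  have Fη2 := F W2.η W2.ηA W2.ηξ
  have Fc := F hc hhc hξ
  have Bb1 : 0 < B b1 := by
    have := W.ρA.convex_pos.segment_subset (x := W.σ) (y := W.f) W.ρσ W.ρf hb1
    replace this : 0 < W.ρ b1 := this
    rw [Fρ] at this
    exact pos_of_mul_pos_right this S.ρz4.le
  have Ab2 : 0 < A b2 := by
    have := W2.ρA.convex_pos.segment_subset (x := W2.σ) (y := W2.f) W2.ρσ W2.ρf hb2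
    replace this : 0 < W2.ρ b2 := this
    rw [Fρ2] at this
    exact pos_of_mul_pos_right this ρ2z.le
  have Ab1 : A b1 < 0 := by
    have := Fc b1; rw [h1] at this
    have h3 : 0 < hc z * (-A b1) := by linarith [mul_pos hz4 Bb1]
    linarith [pos_of_mul_pos_right h3 hz.le]
  have Bb2 : B b2 < 0 := by
    have := Fc b2; rw [h2] at this
    have h3 : 0 < hc z4 * (-B b2) := by linarith [mul_pos hz Ab2]
    linarith [pos_of_mul_pos_right h3 hz4.le]
  have ηb2 : W.η b2 < 0 := by
    rw [Fη]; linarith [mul_pos (neg_pos.2 W.ηz) Ab2, mul_pos S.ηz4 (neg_pos.2 Bb2)]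
  have η2b1 : W2.η b1 < 0 := by
    rw [Fη2]; linarith [mul_pos η2z (neg_pos.2 Ab1), mul_pos (neg_pos.2 W2.ηz) Bb1]
  have hzero : ∀ (g : Plane → ℝ), IsAff g → ∀ p q, 0 < g p → g q < 0 →
      ∃ S ∈ openSegment ℝ p q, g S = 0 := by
    intro g hg p q hp hq
    refine ⟨pt p q (g p / (g p - g q)), pt_mem_openSegment (div_pos hp (by linarith)) ?_, ?_⟩
    · rw [div_lt_one (by linarith)]; linarith
    · have : g p - g q ≠ 0 := by intro h; linarith
      rw [hg.pt]; field_simp; ring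
  obtain ⟨X, hX, ηX⟩ := hzero W.η W.ηA _ _ hησ2 ηb2
  obtain ⟨Y, hY, ηY⟩ := hzero W2.η W2.ηA _ _ η2σ η2b1
  have hXe : X ∈ openSegment ℝ W2.σ W2.f := by
    obtain ⟨k, k0, k1, rfl⟩ := mem_openSegment_iff_pt.1 hX
    obtain ⟨l, l0, l1, rfl⟩ := mem_segment_iff_pt.1 hb2
    rw [pt_pt_right]
    have hl : l ≠ 0 := by
      rintro rfl; rw [pt_zero] at ηb2; linarith
    exact pt_mem_openSegment (mul_pos k0 (l0.lt_of_ne' hl)) (by nlinarith)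
  have hYe : Y ∈ openSegment ℝ W.σ W.f := by
    obtain ⟨k, k0, k1, rfl⟩ := mem_openSegment_iff_pt.1 hY
    obtain ⟨l, l0, l1, rfl⟩ := mem_segment_iff_pt.1 hb1
    rw [pt_pt_right]
    have hl : l ≠ 0 := by
      rintro rfl; rw [pt_zero] at η2b1; linarith
    exact pt_mem_openSegment (mul_pos k0 (l0.lt_of_ne' hl)) (by nlinarith)
  have AX : 0 < A X := hA.convex_pos.segment_subset (x := W2.σ) (y := b2) Aσ2 Ab2
    (openSegment_subset_segment ℝ _ _ hX)
  have hBY : 0 < B Y := by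
    have h : 0 < W.ρ Y := W.ρA.convex_pos.segment_subset (x := W.σ) (y := W.f) W.ρσ W.ρf
      (openSegment_subset_segment ℝ _ _ hYe)
    rw [Fρ] at h
    exact pos_of_mul_pos_right h S.ρz4.le
  have AY : 0 < A Y := by
    have h := Fη2 Y
    rw [ηY] at h
    have h3 : 0 < W2.η z * A Y := by linarith [mul_pos (neg_pos.2 W2.ηz) hBY]
    exact pos_of_mul_pos_right h3 η2z.le
  -- points beyond the ends of the windows
  have beyond : ∀ {a b : Plane} (V : Win D ξ a b) (p : Plane), V.η p = 0 → V.η z4 ≠ 0 ∨ V.η z ≠ 0 →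
      0 < A V.σ → 0 < A p → p ∈ D.F → p ≠ V.σ → ∃ k : ℝ, 0 < k ∧ k < 1 ∧ V.σ = pt ξ p k := by
    intro a b V p hp hV0 hAσ hAp hpF hpσ
    have hσξ : ξ ≠ V.σ := by intro h; rw [← h, Aξ] at hAσ; exact lt_irrefl _ hAσ
    obtain ⟨y, hy⟩ : ∃ y, V.η y ≠ 0 := by
      rcases hV0 with h | h <;> exact ⟨_, h⟩
    obtain ⟨κ, hκ⟩ := V.ηA.exists_pt hσξ V.ηξ V.ησ hy hp
    have hAκ : A p = κ * A V.σ := by rw [hκ, hA.pt, Aξ]; ring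
    have κ0 : 0 < κ := by
      rw [hAκ] at hAp; exact pos_of_mul_pos_left hAp hAσ.le
    have κ1 : 1 < κ := by
      by_contra hle
      rcases (not_lt.1 hle).lt_or_eq with h | h
      · exact notMem_F (V.see_ξσ.pt_mem κ0 h) (hκ ▸ hpF)
      · rw [h, pt_one] at hκ; exact hpσ hκ
    refine ⟨1 / κ, by positivity, by rw [div_lt_one κ0]; exact κ1, ?_⟩
    rw [hκ, pt_pt_right, one_div_mul_cancel κ0.ne', pt_one]
  have hXF : X ∈ segment ℝ W2.w W2.f := W2.σf_sub (openSegment_subset_segment ℝ _ _ hXe)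
  have hYF : Y ∈ segment ℝ W.w W.f := W.σf_sub (openSegment_subset_segment ℝ _ _ hYe)
  obtain ⟨k, k0, k1, hk⟩ := beyond W X ηX (Or.inl S.ηz4.ne') Aσ AX (D.seg_sub _ _ W2.hE hXF)
    (fun h => hne.σ_notMem (h ▸ hXF))
  obtain ⟨l, l0, l1, hl⟩ := beyond W2 Y ηY (Or.inr η2z.ne') Aσ2 AY (D.seg_sub _ _ W.hE hYF)
    (fun h => hne.symm.σ_notMem (h ▸ hYF))
  obtain ⟨p, hp1, hp2⟩ := segments_cross (o := ξ) (S := X) (Z := Y) k0 k1 l0 l1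
  rw [← hk] at hp1
  rw [← hl] at hp2
  have hp1' : p ∈ openSegment ℝ W.w W.f := by
    refine (convex_openSegment _ _).openSegment_subset W.hσ ?_ hp1
    obtain ⟨v, v0, v1, hv⟩ := mem_openSegment_iff_pt.1 W.hσ
    have := openSegment_pt_sub (x := W.w) (y := W.f) v0.le v1.le zero_le_one le_rfl v1.ne
    rw [pt_one, ← hv] at this
    exact this hYe
  have hp2' : p ∈ segment ℝ W2.w W2.f :=
    (convex_segment _ _).segment_subset hXF (openSegment_subset_segment ℝ _ _ W2.hσ)
      (openSegment_subset_segment ℝ _ _ hp2)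
  exact hne (D.uniq _ _ _ _ _ W.hE W2.hE hp1' hp2')

theorem he_proportional {W : Win D ξ z z1} {W2 : Win D ξ z4 z5} (h : ¬ EdgeNe W W2) :
    ∃ c, 0 < c ∧ ∀ y, W2.he y = c * W.he y := by
  have h' : W2.he W.w = 0 ∧ W2.he W.f = 0 := by
    rcases not_not.1 h with ⟨h1, h2⟩ | ⟨h1, h2⟩
    · rw [h1, h2]; exact ⟨W2.hew, W2.hef⟩
    · rw [h1, h2]; exact ⟨W2.hef, W2.hew⟩
  exact W2.heA.proportional W.heA (D.E_ne _ _ W.hE) h'.1 h'.2 W.hew W.hef W2.heξ W.heξ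

end Win

namespace Pocket
open Region
variable {D : Region}

open Classical in
/-- Vertex counting for two disjoint pockets. -/
theorem card_two {Q1 Q2 : Pocket D} (hd : ∀ p ∈ Q1.U, p ∉ Q2.U) (X S : Finset Plane)
    (h1 : ∀ v ∈ D.Vs, v ∈ Q1.U → v ∈ X) (h2 : ∀ v ∈ D.Vs, v ∈ Q2.U → v ∈ X)
    (hS : ∀ v ∈ S, v ∈ X ∧ v ∉ Q1.U ∧ v ∉ Q2.U) : Q1.J + Q2.J + S.card ≤ X.card := by
  unfold J
  rw [← Finset.card_union_of_disjoint, ← Finset.card_union_of_disjoint]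
  · apply Finset.card_le_card
    intro v hv
    simp only [Finset.mem_union, Finset.mem_filter] at hv
    rcases hv with (h | h) | h
    · exact h1 v h.1 h.2
    · exact h2 v h.1 h.2
    · exact (hS v h).1
  · rw [Finset.disjoint_left]
    intro v hv hvS
    simp only [Finset.mem_union, Finset.mem_filter] at hv
    rcases hv with h | h
    · exact (hS v hvS).2.1 h.2
    · exact (hS v hvS).2.2 h.2
  · rw [Finset.disjoint_left]
    intro v hv hv2
    simp only [Finset.mem_filter] at hv hv2
    exact hd v hv.2 hv2.2

end Pocket

namespace Region
variable {D : Region}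

/-- The ray from `z` through `x` stays in the interior until it ends at a regular point. -/
structure Ray (D : Region) (x z : Plane) (R : ℝ) : Prop where
  one_lt : 1 < R
  reg : D.Reg (pt z x R)
  mem : ∀ s, 0 < s → s < R → pt z x s ∈ D.I

namespace Ray

theorem eq_pt (x z : Plane) (R u : ℝ) : pt x (pt z x R) u = pt z x (1 + u * (R - 1)) := by
  apply plane_ext <;> simp only [pt_apply] <;> ring

variable {x z : Plane} {R : ℝ}

theorem sees_right (H : D.Ray x z R) {s : ℝ} (h0 : 0 < s) (h1 : s < R) : D.Sees (pt z x s) z := by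
  intro p hp
  obtain ⟨t, t0, t1, rfl⟩ := mem_openSegment_iff_pt.1 hp
  rw [pt_symm, pt_pt_right]
  refine H.mem _ (mul_pos (by linarith) h0) ?_
  have := mul_pos t0 h0
  linarith

theorem sees_end (H : D.Ray x z R) : D.Sees (pt z x R) z := by
  intro p hp
  obtain ⟨t, t0, t1, rfl⟩ := mem_openSegment_iff_pt.1 hp
  have hR := H.one_lt
  rw [pt_symm, pt_pt_right]
  refine H.mem _ (mul_pos (by linarith) (by linarith)) ?_
  have := mul_pos t0 (show 0 < R by linarith)
  linarith

theorem mem_left (H : D.Ray x z R) {u : ℝ} (h0 : 0 ≤ u) (h1 : u < 1) : pt x (pt z x R) u ∈ D.I := by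
  have hR := sub_pos.2 H.one_lt
  rw [eq_pt]
  have := mul_nonneg h0 hR.le
  have := mul_pos (sub_pos.2 h1) hR
  exact H.mem _ (by linarith) (by linarith)

theorem sees_left (H : D.Ray x z R) : D.Sees x (pt z x R) := by
  intro p hp
  obtain ⟨t, t0, t1, rfl⟩ := mem_openSegment_iff_pt.1 hp
  exact H.mem_left t0.le t1

end Ray
end Region

theorem IsAff.eventually_ne {g : Plane → ℝ} (hg : IsAff g) {x a : Plane} (h : g x ≠ 0 ∨ g a ≠ 0) :
    ∀ᶠ τ in 𝓝[>] (0 : ℝ), g (_root_.pt x a τ) ≠ 0 := by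
  by_cases hx : g x = 0
  · filter_upwards [self_mem_nhdsWithin] with τ hτ
    rw [hg.pt, hx]
    have := mul_ne_zero (ne_of_gt hτ) (h.resolve_left (not_not.2 hx))
    simpa using this
  · have h2 := (hg.continuous.tendsto x).comp (Region.tendsto_pt_zero x a)
    exact h2.eventually_ne hx

namespace Pocket
open Region
variable {D : Region} (Q : Pocket D)

theorem perturb {x z : Plane} (hx : x ∈ openSegment ℝ Q.a Q.σ) (hz : D.Valid z)
    (hs : D.Sees x z) (hc : 0 < Q.hc z) :
    ∃ x' ∈ openSegment ℝ Q.a Q.σ, Q.he x < Q.he x' ∧ ∃ R, D.Ray x' z R := by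
  have hzV : z ∉ D.Vs := fun h => hz.elim (fun h' => notMem_F h' (vertex_mem_F h))
    (vertex_not_reg h)
  have hx0 := Q.hc_zero' hx
  have hxa : x ≠ Q.a := by
    rintro rfl; exact notMem_F (Q.mem_I hx) Q.a_mem_F
  have hgen : ∀ q ∈ D.Vs, ∀ᶠ τ in 𝓝[>] (0 : ℝ), dt z q (pt x Q.a τ) ≠ 0 := by
    intro q hq
    refine (isAff_dt z q).eventually_ne ?_
    by_contra! h
    obtain ⟨v, hv⟩ := exists_dt_ne (p := z) (q := q) (by rintro rfl; exact hzV hq)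
    have hzc : dt x Q.a z ≠ 0 := dt_ne_zero_of_isAff Q.hcA hxa hx0 Q.hca hc.ne'
    exact dt_ne_zero_of_isAff (isAff_dt z q) hxa h.1 h.2 hv (by
      obtain ⟨A, B, hA, hB, Ao, Ax, Ay, Bo, Bx, By, inj⟩ := exists_frame hzc
      have := (isAff_dt z q).frame_formula h.1 hA hB Ao Ax Ay Bo Bx By inj v
      rw [h.2, dt_self_left] at this
      exact absurd (by linarith) hv)
  have hall := (Filter.eventually_all_finset D.Vs).2 hgen
  have hsee := (tendsto_pt_zero x Q.a).eventually (eventually_sees hz (Q.mem_I hx) hs)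
  have h1 : ∀ᶠ t in 𝓝[>] (0 : ℝ), t ∈ Ioo (0 : ℝ) 1 := Ioo_mem_nhdsGT zero_lt_one
  obtain ⟨τ, hg, hs', τ0, τ1⟩ := (hall.and (hsee.and h1)).exists
  obtain ⟨k, k0, k1, hk⟩ := mem_openSegment_iff_pt.1 hx
  obtain ⟨x', hx'⟩ : ∃ x', x' = pt x Q.a τ := ⟨_, rfl⟩
  rw [← hx'] at hg hs'
  have hx'c : x' ∈ openSegment ℝ Q.a Q.σ := by
    have e : x' = pt Q.a Q.σ (k * (1 - τ)) := by
      rw [hx', hk]; apply plane_ext <;> simp only [pt_apply] <;> ring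
    rw [e]
    refine pt_mem_openSegment (mul_pos k0 (by linarith)) ?_
    linarith [mul_pos k0 τ0]
  have hx'I := Q.mem_I hx'c
  have hx'z : x' ≠ pt z x' 2 := by
    intro h
    have h2 := congrArg Q.hc h
    rw [Q.hcA.pt, Q.hc_zero' hx'c] at h2
    linarith
  obtain ⟨t, t0, htF, htI⟩ := exists_hit hx'I hx'z
  have e : ∀ u : ℝ, pt x' (pt z x' 2) u = pt z x' (1 + u) := fun u => by
    apply plane_ext <;> simp only [pt_apply] <;> ring
  rw [e] at htF
  refine ⟨x', hx'c, ?_, 1 + t, by linarith, reg_of_mem_F htF fun hV => ?_, ?_⟩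
  · rw [hx', Q.heA.pt]
    have : Q.he x < Q.he Q.a := by
      rw [hk, Q.heA.pt, Q.heσ]; linarith [mul_pos k0 Q.hea]
    linarith [mul_pos τ0 (sub_pos.2 this)]
  · refine hg _ hV ?_
    unfold dt; simp only [pt_apply]; ring
  · intro s s0 s1
    rcases lt_or_ge s 1 with h | h
    · have := hs'.symm.pt_mem s0 h
      exact this
    · have := htI (s - 1) (by linarith) (by linarith)
      rwa [e, add_sub_cancel] at this

theorem exists_window {ξ t : Plane} (hξ : ξ ∈ openSegment ℝ Q.a Q.σ ∨ ξ = Q.σ) (ht : t ∈ Q.U)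
    (htI : t ∈ D.I) (hns : ¬ D.Sees ξ t) :
    ∃ z z1, ∃ W : Win D ξ z z1, Nested Q W.toPocket ∧ t ∈ W.U := by
  have hmid : pt Q.a Q.σ (1 / 2) ∈ openSegment ℝ Q.a Q.σ :=
    pt_mem_openSegment (by norm_num) (by norm_num)
  have hall : ∀ p ∈ openSegment ℝ Q.a Q.σ, D.Sees ξ p := by
    intro p hp
    by_cases hne : p = ξ
    · rw [← hne]; exact sees_self (Q.mem_I hp)
    obtain ⟨v, v0, v1, hv⟩ : ∃ v : ℝ, 0 < v ∧ v ≤ 1 ∧ ξ = pt Q.a Q.σ v := by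
      rcases hξ with hξ | rfl
      · obtain ⟨v, h0, h1, h⟩ := mem_openSegment_iff_pt.1 hξ
        exact ⟨v, h0, h1.le, h⟩
      · exact ⟨1, one_pos, le_rfl, (pt_one _ _).symm⟩
    obtain ⟨k, k0, k1, rfl⟩ := mem_openSegment_iff_pt.1 hp
    rw [hv] at hne ⊢
    exact Q.see.pt_pt v0.le v1 k0.le k1.le (fun h => hne (by rw [h]))
  have hξV : D.Valid ξ := by
    rcases hξ with h | rfl
    · exact Or.inl (Q.mem_I h)
    · exact Or.inr Q.σ_reg
  obtain ⟨z, hzI, ⟨K, hK, hKI, hKns, hzK, htK⟩, hN⟩ :=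
    exists_path_exit hξV (Q.mem_I hmid) (hall _ hmid) htI hns
  have hIc : ∀ p ∈ D.I, p ∈ segment ℝ Q.a Q.σ → p ∈ openSegment ℝ Q.a Q.σ := by
    intro p hp hps
    refine mem_openSegment_of_ne_left_right ?_ ?_ hps
    · rintro rfl; exact notMem_F hp Q.a_mem_F
    · rintro rfl; exact notMem_F hp Q.σ_mem_F
  have hKU : K ⊆ Q.U := Q.absorb hK (fun p hp => Or.inl (hKI hp))
    (fun p hp hpc => hKns p hp (hall p (hIc p (hKI hp) hpc))) htK ht
  have hopen : IsOpen (D.I ∩ (segment ℝ Q.a Q.σ)ᶜ) :=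
    D.isOpen_I.inter (isClosed_segment _ _).isOpen_compl
  obtain ⟨ε, hε, hball⟩ := Metric.isOpen_iff.1 hopen z ⟨hzI, Q.notMem_chord (hKU hzK)⟩
  obtain ⟨z1, hz1, ⟨W⟩⟩ := hN _ (Metric.ball_mem_nhds z hε)
  have hseg : segment ℝ z1 z ⊆ Q.U := by
    have hsub : segment ℝ z1 z ⊆ Metric.ball z ε :=
      (convex_ball z ε).segment_subset hz1 (Metric.mem_ball_self hε)
    exact Q.absorb (isPreconnected_segment z1 z) (fun q hq => Or.inl (hball (hsub hq)).1)
      (fun q hq => (hball (hsub hq)).2) (right_mem_segment ℝ _ _) (hKU hzK)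
  refine ⟨z, z1, W, Q.nested hξ W (fun q hq _ => hseg hq), ?_⟩
  refine W.absorb hK (fun p hp => Or.inl (hKI hp)) (fun p hp hpc => hKns p hp (W.see_ξ p ?_))
    hzK W.zU htK
  refine mem_openSegment_of_ne_left_right ?_ ?_ hpc
  · rintro rfl; exact notMem_F (hKI hp) W.a_mem_F
  · rintro rfl; exact notMem_F (hKI hp) W.toPocket.σ_mem_F

end Pocket

namespace Win
open Region
variable {D : Region} {ξ z z1 : Plane}

theorem ρ_chord (W : Win D ξ z z1) {x : Plane} (hx : x ∈ openSegment ℝ W.a W.σ) : 0 < W.ρ x := by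
  obtain ⟨k, k0, k1, rfl⟩ := mem_openSegment_iff_pt.1 hx
  obtain ⟨l, l0, l1, hl⟩ := mem_openSegment_iff_pt.1 W.a_mem
  have : W.ρ W.a = 0 := by rw [hl, W.ρA.pt, W.ρξ, W.ρz]; ring
  rw [W.ρA.pt, this]
  linarith [mul_pos k0 W.ρσ]

theorem far (W : Win D ξ z z1) {x y : Plane} (hx : x ∈ openSegment ℝ W.a W.σ)
    (hy : D.Valid y) (hs : D.Sees x y)
    (hc : 0 < W.hc y) :
    (0 < W.ρ y ∧ D.Sees ξ y) ∨ (W.ρ y ≤ 0 ∧ ∃ x' ∈ openSegment ℝ W.a W.σ, W.he x < W.he x' ∧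
      ∃ R, D.Ray x' y R ∧ 0 < W.ρ (pt y x' R)) := by
  rcases lt_or_ge 0 (W.ρ y) with h | h
  · exact Or.inl ⟨h, W.SL x hx y hs hc h⟩
  · obtain ⟨x', hx', hhe, R, hR⟩ := W.toPocket.perturb hx hy hs hc
    refine Or.inr ⟨h, x', hx', hhe, R, hR, ?_⟩
    have h1 := W.ρ_chord hx'
    have h2 := hR.one_lt
    rw [W.ρA.pt]
    have := mul_nonneg (sub_nonneg.2 h2.le) (neg_nonneg.2 h)
    linarith [mul_pos (sub_pos.2 h2) h1]

theorem sibling (W : Win D ξ z z1) (hξ : D.Valid ξ) {x' y : Plane} (hx' : x' ∈ openSegment ℝ W.a W.σ)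
    (hxy : D.Sees x' y) (hy : D.Reg y) (hρ : 0 < W.ρ y) (hns : ¬ D.Sees ξ y) :
    (∃ p q, D.E p q ∧ ξ ∈ openSegment ℝ p q ∧ y ∈ openSegment ℝ p q ∧
      ∀ u, 0 ≤ u → u < 1 → pt x' y u ∈ D.I ∧ D.Sees ξ (pt x' y u)) ∨
    ∃ t u : ℝ, 0 ≤ u ∧ u < t ∧ t ≤ 1 ∧ ∃ W2 : Win D ξ (pt x' y t) (pt x' y u), Sib W W2 := by
  have hne : y ≠ ξ := by
    rintro rfl; rw [W.ρξ] at hρ; exact lt_irrefl _ hρ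
  have hρx := W.ρ_chord hx'
  obtain ⟨t, t0, t1, hvis, hcase⟩ := exists_exit hξ (W.toPocket.mem_I hx') (W.see_ξ _ hx') hxy
    (Or.inr hy) hns hne
  rcases hcase with hW | ⟨rfl, p, q, hE, h1, h2⟩
  swap
  · exact Or.inl ⟨p, q, hE, h1, h2, hvis⟩
  right
  have hρt : ∀ u : ℝ, 0 ≤ u → u ≤ 1 → 0 < W.ρ (pt x' y u) := fun u h0 h1 =>
    W.ρA.convex_pos.segment_subset (x := x') (y := y) hρx hρ (pt_mem_segment h0 h1)
  have hη : 0 < W.η (pt x' y t) := by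
    obtain ⟨W0⟩ := hW 0 le_rfl t0
    obtain ⟨k, k0, k1, hk⟩ := mem_openSegment_iff_pt.1 W0.a_mem
    have h1 : 0 < W.ρ W0.a := by
      rw [hk, W.ρA.pt, W.ρξ]; linarith [mul_pos k0 (hρt t t0.le t1)]
    have h2 := W.ηρ _ W0.ha h1
    rw [hk, W.ηA.pt, W.ηξ] at h2
    exact pos_of_mul_pos_right (a := k) (by linarith) k0.le
  have hev : ∀ᶠ q in 𝓝 (pt x' y t), 0 < W.η q := W.ηA.isOpen_pos.mem_nhds hη
  obtain ⟨v, v0, v1, hv⟩ := exists_near x' hev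
  have e : pt (pt x' y t) x' v = pt x' y (t * (1 - v)) := by
    apply plane_ext <;> simp only [pt_apply] <;> ring
  rw [e] at hv
  have hu0 : 0 ≤ t * (1 - v) := mul_nonneg t0.le (by linarith)
  have hut : t * (1 - v) < t := by linarith [mul_pos t0 v0]
  obtain ⟨W2⟩ := hW _ hu0 hut
  refine ⟨t, t * (1 - v), hu0, hut, t1, W2, hρt t t0.le t1, hρt _ hu0 (by linarith), hη, hv,
    x', hx', ?_⟩
  have h1 := W2.ρz
  have h2 := W2.ρz1
  rw [W2.ρA.pt] at h1 h2
  have h3 : 0 < (t - t * (1 - v)) * (W2.ρ x' - W2.ρ y) := by linarith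
  have h4 := pos_of_mul_pos_right h3 (by linarith)
  linarith [mul_pos t0 h4]

end Win

theorem IsAff.eq_zero {g : Plane → ℝ} (hg : IsAff g) {o x y : Plane} (hd : dt o x y ≠ 0)
    (ho : g o = 0) (hx : g x = 0) (hy : g y = 0) (p : Plane) : g p = 0 := by
  obtain ⟨A, B, hA, hB, Ao, Ax, Ay, Bo, Bx, By, inj⟩ := exists_frame hd
  rw [hg.frame_formula ho hA hB Ao Ax Ay Bo Bx By inj p, hx, hy]; ring

namespace Win
open Region
variable {D : Region} {ξ z z1 z4 z5 : Plane}

theorem ρ_a (W : Win D ξ z z1) : W.ρ W.a = 0 := by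
  obtain ⟨l, l0, l1, hl⟩ := mem_openSegment_iff_pt.1 W.a_mem
  rw [hl, W.ρA.pt, W.ρξ, W.ρz]; ring

theorem f_ne_a (W : Win D ξ z z1) : W.f ≠ W.a := by
  intro h
  have := W.hcf
  rw [h, W.hca] at this
  exact lt_irrefl _ this

theorem hc_target {W : Win D ξ z z1} {Q : Pocket D} (hξ : Q.hc ξ = 0)
    (h : Pocket.Nested Q W.toPocket) : 0 < Q.hc z := by
  obtain ⟨k, k0, k1, hk⟩ := mem_openSegment_iff_pt.1 W.a_mem
  have := h.hca
  rw [hk, Q.hcA.pt, hξ] at this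
  exact pos_of_mul_pos_right (a := k) (by linarith) k0.le

theorem Sib.far_ends {W : Win D ξ z z1} {W2 : Win D ξ z4 z5} (S : Sib W W2)
    (hξ : D.Valid ξ) (hne : EdgeNe W W2) :
    (W.f ≠ W2.a ∧ W.f ∉ W2.U) ∧ W2.f ≠ W.a ∧ W2.f ∉ W.U := by
  obtain ⟨A, B, hA, hB, Aξ, Bξ, F, Aσ, Aσ2, ρ2z, η2z, η2σ⟩ := S.frame
  have h := F W2.ρ W2.ρA W2.ρξ W.σ
  rw [W2.ρz, zero_mul, add_zero] at h
  exact ⟨f_notMem (h ▸ mul_pos ρ2z Aσ) (S.chord_notMem hξ (right_mem_segment ℝ _ _)) hne.symm,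
    f_notMem (S.chord2 (right_mem_segment ℝ _ _)).2
      (S.chord2_notMem hξ (right_mem_segment ℝ _ _)) hne⟩

open Classical in
theorem Sib.card_nested {W : Win D ξ z z1} {W2 : Win D ξ z4 z5} (S : Sib W W2)
    (hξ : D.Valid ξ) {Q : Pocket D} (h1 : Pocket.Nested Q W.toPocket)
    (h2 : Pocket.Nested Q W2.toPocket) (X : Finset Plane)
    (hX : ∀ v ∈ X, (v ∈ D.Vs ∧ v ∈ Q.U) ∧ v ≠ W.a ∧ v ≠ W2.a ∧ v ∉ W.U ∧ v ∉ W2.U) :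
    W.J + W2.J + (X.card + 2) ≤ Q.J := by
  have hc : (insert W.a (insert W2.a X)).card = X.card + 2 := by
    rw [Finset.card_insert_of_notMem, Finset.card_insert_of_notMem]
    · exact fun h => (hX _ h).2.2.1 rfl
    · rw [Finset.mem_insert]
      rintro (h | h)
      · exact S.a_ne h
      · exact (hX _ h).2.1 rfl
  rw [← hc]
  refine Pocket.card_two (fun p hp hp2 => S.disjoint hξ hp hp2)
    (D.Vs.filter (· ∈ Q.U)) _ (fun v hv hU => ?_) (fun v hv hU => ?_) fun v hv => ?_
  · exact Finset.mem_filter.2 ⟨hv, h1.U_sub hU⟩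
  · exact Finset.mem_filter.2 ⟨hv, h2.U_sub hU⟩
  · rw [Finset.mem_filter]
    rcases Finset.mem_insert.1 hv with rfl | hv
    · exact ⟨⟨W.ha, h1.a_mem⟩, h1.a_notMem, S.chord_notMem hξ (left_mem_segment ℝ _ _)⟩
    rcases Finset.mem_insert.1 hv with rfl | hv
    · exact ⟨⟨W2.ha, h2.a_mem⟩, S.chord2_notMem hξ (left_mem_segment ℝ _ _), h2.a_notMem⟩
    exact ⟨(hX v hv).1, (hX v hv).2.2.2⟩

theorem Sib.card_nested_two {W : Win D ξ z z1} {W2 : Win D ξ z4 z5} (S : Sib W W2)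
    (hξ : D.Valid ξ) {Q : Pocket D} (h1 : Pocket.Nested Q W.toPocket)
    (h2 : Pocket.Nested Q W2.toPocket) : W.J + W2.J + 2 ≤ Q.J := by
  simpa using S.card_nested hξ h1 h2 ∅ (by simp)

theorem f_mem_of_nested {W : Win D ξ z z1} {Q : Pocket D} (h : Pocket.Nested Q W.toPocket)
    (hb : ∀ b ∈ segment ℝ W.σ W.f, Q.hc b ≠ 0) : W.f ∈ Q.U := by
  have hσ : W.σ ∈ Q.U := Q.absorb (isPreconnected_segment W.a W.σ) W.toPocket.chord_sub_P
    (fun p hp => Q.notMem_chord_of_hc (h.hc_chord hp).ne') (left_mem_segment ℝ _ _) h.a_mem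
    (right_mem_segment ℝ _ _)
  exact Q.absorb (isPreconnected_segment W.σ W.f) (fun p hp => Or.inr (W.σf_sub_F hp))
    (fun p hp => Q.notMem_chord_of_hc (hb p hp)) (left_mem_segment ℝ _ _) hσ
    (right_mem_segment ℝ _ _)

theorem Sib.card_nested_three {W : Win D ξ z z1} {W2 : Win D ξ z4 z5} (S : Sib W W2)
    (hξ : D.Valid ξ) {Q : Pocket D} (hQξ : Q.hc ξ = 0) (h1 : Pocket.Nested Q W.toPocket)
    (h2 : Pocket.Nested Q W2.toPocket) (hne : EdgeNe W W2) : W.J + W2.J + 3 ≤ Q.J := by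
  obtain ⟨e1, e2⟩ := S.far_ends hξ hne
  by_cases hb : ∀ b ∈ segment ℝ W.σ W.f, Q.hc b ≠ 0
  · simpa using S.card_nested hξ h1 h2 {W.f} (by
      simpa using ⟨⟨E_right W.hE, f_mem_of_nested h1 hb⟩, W.f_ne_a, e1.1, W.fU, e1.2⟩)
  by_cases hb2 : ∀ b ∈ segment ℝ W2.σ W2.f, Q.hc b ≠ 0
  · simpa using S.card_nested hξ h1 h2 {W2.f} (by
      simpa using ⟨⟨E_right W2.hE, f_mem_of_nested h2 hb2⟩, e2.1, W2.f_ne_a, e2.2, W2.fU⟩)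
  push Not at hb hb2
  obtain ⟨b1, hb1, hb1'⟩ := hb
  obtain ⟨b2, hb2, hb2'⟩ := hb2
  exact (S.no_cross hne Q.hcA hQξ (hc_target hQξ h1) (hc_target hQξ h2) hb1 hb1' hb2 hb2').elim

/-- A vertex behind an interior viewpoint. -/
theorem exists_back (W : Win D ξ z z1) (hξ : ξ ∈ D.I) :
    ∃ d ∈ D.Vs, W.ρ d < 0 ∧ ∀ Q : Pocket D, (∀ p ∈ segment ℝ Q.a Q.σ, 0 ≤ W.ρ p) →
      ξ ∉ segment ℝ Q.a Q.σ → ξ ∉ Q.U → d ∉ Q.U := by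
  have h1 := W.ρz1
  have hneg : W.ρ (pt ξ z1 (-1)) < 0 := by rw [W.ρA.pt, W.ρξ]; linarith
  obtain ⟨t, t0, htF, htI⟩ := exists_hit (y := pt ξ z1 (-1)) hξ (by
    intro h; have e := congrArg W.ρ h; linarith [W.ρξ])
  obtain ⟨y, hy⟩ : ∃ y, y = pt ξ (pt ξ z1 (-1)) t := ⟨_, rfl⟩
  rw [← hy] at htF
  have hρy : W.ρ y < 0 := by
    rw [hy, W.ρA.pt, W.ρξ]; linarith [mul_pos t0 (neg_pos.2 hneg)]
  obtain ⟨p, q, hE, hm⟩ := D.cover y htF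
  obtain ⟨d, hdV, hdρ, hd⟩ : ∃ d ∈ D.Vs, W.ρ d < 0 ∧ d ∈ segment ℝ p q := by
    by_contra! H
    have hp : 0 ≤ W.ρ p := not_lt.1 fun h => H p (D.E_left _ _ hE) h (left_mem_segment ℝ _ _)
    have hq : 0 ≤ W.ρ q := not_lt.1 fun h => H q (E_right hE) h (right_mem_segment ℝ _ _)
    have : 0 ≤ W.ρ y := W.ρA.convex_nonneg.segment_subset (x := p) (y := q) hp hq hm
    linarith
  refine ⟨d, hdV, hdρ, fun Q hQ hξc hξU hdU => hξU ?_⟩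
  have hyd : segment ℝ y d ⊆ D.F :=
    ((convex_segment _ _).segment_subset hm hd).trans (D.seg_sub _ _ hE)
  have hneg2 : ∀ x ∈ segment ℝ y d, W.ρ x < 0 := by
    intro x hx
    have := W.ρA.neg.convex_pos.segment_subset (x := y) (y := d) (neg_pos.2 hρy) (neg_pos.2 hdρ) hx
    exact neg_pos.1 this
  have hyU : y ∈ Q.U := Q.absorb (isPreconnected_segment y d) (fun x hx => Or.inr (hyd hx))
    (fun x hx hxc => by linarith [hQ x hxc, hneg2 x hx]) (right_mem_segment ℝ _ _) hdU
    (left_mem_segment ℝ _ _)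
  refine Q.absorb (isPreconnected_segment ξ y) ?_ ?_ (right_mem_segment ℝ _ _) hyU
    (left_mem_segment ℝ _ _)
  · intro x hx
    obtain ⟨u, u0, u1, rfl⟩ := mem_segment_iff_pt.1 hx
    rcases u1.eq_or_lt with rfl | u1
    · rw [pt_one]; exact Or.inr htF
    · rw [hy, pt_pt_right]
      refine Or.inl (htI _ (mul_nonneg u0 t0.le) ?_)
      linarith [mul_pos (sub_pos.2 u1) t0]
  · intro x hx hxc
    obtain ⟨u, u0, u1, rfl⟩ := mem_segment_iff_pt.1 hx
    rcases u0.eq_or_lt with rfl | u0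
    · rw [pt_zero] at hxc; exact hξc hxc
    · have := hQ _ hxc
      rw [W.ρA.pt, W.ρξ] at this
      linarith [mul_pos u0 (neg_pos.2 hρy)]

end Win

namespace Pocket
open Region
variable {D : Region} (Q : Pocket D)

theorem hcf : Q.hc Q.f < 0 := by
  obtain ⟨s, s0, s1, hs⟩ := mem_openSegment_iff_pt.1 Q.hσ
  have h1 := Q.hcσ
  rw [hs, Q.hcA.pt] at h1
  have h2 : 0 < s * (-Q.hc Q.f) := by linarith [mul_pos (sub_pos.2 s1) Q.hcw]
  linarith [pos_of_mul_pos_right h2 s0.le]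

theorem exists_beta {x z z1 : Plane} (W : Win D x z z1) :
    ∃ β ∈ segment ℝ W.w W.f, ∃ u : ℝ, 0 < u ∧ u < 1 ∧ W.a = pt x β u := by
  refine ⟨_, (convex_segment _ _).segment_subset (left_mem_segment ℝ _ _)
    (openSegment_subset_segment ℝ _ _ W.hσ) W.hβ, ?_⟩
  obtain ⟨k, k0, k1, hk⟩ := mem_openSegment_iff_pt.1 W.a_mem
  have hT := W.hT
  refine ⟨k / W.T, by positivity, by rw [div_lt_one (by linarith)]; linarith, ?_⟩
  rw [pt_pt_right, div_mul_cancel₀ _ (by linarith), hk]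

/-- The two ways in which a window seen from the chord may fail to skip two vertices. -/
theorem nested_cases {x z z1 : Plane} (hx : x ∈ openSegment ℝ Q.a Q.σ) (W : Win D x z z1)
    (h : Nested Q W.toPocket) (hJ : ¬ W.J + 2 ≤ Q.J) :
    (∃ β ∈ segment ℝ Q.a Q.r, ∃ u : ℝ, 0 < u ∧ u < 1 ∧ Q.w = pt x β u) ∨
    (∃ β ∈ segment ℝ Q.w Q.f, ∃ u : ℝ, 0 < u ∧ u < 1 ∧ Q.r = pt x β u) := by
  have hσw : segment ℝ Q.σ Q.w ⊆ segment ℝ Q.w Q.f :=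
    (convex_segment _ _).segment_subset (openSegment_subset_segment ℝ _ _ Q.hσ)
      (left_mem_segment ℝ _ _)
  have c1 : Q.w = W.a ∨ W.σ ∈ segment ℝ Q.w Q.f := by
    by_contra! H
    exact hJ (h.J_gain_w H.1 fun h' => H.2 (hσw h'))
  have c2 : Q.r = W.a ∨ W.σ ∈ segment ℝ Q.a Q.r := by
    by_contra! H
    exact hJ (h.J_gain_r H.1 H.2)
  have hseg : ∀ p q, D.E p q → W.σ ∈ segment ℝ p q → segment ℝ W.w W.f = segment ℝ p q := by
    intro p q hE hm
    rcases D.uniq _ _ _ _ _ W.hE hE W.hσ hm with ⟨h1, h2⟩ | ⟨h1, h2⟩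
    · rw [h1, h2]
    · rw [h1, h2, segment_symm]
  obtain ⟨β, hβ, u, u0, u1, hu⟩ := exists_beta W
  rcases c1 with c1 | c1 <;> rcases c2 with c2 | c2
  · exfalso
    have e1 := W.ρa Q.a (by rw [← c2]; exact D.E_symm _ _ Q.har)
    have e2 := W.ρa Q.f (by rw [← c1]; exact Q.hE)
    have e3 : W.ρ Q.w = 0 := by rw [c1]; exact W.ρ_a
    obtain ⟨s, s0, s1, hs⟩ := mem_openSegment_iff_pt.1 Q.hσ
    have e4 : W.ρ Q.σ ≤ 0 := by
      rw [hs, W.ρA.pt, e3]; linarith [mul_nonneg s0.le (neg_nonneg.2 e2)]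
    obtain ⟨k, k0, k1, hk⟩ := mem_openSegment_iff_pt.1 hx
    have e5 := W.ρξ
    have e6 : W.ρ x = (1 - k) * W.ρ Q.a + k * W.ρ Q.σ :=
      (congrArg W.ρ hk).trans (by rw [W.ρA.pt]; ring)
    have e7 : W.ρ Q.a = 0 := by nlinarith
    have e8 : W.ρ Q.σ = 0 := by nlinarith
    have := W.ρA.eq_zero (dt_ne_zero_of_isAff Q.hcA Q.a_ne_σ Q.hca Q.hcσ Q.hcw.ne') e7 e8 e3 z1
    linarith [W.ρz1]
  · left
    exact ⟨β, hseg _ _ Q.har c2 ▸ hβ, u, u0, u1, c1.trans hu⟩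
  · right
    exact ⟨β, hseg _ _ Q.hE c1 ▸ hβ, u, u0, u1, c2.trans hu⟩
  · exfalso
    have hm : Q.a ∈ segment ℝ Q.w Q.f := by
      rw [← hseg _ _ Q.hE c1, hseg _ _ Q.har c2]
      exact left_mem_segment ℝ _ _
    rcases vertex_mem_segment Q.ha Q.hE hm with h' | h'
    · linarith [Q.hca, Q.hcw, congrArg Q.hc h']
    · linarith [Q.hca, Q.hcf, congrArg Q.hc h']

theorem exists_good : ∃ x ∈ openSegment ℝ Q.a Q.σ, ∀ z z1, ∀ W : Win D x z z1,
    Nested Q W.toPocket → W.J + 2 ≤ Q.J := by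
  have hw := Q.hcw
  have hr := Q.hcr
  have hf := Q.hcf
  have hI : ∀ x ∈ openSegment ℝ Q.a Q.σ, ∀ β ∈ segment ℝ Q.a Q.r, ∀ u : ℝ, 0 < u → u < 1 →
      Q.w = pt x β u → Q.hc Q.w < Q.hc Q.r := by
    intro x hx β hβ u u0 u1 h
    obtain ⟨v, v0, v1, hv⟩ := mem_segment_iff_pt.1 hβ
    have e1 : Q.hc β = v * Q.hc Q.r := by rw [hv, Q.hcA.pt, Q.hca]; ring
    have e2 : Q.hc Q.w = u * Q.hc β := by
      have := congrArg Q.hc h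
      rw [Q.hcA.pt, Q.hc_zero' hx] at this; linarith
    have hβ0 : 0 < Q.hc β := pos_of_mul_pos_right (by linarith : 0 < u * Q.hc β) u0.le
    have := mul_pos (sub_pos.2 u1) hβ0
    have := mul_nonneg (sub_nonneg.2 v1) hr.le
    linarith
  have hII : ∀ x ∈ openSegment ℝ Q.a Q.σ, ∀ β ∈ segment ℝ Q.w Q.f, ∀ u : ℝ, 0 < u → u < 1 →
      Q.r = pt x β u → Q.hc Q.r < Q.hc Q.w := by
    intro x hx β hβ u u0 u1 h
    obtain ⟨v, v0, v1, hv⟩ := mem_segment_iff_pt.1 hβ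
    have e1 : Q.hc β = (1 - v) * Q.hc Q.w + v * Q.hc Q.f := by rw [hv, Q.hcA.pt]; ring
    have e2 : Q.hc Q.r = u * Q.hc β := by
      have := congrArg Q.hc h
      rw [Q.hcA.pt, Q.hc_zero' hx] at this; linarith
    have hβ0 : 0 < Q.hc β := pos_of_mul_pos_right (by linarith : 0 < u * Q.hc β) u0.le
    have := mul_pos (sub_pos.2 u1) hβ0
    have := mul_nonneg v0 (sub_nonneg.2 (hf.trans hw).le)
    linarith
  have hex : ∀ k : ℝ, 0 < k → k < 1 →
      (Q.hc Q.w < Q.hc Q.r → ∀ β ∈ segment ℝ Q.a Q.r, ∀ u : ℝ, 0 < u → u < 1 →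
        Q.w ≠ pt (pt Q.a Q.σ k) β u) →
      (Q.hc Q.r < Q.hc Q.w → ∀ β ∈ segment ℝ Q.w Q.f, ∀ u : ℝ, 0 < u → u < 1 →
        Q.r ≠ pt (pt Q.a Q.σ k) β u) →
      ∃ x ∈ openSegment ℝ Q.a Q.σ, ∀ z z1, ∀ W : Win D x z z1,
        Nested Q W.toPocket → W.J + 2 ≤ Q.J := by
    intro k k0 k1 h1 h2
    have hx := pt_mem_openSegment (x := Q.a) (y := Q.σ) k0 k1
    refine ⟨_, hx, fun z z1 W hN => ?_⟩
    by_contra hJ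
    rcases Q.nested_cases hx W hN hJ with ⟨β, hβ, u, u0, u1, hu⟩ | ⟨β, hβ, u, u0, u1, hu⟩
    · exact h1 (hI _ hx β hβ u u0 u1 hu) β hβ u u0 u1 hu
    · exact h2 (hII _ hx β hβ u u0 u1 hu) β hβ u u0 u1 hu
  rcases lt_or_ge (Q.hc Q.w) (Q.hc Q.r) with hlt | hge
  · have hra : Q.a ≠ Q.r := fun h => by linarith [Q.hca, congrArg Q.hc h]
    have hd : dt Q.a Q.r Q.σ ≠ 0 := by
      intro h0
      obtain ⟨t, ht⟩ := exists_pt_of_dt_eq_zero hra h0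
      have e := congrArg Q.hc ht
      rw [Q.hcA.pt, Q.hca, Q.hcσ] at e
      have : t = 0 := by
        have : t * Q.hc Q.r = 0 := by linarith
        exact (mul_eq_zero.1 this).resolve_right hr.ne'
      rw [this, pt_zero] at ht
      exact Q.a_ne_σ ht.symm
    obtain ⟨g, hg⟩ : ∃ g : Plane → ℝ, g = fun p => dt Q.a Q.r Q.σ * dt Q.a Q.r p + 0 * dt Q.a Q.r p + 0 :=
      ⟨_, rfl⟩
    have gA : IsAff g := by
      rw [hg]; exact (isAff_dt _ _).lin (isAff_dt _ _) _ _ _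
    have ga : g Q.a = 0 := by rw [hg]; simp [dt_self_left]
    have gr : g Q.r = 0 := by rw [hg]; simp [dt_self_right]
    have gσ : 0 < g Q.σ := by
      rw [hg]
      have := mul_self_pos.2 hd
      simpa using this
    have key : ∀ k : ℝ, 0 < k → k < 1 → ∀ β ∈ segment ℝ Q.a Q.r, ∀ u : ℝ, 0 < u → u < 1 →
        Q.w = pt (pt Q.a Q.σ k) β u → 0 < g Q.w ∧ g Q.w < k * g Q.σ := by
      intro k k0 k1 β hβ u u0 u1 h
      have e := congrArg g h
      rw [gA.pt, gA.pt, ga, isAff_zero_on_segment gA ga gr hβ] at e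
      have := mul_pos k0 gσ
      have := mul_pos u0 this
      have := mul_pos (sub_pos.2 u1) (mul_pos k0 gσ)
      constructor <;> linarith
    rcases le_or_gt (g Q.w) 0 with hw0 | hw0
    · refine hex (1 / 2) (by norm_num) (by norm_num) (fun _ β hβ u u0 u1 h => ?_)
        (fun h => absurd h (not_lt.2 hlt.le))
      linarith [(key _ (by norm_num) (by norm_num) β hβ u u0 u1 h).1]
    · have hk0 : 0 < min (1 / 2) (g Q.w / g Q.σ) := lt_min (by norm_num) (div_pos hw0 gσ)
      have hk1 : min (1 / 2) (g Q.w / g Q.σ) < 1 :=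
        (min_le_left _ _).trans_lt (by norm_num)
      refine hex _ hk0 hk1 (fun _ β hβ u u0 u1 h => ?_) (fun h => absurd h (not_lt.2 hlt.le))
      have h2 := (key _ hk0 hk1 β hβ u u0 u1 h).2
      have h3 := mul_le_mul_of_nonneg_right (min_le_right (1 / 2) (g Q.w / g Q.σ)) gσ.le
      rw [div_mul_cancel₀ _ gσ.ne'] at h3
      linarith
  · have ha := Q.hea
    have key : ∀ k : ℝ, 0 < k → k < 1 → ∀ β ∈ segment ℝ Q.w Q.f, ∀ u : ℝ, 0 < u → u < 1 →
        Q.r = pt (pt Q.a Q.σ k) β u → 0 < Q.he Q.r ∧ Q.he Q.r < (1 - k) * Q.he Q.a := by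
      intro k k0 k1 β hβ u u0 u1 h
      have e := congrArg Q.he h
      rw [Q.heA.pt, Q.heA.pt, Q.heσ, isAff_zero_on_segment Q.heA Q.hew Q.hef hβ] at e
      have h1 := mul_pos (sub_pos.2 k1) ha
      have := mul_pos u0 h1
      have := mul_pos (sub_pos.2 u1) h1
      constructor <;> linarith
    rcases le_or_gt (Q.he Q.r) 0 with hr0 | hr0
    · refine hex (1 / 2) (by norm_num) (by norm_num) (fun h => absurd h (not_lt.2 hge))
        (fun _ β hβ u u0 u1 h => ?_)
      linarith [(key _ (by norm_num) (by norm_num) β hβ u u0 u1 h).1]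
    · have hk0 : 0 < min (1 / 2) (Q.he Q.r / Q.he Q.a) := lt_min (by norm_num) (div_pos hr0 ha)
      have hk1 : min (1 / 2) (Q.he Q.r / Q.he Q.a) < 1 :=
        (min_le_left _ _).trans_lt (by norm_num)
      refine hex (1 - min (1 / 2) (Q.he Q.r / Q.he Q.a)) (by linarith) (by linarith)
        (fun h => absurd h (not_lt.2 hge)) (fun _ β hβ u u0 u1 h => ?_)
      have h2 := (key _ (by linarith) (by linarith) β hβ u u0 u1 h).2
      have h3 := mul_le_mul_of_nonneg_right (min_le_right (1 / 2) (Q.he Q.r / Q.he Q.a)) ha.le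
      rw [div_mul_cancel₀ _ ha.ne'] at h3
      linarith

end Pocket

namespace Region
open Pocket Win
variable {D : Region} {s : Plane}

theorem Reach.of_sees {z : Plane} (h : Sees D s z) (hz : z ∈ D.P) : Reach D s 1 z :=
  Or.inr ⟨s, rfl, Or.inl rfl, h, hz⟩

theorem Reach.ray {x z : Plane} {R : ℝ} {k : ℕ} (h : Reach D s k (pt z x R)) (H : Ray D x z R)
    (hz : D.Valid z) : Reach D s (k + 1) z :=
  h.step H.reg H.sees_end hz.mem_P

end Region

namespace Win
open Region Pocket
variable {D : Region} {ξ z z1 z4 z5 : Plane}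

/-- Points seen through the chord of a sibling window. -/
theorem reach_through {s x y : Plane} {t u : ℝ} (W2 : Win D ξ (pt x y t) (pt x y u))
    (hxy : D.Sees x y) (hy : D.Reg y) (u0 : 0 ≤ u) (ut : u < t) (t1 : t ≤ 1) {m : ℕ}
    (h : D.Reach s m W2.σ) :
    D.Reach s (m + W2.J) y ∨ (D.Reach s (m + W2.J + 1) y ∧ W2.he y ≤ 0) := by
  obtain ⟨x', hx', hs, hc⟩ := W2.cross_ray hxy u0 ut t1
  exact Reach.through _ W2.toPocket le_rfl m h x' y hy hx' hs hc

theorem Sib.he_lt {W : Win D ξ z z1} {W2 : Win D ξ z4 z5} (hne : ¬ EdgeNe W W2)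
    {x x' y : Plane} {R : ℝ} (hx' : x' ∈ openSegment ℝ W.a W.σ) (hlt : W.he x < W.he x')
    (hR : Ray D x' y R) (h : W2.he (pt y x' R) ≤ 0) : W.he x < W.he y := by
  obtain ⟨c, c0, hc⟩ := he_proportional hne
  have h1 := W.toPocket.he_chord hx'
  have h2 : W.he (pt y x' R) ≤ 0 := by
    have := hc (pt y x' R)
    by_contra hn
    linarith [mul_pos c0 (not_le.1 hn)]
  rw [W.heA.pt] at h2
  have h3 := hR.one_lt
  have h4 : W.he x' < W.he y := by
    by_contra hn
    nlinarith [mul_nonneg (sub_nonneg.2 h3.le) (sub_nonneg.2 (not_lt.1 hn))]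
  linarith

end Win

namespace Pocket
open Region Win
variable {D : Region} (Q : Pocket D)

theorem Nested.chord_sub {Q Q' : Pocket D} (h : Nested Q Q') {x : Plane}
    (hx : x ∈ segment ℝ Q'.a Q'.σ) : x ∈ Q.U :=
  Q.absorb (isPreconnected_segment Q'.a Q'.σ) Q'.chord_sub_P
    (fun _ hp => Q.notMem_chord_of_hc (h.hc_chord hp).ne') (left_mem_segment ℝ _ _) h.a_mem hx

theorem mem_chord_of_mem_I {x : Plane} (hx : x ∈ D.I) (h : x ∈ segment ℝ Q.a Q.σ) :
    x ∈ openSegment ℝ Q.a Q.σ := by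
  refine mem_openSegment_of_ne_left_right ?_ ?_ h
  · rintro rfl; exact D.notMem_F hx Q.a_mem_F
  · rintro rfl; exact D.notMem_F hx Q.σ_mem_F

/-- A point of a ray crossing the chord of the ambient pocket. -/
theorem hc_pos_of_cross {x z : Plane} {R v : ℝ} (hR : Ray D x z R) (hx : 0 < Q.hc x)
    (v0 : 0 ≤ v) (h : pt x (pt z x R) v ∈ openSegment ℝ Q.a Q.σ) (hv : v < 1) :
    D.Sees (pt x (pt z x R) v) z ∧ 0 < Q.hc z := by
  have h0 := Q.hc_zero' h
  have hR1 := hR.one_lt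
  rw [Ray.eq_pt] at h h0 ⊢
  have hp : 0 ≤ v * (R - 1) := mul_nonneg v0 (by linarith)
  refine ⟨hR.sees_right (by linarith) ?_, ?_⟩
  · nlinarith [mul_pos (sub_pos.2 hv) (sub_pos.2 hR1)]
  · rw [Q.hcA.pt] at h0
    have h1 : v * (R - 1) * Q.hc z = (1 + v * (R - 1)) * Q.hc x := by linarith
    have h2 : 0 < v * (R - 1) * Q.hc z := by rw [h1]; exact mul_pos (by linarith) hx
    exact pos_of_mul_pos_right h2 hp

theorem mem_of_no_cross {x z : Plane} {R : ℝ} (hR : Ray D x z R) (hx : x ∈ Q.U)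
    (hn : ∀ v, 0 ≤ v → v < 1 → pt x (pt z x R) v ∉ openSegment ℝ Q.a Q.σ) {v : ℝ}
    (v0 : 0 ≤ v) (hv : v < 1) : pt x (pt z x R) v ∈ Q.U := by
  have key : ∀ p ∈ segment ℝ x (pt x (pt z x R) v),
      ∃ u, 0 ≤ u ∧ u < 1 ∧ p = pt x (pt z x R) u := by
    intro p hp
    obtain ⟨u, u0, u1, rfl⟩ := mem_segment_iff_pt.1 hp
    exact ⟨u * v, mul_nonneg u0 v0, by nlinarith, pt_pt_right ..⟩
  refine Q.absorb (isPreconnected_segment x (pt x (pt z x R) v)) (fun p hp => ?_) (fun p hp h => ?_)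
    (left_mem_segment ℝ _ _) hx (right_mem_segment ℝ _ _)
  · obtain ⟨u, u0, u1, rfl⟩ := key p hp
    exact Or.inl (hR.mem_left u0 u1)
  · obtain ⟨u, u0, u1, rfl⟩ := key p hp
    exact hn u u0 u1 (Q.mem_chord_of_mem_I (hR.mem_left u0 u1) h)

theorem nested_of_no_cross {ξ x z : Plane} {R t u : ℝ}
    (hξ : ξ ∈ openSegment ℝ Q.a Q.σ ∨ ξ = Q.σ) (hR : Ray D x z R) (hx : x ∈ Q.U)
    (hn : ∀ v, 0 ≤ v → v < 1 → pt x (pt z x R) v ∉ openSegment ℝ Q.a Q.σ)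
    (u0 : 0 ≤ u) (ut : u < t) (t1 : t ≤ 1)
    (W2 : Win D ξ (pt x (pt z x R) t) (pt x (pt z x R) u)) : Nested Q W2.toPocket := by
  refine Q.nested hξ W2 fun q hq hne => ?_
  obtain ⟨k, k0, k1, rfl⟩ := mem_segment_iff_pt.1 hq
  rw [pt_pt] at hne ⊢
  have hk : k ≠ 1 := by rintro rfl; exact hne (by congr 1; ring)
  have hk1 : k < 1 := lt_of_le_of_ne k1 hk
  have := mul_pos (sub_pos.2 hk1) (sub_pos.2 ut)
  exact Q.mem_of_no_cross hR hx hn (by nlinarith [mul_nonneg k0 (sub_pos.2 ut).le]) (by nlinarith)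

/-- The invariant carried by the search: the chord end `Q.σ` is reached in `m` steps, and so is
everything seen through the chord, up to a controlled number of further steps. -/
structure State (s t : Plane) (N : ℕ) (Q : Pocket D) (m : ℕ) : Prop where
  tU : t ∈ Q.U
  reach : D.Reach s m Q.σ
  le : Q.J + 2 * m + 1 ≤ N
  far : ∀ x ∈ openSegment ℝ Q.a Q.σ, ∀ z, D.Valid z → D.Sees x z → 0 < Q.hc z →
    (∃ k, k + Q.J + m ≤ N ∧ D.Reach s k z) ∨
    (Q.J + 2 * m + 2 ≤ N ∧ (∃ k, k + Q.J + m ≤ N + 1 ∧ D.Reach s k z) ∧ Q.he x < Q.he z)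

variable {s t : Plane} {N m : ℕ} {Q}

theorem gain_two {z z1 : Plane} {W : Win D Q.σ z z1} (hN : Nested Q W.toPocket)
    (h : Q.w ≠ W.a) : W.J + 2 ≤ Q.J := by
  refine hN.J_gain_w h fun hm => ?_
  have := isAff_zero_on_segment Q.heA Q.heσ Q.hew hm
  linarith [Q.he_pos W.see_ξσ]

theorem ρ_proportional {z z1 : Plane} {W : Win D Q.σ z z1} (h : Q.w = W.a) :
    ∃ c, 0 < c ∧ ∀ y, W.ρ y = c * Q.he y :=
  W.ρA.proportional Q.heA (p := Q.σ) (q := W.a) (x := W.σ)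
    (fun e => by
      have h1 := W.a_mem
      have h2 := W.hca
      rw [← e] at h2
      linarith [W.hcξ])
    W.ρξ W.ρ_a Q.heσ (by rw [← h]; exact Q.hew) W.ρσ (Q.he_pos W.see_ξσ)

theorem State.step_roomy (S : State s t N Q m) (hle : Q.J + 2 * m + 2 ≤ N) (ht : t ∈ D.I) :
    (∃ k, 2 * k ≤ N ∧ D.Reach s k t) ∨
      ∃ (Q' : Pocket D) (m' : ℕ), State s t N Q' m' ∧ Q'.J < Q.J := by
  by_cases hst : D.Sees Q.σ t
  · exact Or.inl ⟨m + 1, by linarith, S.reach.step Q.σ_reg hst (Or.inl ht)⟩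
  right
  have hξ : Q.σ ∈ openSegment ℝ Q.a Q.σ ∨ Q.σ = Q.σ := Or.inr rfl
  have hσV : D.Valid Q.σ := Or.inr Q.σ_reg
  obtain ⟨z, z1, W, hN, htW⟩ := Q.exists_window hξ S.tU ht hst
  have hJ := hN.J_lt
  have hstep : ∀ y, D.Sees Q.σ y → y ∈ D.P → D.Reach s (m + 1) y := fun y h1 h2 =>
    S.reach.step Q.σ_reg h1 h2
  refine ⟨W.toPocket, m + 1, ⟨htW, hstep _ W.see_ξσ (Or.inr W.toPocket.σ_mem_F), by omega, ?_⟩,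
    by omega⟩
  intro x2 hx2 z2 hz2 hs2 hc2
  rcases W.far hx2 hz2 hs2 hc2 with ⟨-, h⟩ | ⟨hρz, x', hx', hlt, R, hR, hρy⟩
  · exact Or.inl ⟨m + 1, by omega, hstep _ h hz2.mem_P⟩
  have hxc : 0 < Q.hc x' := hN.hc_chord (openSegment_subset_segment ℝ _ _ hx')
  have hxU : x' ∈ Q.U := hN.chord_sub (openSegment_subset_segment ℝ _ _ hx')
  by_cases hcr : ∃ v, 0 ≤ v ∧ v < 1 ∧ pt x' (pt z2 x' R) v ∈ openSegment ℝ Q.a Q.σ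
  · obtain ⟨v, v0, v1, hv⟩ := hcr
    obtain ⟨hs3, hc3⟩ := Q.hc_pos_of_cross hR hxc v0 hv v1
    rcases S.far _ hv z2 hz2 hs3 hc3 with ⟨k, hk, hr⟩ | ⟨-, ⟨k, hk, hr⟩, hlt3⟩
    · exact Or.inl ⟨k, by omega, hr⟩
    have hw : Q.w ≠ W.a := by
      intro e
      obtain ⟨c, c0, hc⟩ := ρ_proportional e
      have h3 : 0 < W.ρ (pt x' (pt z2 x' R) v) := by
        have h1 := W.ρ_chord hx'
        rw [W.ρA.pt]
        nlinarith [mul_pos (sub_pos.2 v1) h1, mul_nonneg v0 hρy.le]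
      rw [hc] at h3 hρz
      have h4 := pos_of_mul_pos_right h3 c0.le
      have h5 : Q.he z2 ≤ 0 := by
        by_contra hn
        linarith [mul_pos c0 (not_le.1 hn)]
      linarith
    have := gain_two hN hw
    exact Or.inl ⟨k, by omega, hr⟩
  push Not at hcr
  by_cases hsy : D.Sees Q.σ (pt z2 x' R)
  · have := (hstep _ hsy (Or.inr hR.reg.mem_F)).ray hR hz2
    exact Or.inl ⟨m + 1 + 1, by omega, this⟩
  rcases W.sibling hσV hx' hR.sees_left hR.reg hρy hsy with
    ⟨p, q, hE, hσpq, hypq, hvis⟩ | ⟨t', u', u0, ut, t1, W2, hS⟩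
  · have hy0 : Q.he (pt z2 x' R) = 0 := by
      rcases D.uniq p q Q.w Q.f Q.σ hE Q.hE hσpq (openSegment_subset_segment ℝ _ _ Q.hσ) with
        ⟨rfl, rfl⟩ | ⟨rfl, rfl⟩
      · exact isAff_zero_on_segment Q.heA Q.hew Q.hef (openSegment_subset_segment ℝ _ _ hypq)
      · exact isAff_zero_on_segment Q.heA Q.hef Q.hew (openSegment_subset_segment ℝ _ _ hypq)
    have hw : Q.w ≠ W.a := by
      intro e
      obtain ⟨c, c0, hc⟩ := ρ_proportional e
      rw [hc, hy0] at hρy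
      linarith
    have hg := gain_two hN hw
    have hne : Q.σ ≠ pt z2 x' R := by
      intro e
      have := W.ρξ
      have h2 := congrArg W.ρ e
      linarith
    have hx'σ : D.Sees Q.σ x' := by
      have := (hvis 0 le_rfl zero_lt_one).2
      rwa [pt_zero] at this
    have hd := dt_ne_zero_of_isAff Q.heA hne Q.heσ hy0 (Q.he_pos hx'σ).ne'
    obtain ⟨σ', hr', h1, h2⟩ := exists_common_reg hE hσpq hypq hd (z1 := x') (by
      intro q hq hqy
      obtain ⟨k, k0, k1, rfl⟩ := mem_segment_iff_pt.1 hq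
      refine hvis k k0 (lt_of_le_of_ne k1 ?_)
      rintro rfl
      exact hqy (pt_one _ _))
    have h3 := (hstep σ' h1 (Or.inr hr'.mem_F)).step hr' h2.symm (Or.inr hR.reg.mem_F)
    exact Or.inl ⟨m + 1 + 1 + 1, by omega, h3.ray hR hz2⟩
  · have hN2 := Q.nested_of_no_cross hξ hR hxU hcr u0 ut t1 W2
    have hg := hS.card_nested_two hσV hN hN2
    have h1 := W2.reach_through hR.sees_left hR.reg u0 ut t1
      (hstep _ W2.see_ξσ (Or.inr W2.toPocket.σ_mem_F))
    have h2 : D.Reach s (m + 1 + W2.J + 1) (pt z2 x' R) := by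
      rcases h1 with h1 | h1
      · exact h1.mono (by omega)
      · exact h1.1
    exact Or.inl ⟨_, by omega, h2.ray hR hz2⟩

theorem State.step_tight (S : State s t N Q m) (hle : Q.J + 2 * m + 1 = N) (ht : t ∈ D.I) :
    (∃ k, 2 * k ≤ N ∧ D.Reach s k t) ∨
      ∃ (Q' : Pocket D) (m' : ℕ), State s t N Q' m' ∧ Q'.J < Q.J := by
  have hall : ∀ x ∈ openSegment ℝ Q.a Q.σ, ∀ z, D.Valid z → D.Sees x z → 0 < Q.hc z →
      D.Reach s (m + 1) z := by
    intro x hx z hz hs hc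
    rcases S.far x hx z hz hs hc with ⟨k, hk, hr⟩ | ⟨h, -⟩
    · exact hr.mono (by omega)
    · omega
  obtain ⟨x, hx, hgood⟩ := Q.exists_good
  have hξ : x ∈ openSegment ℝ Q.a Q.σ ∨ x = Q.σ := Or.inl hx
  have hxI := Q.mem_I hx
  have hxV : D.Valid x := Or.inl hxI
  have hJ0 := Q.J_pos
  by_cases hst : D.Sees x t
  · exact Or.inl ⟨m + 1, by omega,
      hall x hx t (Or.inl ht) hst (Q.hc_pos_of_sees hξ S.tU hst)⟩
  right
  obtain ⟨z, z1, W, hN, htW⟩ := Q.exists_window hξ S.tU ht hst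
  have hJ := hgood z z1 W hN
  refine ⟨W.toPocket, m + 1, ⟨htW, hall x hx _ (Or.inr W.toPocket.σ_reg) W.see_ξσ hN.hcσ,
    by omega, ?_⟩, by omega⟩
  intro x2 hx2 z2 hz2 hs2 hc2
  rcases W.far hx2 hz2 hs2 hc2 with ⟨-, h⟩ | ⟨hρz, x', hx', hlt, R, hR, hρy⟩
  · have hzU : z2 ∈ Q.U := hN.U_sub (by
      have := W.toPocket.mem_of_sees hx2 hz2.mem_P hs2 hc2 zero_lt_one le_rfl
      rwa [pt_one] at this)
    exact Or.inl ⟨m + 1, by omega, hall x hx z2 hz2 h (Q.hc_pos_of_sees hξ hzU h)⟩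
  have hxc : 0 < Q.hc x' := hN.hc_chord (openSegment_subset_segment ℝ _ _ hx')
  have hxU : x' ∈ Q.U := hN.chord_sub (openSegment_subset_segment ℝ _ _ hx')
  by_cases hcr : ∃ v, 0 ≤ v ∧ v < 1 ∧ pt x' (pt z2 x' R) v ∈ openSegment ℝ Q.a Q.σ
  · obtain ⟨v, v0, v1, hv⟩ := hcr
    obtain ⟨hs3, hc3⟩ := Q.hc_pos_of_cross hR hxc v0 hv v1
    exact Or.inl ⟨m + 1, by omega, hall _ hv z2 hz2 hs3 hc3⟩
  push Not at hcr
  by_cases hyc : pt z2 x' R ∈ segment ℝ Q.a Q.σ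
  · have hyσ : pt z2 x' R = Q.σ := by
      by_contra hne
      have ha : pt z2 x' R ≠ Q.a := by
        intro e
        exact D.vertex_not_reg Q.ha (e ▸ hR.reg)
      exact D.notMem_F (Q.mem_I (mem_openSegment_of_ne_left_right ha.symm (Ne.symm hne) hyc))
        hR.reg.mem_F
    have h1 : D.Reach s m (pt z2 x' R) := by rw [hyσ]; exact S.reach
    exact Or.inl ⟨m + 1, by omega, h1.ray hR hz2⟩
  have hyU : pt z2 x' R ∈ Q.U := by
    refine Q.absorb (isPreconnected_segment x' (pt z2 x' R)) (fun p hp => ?_) (fun p hp h => ?_)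
      (left_mem_segment ℝ _ _) hxU (right_mem_segment ℝ _ _)
    · obtain ⟨k, k0, k1, rfl⟩ := mem_segment_iff_pt.1 hp
      rcases k1.lt_or_eq with k1 | rfl
      · exact Or.inl (hR.mem_left k0 k1)
      · rw [pt_one]; exact Or.inr hR.reg.mem_F
    · obtain ⟨k, k0, k1, rfl⟩ := mem_segment_iff_pt.1 hp
      rcases k1.lt_or_eq with k1 | rfl
      · exact hcr k k0 k1 (Q.mem_chord_of_mem_I (hR.mem_left k0 k1) h)
      · rw [pt_one] at h; exact hyc h
  by_cases hsy : D.Sees x (pt z2 x' R)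
  · have := (hall x hx _ (Or.inr hR.reg) hsy (Q.hc_pos_of_sees hξ hyU hsy)).ray hR hz2
    exact Or.inl ⟨m + 1 + 1, by omega, this⟩
  rcases W.sibling hxV hx' hR.sees_left hR.reg hρy hsy with
    ⟨p, q, hE, hσpq, -, -⟩ | ⟨t', u', u0, ut, t1, W2, hS⟩
  · exact (D.notMem_F hxI (Reg.mem_F ⟨p, q, hE, hσpq⟩)).elim
  have hN2 := Q.nested_of_no_cross hξ hR hxU hcr u0 ut t1 W2
  have hg := hS.card_nested_two hxV hN hN2
  have hJ2 := W2.toPocket.J_pos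
  rcases W2.reach_through hR.sees_left hR.reg u0 ut t1
    (hall x hx _ (Or.inr W2.toPocket.σ_reg) W2.see_ξσ hN2.hcσ) with h1 | ⟨h1, h2⟩
  · exact Or.inl ⟨_, by omega, h1.ray hR hz2⟩
  by_cases hne : EdgeNe W W2
  · have hg3 := hS.card_nested_three hxV (Q.hc_zero_of_mem hξ) hN hN2 hne
    exact Or.inl ⟨_, by omega, h1.ray hR hz2⟩
  · exact Or.inr ⟨by omega, ⟨_, by omega, h1.ray hR hz2⟩, Sib.he_lt hne hx' hlt hR h2⟩

theorem State.reach_target (ht : t ∈ D.I) (n : ℕ) :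
    ∀ (Q : Pocket D) (m : ℕ), Q.J ≤ n → State s t N Q m → ∃ k, 2 * k ≤ N ∧ D.Reach s k t := by
  induction n with
  | zero => intro Q m hn _; have := Q.J_pos; omega
  | succ n ih =>
    intro Q m hn S
    have : (∃ k, 2 * k ≤ N ∧ D.Reach s k t) ∨
        ∃ (Q' : Pocket D) (m' : ℕ), State s t N Q' m' ∧ Q'.J < Q.J := by
      rcases S.le.lt_or_eq with h | h
      · exact S.step_roomy h ht
      · exact S.step_tight h ht
    rcases this with h | ⟨Q', m', S', h⟩
    · exact h
    · exact ih Q' m' (by omega) S'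

end Pocket

namespace Region
open Pocket Win
variable {D : Region} {s t : Plane}

theorem exists_first_window (hs : s ∈ D.I) (ht : t ∈ D.I) (hst : ¬ D.Sees s t) :
    ∃ z z1, ∃ W : Win D s z z1, t ∈ W.U := by
  obtain ⟨z, -, ⟨K, hK, hKI, hKs, hzK, htK⟩, h⟩ :=
    exists_path_exit (Or.inl hs) hs (sees_self hs) ht hst
  obtain ⟨z1, -, ⟨W⟩⟩ := h univ univ_mem
  exact ⟨z, z1, W, W.toPocket.absorb hK (fun p hp => Or.inl (hKI hp))
    (fun p hp hm => hKs p hp (W.see_ξ p (W.toPocket.mem_chord_of_mem_I (hKI hp) hm))) hzK W.zU htK⟩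

theorem exists_reach (hs : s ∈ D.I) (ht : t ∈ D.I) (hN : 2 ≤ D.Vs.card) :
    ∃ k, 2 * k ≤ D.Vs.card ∧ D.Reach s k t := by
  classical
  by_cases hst : D.Sees s t
  · exact ⟨1, hN, Reach.of_sees hst (Or.inl ht)⟩
  have hsV : D.Valid s := Or.inl hs
  obtain ⟨z, z1, W, htW⟩ := exists_first_window hs ht hst
  obtain ⟨d, hd, hdρ, hdU⟩ := W.exists_back hs
  have hρc : ∀ p ∈ segment ℝ W.a W.σ, 0 ≤ W.ρ p := fun p hp =>
    W.ρA.convex_nonneg.segment_subset (x := W.a) (y := W.σ) W.ρ_a.ge W.ρσ.le hp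
  have hsc : s ∉ segment ℝ W.a W.σ := fun h => by
    have h1 := W.toPocket.hc_zero h
    linarith [W.hcξ]
  have hdW : d ∉ W.U := hdU W.toPocket hρc hsc W.ξU
  have hda : d ≠ W.a := by rintro rfl; linarith [W.ρ_a]
  have hdf : d ≠ W.f := by rintro rfl; linarith [W.ρf]
  have haW : W.a ∉ W.U := fun h => W.toPocket.notMem_chord h (left_mem_segment ℝ _ _)
  have hcard : W.J + 3 ≤ D.Vs.card := by
    have h3 : ({W.a, W.f, d} : Finset Plane).card = 3 := by
      rw [Finset.card_eq_three]
      exact ⟨_, _, _, W.f_ne_a.symm, hda.symm, hdf.symm, rfl⟩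
    rw [← h3, Pocket.J, ← Finset.card_union_of_disjoint]
    · refine Finset.card_le_card fun v hv => ?_
      rcases Finset.mem_union.1 hv with h | h
      · exact (Finset.mem_filter.1 h).1
      · simp only [Finset.mem_insert, Finset.mem_singleton] at h
        rcases h with rfl | rfl | rfl
        · exact W.ha
        · exact E_right W.hE
        · exact hd
    · rw [Finset.disjoint_left]
      intro v hv h
      have hv := (Finset.mem_filter.1 hv).2
      simp only [Finset.mem_insert, Finset.mem_singleton] at h
      rcases h with rfl | rfl | rfl
      · exact haW hv
      · exact W.fU hv
      · exact hdW hv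
  have hone : ∀ y, D.Sees s y → y ∈ D.P → D.Reach s 1 y := fun y h1 h2 => Reach.of_sees h1 h2
  refine State.reach_target ht W.J W.toPocket 1 le_rfl
    ⟨htW, hone _ W.see_ξσ (Or.inr W.toPocket.σ_mem_F), by omega, ?_⟩
  intro x2 hx2 z2 hz2 hs2 hc2
  rcases W.far hx2 hz2 hs2 hc2 with ⟨-, h⟩ | ⟨hρz, x', hx', hlt, R, hR, hρy⟩
  · exact Or.inl ⟨1, by omega, hone _ h hz2.mem_P⟩
  by_cases hsy : D.Sees s (pt z2 x' R)
  · exact Or.inl ⟨1 + 1, by omega, (hone _ hsy (Or.inr hR.reg.mem_F)).ray hR hz2⟩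
  rcases W.sibling hsV hx' hR.sees_left hR.reg hρy hsy with
    ⟨p, q, hE, hσpq, -, -⟩ | ⟨t', u', u0, ut, t1, W2, hS⟩
  · exact (D.notMem_F hs (Reg.mem_F ⟨p, q, hE, hσpq⟩)).elim
  have hρ2 : ∀ p ∈ segment ℝ W2.a W2.σ, 0 < W.ρ p := fun p hp => (hS.chord2 hp).2
  have hdW2 : d ∉ W2.U := hdU W2.toPocket (fun p hp => (hρ2 p hp).le)
    (fun h => by linarith [hρ2 _ h, W.ρξ]) W2.ξU
  have ha2 := hρ2 _ (left_mem_segment ℝ _ _)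
  have hda2 : d ≠ W2.a := by rintro rfl; linarith
  have hcount : ∀ S : Finset Plane, (∀ v ∈ S, v ∈ D.Vs ∧ v ∉ W.U ∧ v ∉ W2.U) →
      W.J + W2.J + S.card ≤ D.Vs.card := fun S h =>
    Pocket.card_two (fun p hp hp2 => hS.disjoint hsV hp hp2) D.Vs S (fun v hv _ => hv)
      (fun v hv _ => hv) h
  have haW2 : W.a ∉ W2.U := hS.chord_notMem hsV (left_mem_segment ℝ _ _)
  have ha2W : W2.a ∉ W.U := hS.chord2_notMem hsV (left_mem_segment ℝ _ _)
  have ha2W2 : W2.a ∉ W2.U := fun h => W2.toPocket.notMem_chord h (left_mem_segment ℝ _ _)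
  have hc3 : W.J + W2.J + 3 ≤ D.Vs.card := by
    have h3 : ({W.a, W2.a, d} : Finset Plane).card = 3 := by
      rw [Finset.card_eq_three]
      exact ⟨_, _, _, hS.a_ne, hda.symm, hda2.symm, rfl⟩
    rw [← h3]
    refine hcount _ fun v h => ?_
    simp only [Finset.mem_insert, Finset.mem_singleton] at h
    rcases h with rfl | rfl | rfl
    · exact ⟨W.ha, haW, haW2⟩
    · exact ⟨W2.ha, ha2W, ha2W2⟩
    · exact ⟨hd, hdW, hdW2⟩
  have hJ2 := W2.toPocket.J_pos
  rcases W2.reach_through hR.sees_left hR.reg u0 ut t1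
    (hone _ W2.see_ξσ (Or.inr W2.toPocket.σ_mem_F)) with h1 | ⟨h1, h2⟩
  · exact Or.inl ⟨_, by omega, h1.ray hR hz2⟩
  by_cases hne : EdgeNe W W2
  · obtain ⟨⟨f1, f2⟩, -⟩ := hS.far_ends hsV hne
    have h4 : W.J + W2.J + 4 ≤ D.Vs.card := by
      have h4 : ({W.f, W.a, W2.a, d} : Finset Plane).card = 4 := by
        rw [Finset.card_insert_of_notMem, Finset.card_eq_three.2
          ⟨_, _, _, hS.a_ne, hda.symm, hda2.symm, rfl⟩]
        simp only [Finset.mem_insert, Finset.mem_singleton, not_or]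
        exact ⟨W.f_ne_a, f1, hdf.symm⟩
      rw [← h4]
      refine hcount _ fun v h => ?_
      simp only [Finset.mem_insert, Finset.mem_singleton] at h
      rcases h with rfl | rfl | rfl | rfl
      · exact ⟨E_right W.hE, W.fU, f2⟩
      · exact ⟨W.ha, haW, haW2⟩
      · exact ⟨W2.ha, ha2W, ha2W2⟩
      · exact ⟨hd, hdW, hdW2⟩
    exact Or.inl ⟨_, by omega, h1.ray hR hz2⟩
  · exact Or.inr ⟨by omega, ⟨_, by omega, h1.ray hR hz2⟩, Sib.he_lt hne hx' hlt hR h2⟩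

end Region

theorem left_notMem_openSegment {p q : Plane} (h : p ≠ q) : p ∉ openSegment ℝ p q := fun hm =>
  h (left_mem_openSegment_iff.1 hm)

theorem segment_subset_union {p q x : Plane} (h : x ∈ segment ℝ p q) :
    segment ℝ p q ⊆ segment ℝ p x ∪ segment ℝ x q := by
  obtain ⟨t, t0, t1, rfl⟩ := mem_segment_iff_pt.1 h
  intro y hy
  obtain ⟨u, u0, u1, rfl⟩ := mem_segment_iff_pt.1 hy
  rcases le_or_gt u t with hu | hu
  · left
    rcases t0.eq_or_lt with rfl | t0
    · have : u = 0 := le_antisymm hu u0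
      subst this
      rw [pt_zero]; exact left_mem_segment ℝ _ _
    · refine mem_segment_iff_pt.2 ⟨u / t, div_nonneg u0 t0.le, (div_le_one t0).2 hu, ?_⟩
      rw [pt_pt_right, div_mul_cancel₀ _ t0.ne']
  · right
    have ht : 0 < 1 - t := by linarith
    refine mem_segment_iff_pt.2 ⟨(u - t) / (1 - t), div_nonneg (by linarith) ht.le,
      (div_le_one ht).2 (by linarith), ?_⟩
    have h1 : pt p q 1 = q := pt_one p q
    have h2 := pt_pt p q t 1 ((u - t) / (1 - t))
    rw [h1] at h2
    rw [h2]
    congr 1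
    field_simp
    ring

theorem segment_inter_of_mem_openSegment {p q x : Plane} (hpq : p ≠ q) (h : x ∈ openSegment ℝ p q)
    {y : Plane} (h1 : y ∈ segment ℝ p x) (h2 : y ∈ segment ℝ x q) : y = x := by
  obtain ⟨t, t0, t1, rfl⟩ := mem_openSegment_iff_pt.1 h
  obtain ⟨u, u0, u1, e1⟩ := mem_segment_iff_pt.1 h1
  obtain ⟨w, w0, w1, e2⟩ := mem_segment_iff_pt.1 h2
  rw [pt_pt_right] at e1
  have h3 := pt_pt p q t 1 w
  rw [pt_one] at h3
  rw [h3] at e2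
  have := pt_injective hpq (e1.symm.trans e2)
  rw [e1]
  congr 1
  have := mul_nonneg w0 (sub_nonneg.2 t1.le)
  nlinarith

theorem right_notMem_segment_left {p q x : Plane} (h : x ∈ openSegment ℝ p q) (hpq : p ≠ q) :
    q ∉ segment ℝ p x := fun hq => by
  have := segment_inter_of_mem_openSegment hpq h hq (right_mem_segment ℝ _ _)
  rw [← this, openSegment_symm] at h
  exact left_notMem_openSegment hpq.symm h

theorem add_mod_cancel {n i k l : ℕ} (h : (i + k) % n = (i + l) % n) (hk : k < n) (hl : l < n) :
    k = l :=
  (Nat.ModEq.add_left_cancel' i h : k ≡ l [MOD n]).eq_of_lt_of_lt hk hl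

theorem exists_offset {n i j : ℕ} (hi : i < n) (hj : j < n) : ∃ d, d < n ∧ (i + d) % n = j := by
  rcases le_or_gt i j with h | h
  · exact ⟨j - i, by omega, by rw [Nat.add_sub_cancel' h, Nat.mod_eq_of_lt hj]⟩
  · exact ⟨j + n - i, by omega, by
      rw [Nat.add_sub_cancel' (by omega), Nat.add_mod_right, Nat.mod_eq_of_lt hj]⟩

namespace IsSimplePolygon
variable {n : ℕ} {P : Set Plane} {v : ℕ → Plane}

theorem succ_ne (hn : 3 ≤ n) {i : ℕ} (hi : i < n) : (i + 1) % n ≠ i := by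
  intro h
  have := add_mod_cancel (n := n) (i := i) (k := 1) (l := 0) (by
    rw [h, add_zero, Nat.mod_eq_of_lt hi]) (by omega) (by omega)
  omega

theorem vertex_ne (hn : 3 ≤ n) (hP : IsSimplePolygon n P v) {i : ℕ} (hi : i < n) :
    v i ≠ v ((i + 1) % n) := fun h =>
  succ_ne hn hi (hP.2.2.1 i hi _ (Nat.mod_lt _ (by omega)) h).symm

theorem eq_vertex (hP : IsSimplePolygon n P v) {i j : ℕ} (hi : i < n) (hj : j < n) (hij : i ≠ j)
    {x : Plane} (h1 : x ∈ polyEdge n v i) (h2 : x ∈ polyEdge n v j) :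
    (j = (i + 1) % n ∧ x = v j) ∨ (i = (j + 1) % n ∧ x = v i) := by
  obtain ⟨e1, e2, e3⟩ := hP.2.2.2.2 i hi j hj hij
  by_cases h : j = (i + 1) % n
  · have : x ∈ polyEdge n v i ∩ polyEdge n v j := ⟨h1, h2⟩
    rw [e1 h] at this
    exact Or.inl ⟨h, this⟩
  by_cases h' : i = (j + 1) % n
  · have : x ∈ polyEdge n v i ∩ polyEdge n v j := ⟨h1, h2⟩
    rw [e2 h'] at this
    exact Or.inr ⟨h', this⟩
  · exact (disjoint_left.1 (e3 h h') h1 h2).elim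

theorem edge_unique (hn : 3 ≤ n) (hP : IsSimplePolygon n P v) {i j : ℕ} (hi : i < n) (hj : j < n)
    {x : Plane} (h1 : x ∈ openSegment ℝ (v i) (v ((i + 1) % n))) (h2 : x ∈ polyEdge n v j) :
    i = j := by
  by_contra hij
  have hne := vertex_ne hn hP hi
  rcases hP.eq_vertex hi hj hij (openSegment_subset_segment ℝ _ _ h1) h2 with ⟨rfl, rfl⟩ | ⟨-, rfl⟩
  · rw [openSegment_symm] at h1
    exact left_notMem_openSegment hne.symm h1
  · exact left_notMem_openSegment hne h1

theorem edge_sub (hP : IsSimplePolygon n P v) {i : ℕ} (hi : i < n) :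
    polyEdge n v i ⊆ frontier P := by
  rw [hP.2.2.2.1]
  exact fun x hx => mem_biUnion (Finset.mem_coe.2 (Finset.mem_range.2 hi)) hx

theorem exists_edge (hP : IsSimplePolygon n P v) {x : Plane} (hx : x ∈ frontier P) :
    ∃ i < n, x ∈ polyEdge n v i := by
  rw [hP.2.2.2.1] at hx
  obtain ⟨i, hi, hx⟩ := mem_iUnion₂.1 hx
  exact ⟨i, Finset.mem_range.1 hi, hx⟩

theorem union_eq (hP : IsSimplePolygon n P v) : interior P ∪ frontier P = P := by
  rw [← closure_eq_interior_union_frontier, hP.1.isClosed.closure_eq]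

/-- Adjacency of vertices. -/
def Adj (n : ℕ) (v : ℕ → Plane) (p q : Plane) : Prop :=
  ∃ i < n, (p = v i ∧ q = v ((i + 1) % n)) ∨ (p = v ((i + 1) % n) ∧ q = v i)

theorem Adj.segment_eq {p q : Plane} (h : Adj n v p q) : ∃ i < n,
    ((p = v i ∧ q = v ((i + 1) % n)) ∨ (p = v ((i + 1) % n) ∧ q = v i)) ∧
    segment ℝ p q = polyEdge n v i ∧ openSegment ℝ p q = openSegment ℝ (v i) (v ((i + 1) % n)) := by
  obtain ⟨i, hi, ⟨rfl, rfl⟩ | ⟨rfl, rfl⟩⟩ := h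
  · exact ⟨i, hi, Or.inl ⟨rfl, rfl⟩, rfl, rfl⟩
  · exact ⟨i, hi, Or.inr ⟨rfl, rfl⟩, segment_symm .., openSegment_symm ..⟩

theorem edge_offset (i k : ℕ) :
    polyEdge n v ((i + k) % n) = segment ℝ (v ((i + k) % n)) (v ((i + (k + 1)) % n)) := by
  rw [polyEdge, Nat.mod_add_mod, add_assoc]

theorem offset_inter (hn : 3 ≤ n) (hP : IsSimplePolygon n P v) {i k l : ℕ} (hi : i < n)
    (hkl : k < l) (hl : l < n) {x : Plane} (h1 : x ∈ polyEdge n v ((i + k) % n))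
    (h2 : x ∈ polyEdge n v ((i + l) % n)) :
    (l = k + 1 ∧ x = v ((i + l) % n)) ∨ (k = 0 ∧ l + 1 = n ∧ x = v i) := by
  have hn0 : 0 < n := by omega
  rcases hP.eq_vertex (Nat.mod_lt _ hn0) (Nat.mod_lt _ hn0)
    (fun h => hkl.ne (add_mod_cancel h (by omega) hl)) h1 h2 with ⟨h, hx⟩ | ⟨h, hx⟩
  · rw [Nat.mod_add_mod, add_assoc] at h
    exact Or.inl ⟨add_mod_cancel h hl (by omega), hx⟩
  · rw [Nat.mod_add_mod, add_assoc] at h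
    rcases (Nat.succ_le_of_lt hl).lt_or_eq with h' | h'
    · have := add_mod_cancel h (by omega) h'
      omega
    · have h0 : l + 1 = n := h'
      rw [h0, Nat.add_mod_right] at h
      have h3 : k = 0 := add_mod_cancel (n := n) (i := i) (by rw [h, add_zero]) (by omega) hn0
      subst h3
      rw [add_zero, Nat.mod_eq_of_lt hi] at hx
      exact Or.inr ⟨rfl, h0, hx⟩

theorem chord_sep (hn : 3 ≤ n) (hP : IsSimplePolygon n P v) {i j : ℕ} (hi : i < n) (hj : j < n)
    {σ : Plane} (hσ : σ ∈ openSegment ℝ (v j) (v ((j + 1) % n)))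
    (hc : openSegment ℝ (v i) σ ⊆ interior P) {A B X : Plane} {K : Set Plane}
    (hAB : segment ℝ A B ⊆ interior P) (hX : X ∈ openSegment ℝ (v i) σ) (hXAB : X ∈ segment ℝ A B)
    (hA : 0 < dt σ (v i) A) (hB : dt σ (v i) B < 0) (hK : IsPreconnected K)
    (hKs : K ⊆ P \ segment ℝ (v i) σ) (hAK : A ∈ K) (hBK : B ∈ K) : False := by
  have hn0 : 0 < n := by omega
  have hIF : Disjoint (interior P) (frontier P) := disjoint_interior_frontier
  have hσe : σ ∈ polyEdge n v j := openSegment_subset_segment ℝ _ _ hσ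
  have hends : v i ∉ polyEdge n v j := fun h =>
    disjoint_left.1 hIF (hc hX) (hP.edge_sub hj ((convex_segment _ _).segment_subset h hσe
      (openSegment_subset_segment ℝ _ _ hX)))
  obtain ⟨d, hd, rfl⟩ := exists_offset hi hj
  have hjs : ((i + d) % n + 1) % n = (i + (d + 1)) % n := by rw [Nat.mod_add_mod, add_assoc]
  have hne := vertex_ne hn hP hj
  rw [hjs] at hσ hne
  have hedge : ∀ k, polyEdge n v ((i + k) % n) ⊆ frontier P := fun k =>
    hP.edge_sub (Nat.mod_lt _ hn0)
  have hd0 : d ≠ 0 := by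
    rintro rfl
    rw [edge_offset, add_zero, Nat.mod_eq_of_lt hi] at hends
    exact hends (left_mem_segment ℝ _ _)
  have hd1 : d + 1 ≠ n := by
    intro h
    rw [edge_offset, h, Nat.add_mod_right, Nat.mod_eq_of_lt hi] at hends
    exact hends (right_mem_segment ℝ _ _)
  have hleft : segment ℝ (v ((i + d) % n)) σ ⊆ polyEdge n v ((i + d) % n) :=
    (convex_segment _ _).segment_subset (left_mem_segment ℝ _ _) hσe
  have hright : segment ℝ σ (v ((i + (d + 1)) % n)) ⊆ polyEdge n v ((i + d) % n) := by
    rw [edge_offset] at hσe ⊢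
    exact (convex_segment _ _).segment_subset hσe (right_mem_segment ℝ _ _)
  obtain ⟨p, hp⟩ : ∃ p : ℕ → Plane, p = fun k => if k ≤ d then v ((i + k) % n) else σ := ⟨_, rfl⟩
  obtain ⟨q, hq⟩ : ∃ q : ℕ → Plane, q = fun k => if k = 0 then σ else v ((i + (d + k)) % n) :=
    ⟨_, rfl⟩
  have hpk : ∀ k < d, segment ℝ (p k) (p (k + 1)) = polyEdge n v ((i + k) % n) := by
    intro k hk
    rw [edge_offset, hp]
    simp only [if_pos hk.le, if_pos (Nat.succ_le_of_lt hk)]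
  have hpd : segment ℝ (p d) (p (d + 1)) = segment ℝ (v ((i + d) % n)) σ := by
    rw [hp]
    simp only [le_refl, if_true, Nat.not_succ_le_self, if_false]
  have hq0 : segment ℝ (q 0) (q (0 + 1)) = segment ℝ σ (v ((i + (d + 1)) % n)) := by
    rw [hq]; simp
  have hqk : ∀ k, k ≠ 0 → segment ℝ (q k) (q (k + 1)) = polyEdge n v ((i + (d + k)) % n) := by
    intro k hk
    rw [edge_offset, hq]
    simp only [if_neg hk, Nat.succ_ne_zero, if_false, add_assoc]
  have hP1 : ∀ x ∈ trace p (d + 1), (∃ k < d, x ∈ polyEdge n v ((i + k) % n)) ∨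
      x ∈ segment ℝ (v ((i + d) % n)) σ := by
    intro x hx
    obtain ⟨k, hk, hx'⟩ := mem_iUnion₂.1 hx
    rcases (Nat.lt_succ_iff.1 (Finset.mem_range.1 hk)).lt_or_eq with h | rfl
    · rw [hpk k h] at hx'; exact Or.inl ⟨k, h, hx'⟩
    · rw [hpd] at hx'; exact Or.inr hx'
  have hQ1 : ∀ x ∈ trace q (n - d), (∃ l, d < l ∧ l < n ∧ x ∈ polyEdge n v ((i + l) % n)) ∨
      x ∈ segment ℝ σ (v ((i + (d + 1)) % n)) := by
    intro x hx
    obtain ⟨k, hk, hx⟩ := mem_iUnion₂.1 hx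
    have hk := Finset.mem_range.1 hk
    by_cases h : k = 0
    · subst h; rw [hq0] at hx; exact Or.inr hx
    · rw [hqk k h] at hx; exact Or.inl ⟨d + k, by omega, by omega, hx⟩
  have hai : v i ∈ segment ℝ (v i) σ := left_mem_segment ℝ _ _
  refine chord_separates (P := p) (Q := q) (m := d + 1) (l := n - d) (a := v i) (σ := σ)
    (I := interior P) (K := K) (fun h => hends (h ▸ hσe)) ?_ ?_ ?_ ?_ hP.2.1.isPreconnected
    ?_ ?_ ?_ hAB hX hXAB hA hB hK ?_ ?_ hAK hBK
  · rw [hp]; simp [Nat.mod_eq_of_lt hi]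
  · rw [hp]; simp
  · rw [hq]; simp
  · rw [hq]
    simp only [if_neg (by omega : ¬ n - d = 0), Nat.add_sub_cancel' hd.le, Nat.add_mod_right,
      Nat.mod_eq_of_lt hi]
  · refine disjoint_left.2 fun x hx h => disjoint_left.1 hIF hx ?_
    rcases hP1 x h with ⟨k, -, h⟩ | h
    · exact hedge _ h
    · exact hedge _ (hleft h)
  · refine disjoint_left.2 fun x hx h => disjoint_left.1 hIF hx ?_
    rcases hQ1 x h with ⟨k, -, -, h⟩ | h
    · exact hedge _ h
    · exact hedge _ (hright h)
  · rintro x ⟨h1, h2⟩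
    rcases hP1 x h1 with ⟨k, hk, h1⟩ | h1 <;> rcases hQ1 x h2 with ⟨l, hl, hln, h2⟩ | h2
    · rcases offset_inter hn hP hi (hk.trans hl) hln h1 h2 with ⟨h, -⟩ | ⟨-, -, rfl⟩
      · omega
      · exact hai
    · rcases offset_inter hn hP hi hk hd h1 (hright h2) with ⟨h, rfl⟩ | ⟨-, h, -⟩
      · rw [segment_symm] at h2
        rw [openSegment_symm] at hσ
        exact (right_notMem_segment_left hσ hne.symm h2).elim
      · omega
    · rcases offset_inter hn hP hi hl hln (hleft h1) h2 with ⟨rfl, rfl⟩ | ⟨h, -⟩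
      · exact (right_notMem_segment_left hσ hne h1).elim
      · omega
    · rw [segment_inter_of_mem_openSegment hne hσ h1 h2]
      exact right_mem_segment ℝ _ _
  · intro x hx
    obtain ⟨hxP, -⟩ := hKs hx
    rw [← hP.union_eq] at hxP
    rcases hxP with h | h
    · exact Or.inl (Or.inl h)
    obtain ⟨j', hj', h⟩ := hP.exists_edge h
    obtain ⟨e, he, rfl⟩ := exists_offset hi hj'
    have hPin : ∀ k ≤ d, segment ℝ (p k) (p (k + 1)) ⊆ trace p (d + 1) := fun k hk y hy =>
      mem_biUnion (Finset.mem_coe.2 (Finset.mem_range.2 (Nat.lt_succ_of_le hk))) hy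
    have hQin : ∀ k < n - d, segment ℝ (q k) (q (k + 1)) ⊆ trace q (n - d) := fun k hk y hy =>
      mem_biUnion (Finset.mem_coe.2 (Finset.mem_range.2 hk)) hy
    rcases lt_trichotomy e d with hed | rfl | hed
    · exact Or.inl (Or.inr (hPin e hed.le (by rw [hpk e hed]; exact h)))
    · rw [edge_offset] at h
      rcases segment_subset_union (openSegment_subset_segment ℝ _ _ hσ) h with h | h
      · exact Or.inl (Or.inr (hPin e le_rfl (by rw [hpd]; exact h)))
      · exact Or.inr (hQin 0 (by omega) (by rw [hq0]; exact h))
    · refine Or.inr (hQin (e - d) (by omega) ?_)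
      rw [hqk _ (by omega), Nat.add_sub_cancel' hed.le]
      exact h
  · exact disjoint_left.2 fun x hx => (hKs hx).2

theorem adj_iff (hn : 3 ≤ n) (hP : IsSimplePolygon n P v) {i : ℕ} (hi : i < n) (r : Plane) :
    Adj n v (v i) r ↔ r = v ((i + 1) % n) ∨ r = v ((i + (n - 1)) % n) := by
  have hn0 : 0 < n := by omega
  have hpred : ((i + (n - 1)) % n + 1) % n = i := by
    rw [Nat.mod_add_mod, add_assoc, Nat.sub_add_cancel (by omega), Nat.add_mod_right,
      Nat.mod_eq_of_lt hi]
  constructor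
  · rintro ⟨j, hj, ⟨h, rfl⟩ | ⟨h, rfl⟩⟩
    · rw [hP.2.2.1 i hi j hj h]; exact Or.inl rfl
    · have := hP.2.2.1 i hi _ (Nat.mod_lt _ hn0) h
      right
      congr 1
      rw [this, Nat.mod_add_mod, add_assoc, Nat.add_sub_cancel' (by omega), Nat.add_mod_right,
        Nat.mod_eq_of_lt hj]
  · rintro (rfl | rfl)
    · exact ⟨i, hi, Or.inl ⟨rfl, rfl⟩⟩
    · exact ⟨(i + (n - 1)) % n, Nat.mod_lt _ hn0, Or.inr ⟨by rw [hpred], rfl⟩⟩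

theorem pred_ne (hn : 3 ≤ n) (hP : IsSimplePolygon n P v) (i : ℕ) :
    v ((i + 1) % n) ≠ v ((i + (n - 1)) % n) := fun h => by
  have := add_mod_cancel (hP.2.2.1 _ (Nat.mod_lt _ (by omega)) _ (Nat.mod_lt _ (by omega)) h)
    (by omega) (by omega)
  omega

theorem adj_inter (hn : 3 ≤ n) (hP : IsSimplePolygon n P v) {α p q : Plane} (h1 : Adj n v α p)
    (h2 : Adj n v α q) (hpq : p ≠ q) : segment ℝ α p ∩ segment ℝ α q = {α} := by
  refine Subset.antisymm ?_ (singleton_subset_iff.2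
    ⟨left_mem_segment ℝ _ _, left_mem_segment ℝ _ _⟩)
  rintro x ⟨hx1, hx2⟩
  obtain ⟨i, hi, e1, s1, -⟩ := h1.segment_eq
  obtain ⟨j, hj, e2, s2, -⟩ := h2.segment_eq
  rw [s1] at hx1
  rw [s2] at hx2
  have hn0 : 0 < n := by omega
  have hm : ∀ k, (k + 1) % n < n := fun k => Nat.mod_lt _ hn0
  have inj := hP.2.2.1
  have hij : i ≠ j := by
    rintro rfl
    have hne := vertex_ne hn hP hi
    rcases e1 with ⟨a1, rfl⟩ | ⟨a1, rfl⟩ <;> rcases e2 with ⟨a2, rfl⟩ | ⟨a2, rfl⟩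
    · exact hpq rfl
    · exact hne (a1.symm.trans a2)
    · exact hne (a2.symm.trans a1)
    · exact hpq rfl
  have key : ∀ k l : ℕ, k < n → l < n → l = (k + 1) % n →
      (α = v k ∨ α = v ((k + 1) % n)) → (α = v l ∨ α = v ((l + 1) % n)) → α = v l := by
    intro k l hk hl hkl a1 a2
    rcases a2 with a2 | a2
    · exact a2
    rcases a1 with a1 | a1
    · have h := inj k hk _ (hm l) (a1.symm.trans a2)
      rw [hkl, Nat.mod_add_mod] at h
      have := add_mod_cancel (n := n) (i := k) (k := 0) (l := 1 + 1) (by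
        rw [← add_assoc, ← h, add_zero, Nat.mod_eq_of_lt hk]) hn0 (by omega)
      omega
    · rw [hkl]; exact a1
  have a1 : α = v i ∨ α = v ((i + 1) % n) := e1.imp And.left And.left
  have a2 : α = v j ∨ α = v ((j + 1) % n) := e2.imp And.left And.left
  rcases hP.eq_vertex hi hj hij hx1 hx2 with ⟨h, rfl⟩ | ⟨h, rfl⟩
  · exact (key i j hi hj h a1 a2).symm
  · exact (key j i hj hi h a2 a1).symm

open Classical in
/-- The region bounded by a simple polygon. -/
noncomputable def region (hn : 3 ≤ n) (hP : IsSimplePolygon n P v) : Region where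
  I := interior P
  F := frontier P
  Vs := (Finset.range n).image v
  E := Adj n v
  isOpen_I := isOpen_interior
  isClosed_P := by rw [hP.union_eq]; exact hP.1.isClosed
  disj := disjoint_interior_frontier
  preconn := hP.2.1.isPreconnected
  bdd := hP.1.isBounded.subset interior_subset
  sub_I := fun K hK hKF hKI => by
    refine hK.subset_left_of_subset_union isOpen_interior
      (isClosed_closure (s := P)).isOpen_compl ?_ (fun x hx => ?_) hKI
    · exact disjoint_left.2 fun x hx h => h (subset_closure (interior_subset hx))
    · by_cases h : x ∈ closure P
      · exact Or.inl (by_contra fun h' => disjoint_left.1 hKF hx ⟨h, h'⟩)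
      · exact Or.inr h
  not_nhds := fun x hx h => by
    rw [hP.union_eq] at h
    exact hx.2 (mem_interior_iff_mem_nhds.2 h)
  E_symm := by
    rintro p q ⟨i, hi, h | h⟩
    · exact ⟨i, hi, Or.inr h.symm⟩
    · exact ⟨i, hi, Or.inl h.symm⟩
  E_ne := by
    rintro p q ⟨i, hi, ⟨rfl, rfl⟩ | ⟨rfl, rfl⟩⟩
    · exact vertex_ne hn hP hi
    · exact (vertex_ne hn hP hi).symm
  E_left := by
    rintro p q ⟨i, hi, ⟨rfl, rfl⟩ | ⟨rfl, rfl⟩⟩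
    · exact Finset.mem_image_of_mem _ (Finset.mem_range.2 hi)
    · exact Finset.mem_image_of_mem _ (Finset.mem_range.2 (Nat.mod_lt _ (by omega)))
  seg_sub := fun p q h => by
    obtain ⟨i, hi, -, hs, -⟩ := h.segment_eq
    rw [hs]; exact hP.edge_sub hi
  cover := fun x hx => by
    obtain ⟨i, hi, h⟩ := hP.exists_edge hx
    exact ⟨_, _, ⟨i, hi, Or.inl ⟨rfl, rfl⟩⟩, h⟩
  uniq := fun p q p' q' x h h' hx hx' => by
    obtain ⟨i, hi, e, -, ho⟩ := h.segment_eq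
    obtain ⟨j, hj, e', hs, -⟩ := h'.segment_eq
    rw [ho] at hx
    rw [hs] at hx'
    obtain rfl := edge_unique hn hP hi hj hx hx'
    rcases e with ⟨rfl, rfl⟩ | ⟨rfl, rfl⟩ <;> rcases e' with ⟨rfl, rfl⟩ | ⟨rfl, rfl⟩ <;> simp
  nbrs := fun α hα => by
    obtain ⟨i, hi, rfl⟩ := Finset.mem_image.1 hα
    have hi := Finset.mem_range.1 hi
    exact ⟨_, _, pred_ne hn hP i, (adj_iff hn hP hi _).2 (Or.inl rfl),
      (adj_iff hn hP hi _).2 (Or.inr rfl), fun r hr => (adj_iff hn hP hi r).1 hr⟩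
  inter := fun α p q h1 h2 hpq => adj_inter hn hP h1 h2 hpq
  sep := fun a w f σ ha hE hσ hc h hh h0 h1 A B X K hAB hX hXAB hA hB hK hKs hAK hBK => by
    obtain ⟨i, hi, rfl⟩ := Finset.mem_image.1 ha
    have hi := Finset.mem_range.1 hi
    obtain ⟨j, hj, -, -, ho⟩ := hE.segment_eq
    rw [ho] at hσ
    rw [hP.union_eq] at hKs
    have hne : σ ≠ v i := by
      rintro rfl
      rw [openSegment_same] at hX
      rw [hX] at hXAB
      have hfr : v i ∈ frontier P := hP.edge_sub hi (left_mem_segment ℝ _ _)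
      exact disjoint_left.1 disjoint_interior_frontier (hAB hXAB) hfr
    have hd := dt_ne_zero_of_isAff hh hne h1 h0 hA.ne'
    rcases hd.lt_or_gt with hd | hd
    · obtain ⟨c, c0, hk⟩ := hh.proportional (isAff_dt σ (v i)).neg hne h1 h0
        (by simp [dt_self_left]) (by simp [dt_self_right]) hA (neg_pos.2 hd)
      have hB' : 0 < dt σ (v i) B := by
        have := hk B
        by_contra hn'
        linarith [mul_nonneg c0.le (neg_nonneg.2 (not_lt.1 hn'))]
      rw [segment_symm] at hAB hXAB
      exact chord_sep hn hP hi hj hσ hc hAB hX hXAB hB' hd hK hKs hBK hAK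
    · obtain ⟨c, c0, hk⟩ := hh.proportional (isAff_dt σ (v i)) hne h1 h0
        (dt_self_left ..) (dt_self_right ..) hA hd
      have hB' : dt σ (v i) B < 0 := by
        have := hk B
        by_contra hn'
        linarith [mul_nonneg c0.le (not_lt.1 hn')]
      exact chord_sep hn hP hi hj hσ hc hAB hX hXAB hd hB' hK hKs hAK hBK

theorem card_region (hn : 3 ≤ n) (hP : IsSimplePolygon n P v) : (region hn hP).Vs.card = n := by
  classical
  have : ((Finset.range n).image v).card = n := by
    rw [Finset.card_image_of_injOn, Finset.card_range]
    intro i hi j hj h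
    exact hP.2.2.1 i (Finset.mem_range.1 hi) j (Finset.mem_range.1 hj) h
  refine Eq.trans ?_ this
  unfold region
  congr!

end IsSimplePolygon

theorem Region.Reach.exists_path {D : Region} {s : Plane} (hs : s ∈ D.P) {k : ℕ} :
    ∀ {z : Plane}, D.Reach s k z → ∃ m ≤ k, ∃ p : ℕ → Plane, p 0 = s ∧ p m = z ∧
      (∀ i ≤ m, p i ∈ D.P) ∧ (∀ i, 0 < i → i < m → D.Reg (p i)) ∧
      ∀ i < m, D.Sees (p i) (p (i + 1)) := by
  have triv : ∃ p : ℕ → Plane, p 0 = s ∧ p 0 = s ∧ (∀ i ≤ 0, p i ∈ D.P) ∧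
      (∀ i, 0 < i → i < 0 → D.Reg (p i)) ∧ ∀ i < 0, D.Sees (p i) (p (i + 1)) :=
    ⟨fun _ => s, rfl, rfl, fun _ _ => hs, fun i h h' => by omega, fun i h => by omega⟩
  induction k with
  | zero =>
    rintro z rfl
    exact ⟨0, le_rfl, triv⟩
  | succ k ih =>
    rintro z (h | ⟨y, hy, hreg, hsee, hz⟩)
    · obtain ⟨m, hm, h⟩ := ih h
      exact ⟨m, by omega, h⟩
    have : ∃ m ≤ k, (m = 0 ∨ D.Reg y) ∧ ∃ p : ℕ → Plane, p 0 = s ∧ p m = y ∧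
        (∀ i ≤ m, p i ∈ D.P) ∧ (∀ i, 0 < i → i < m → D.Reg (p i)) ∧
        ∀ i < m, D.Sees (p i) (p (i + 1)) := by
      rcases hreg with rfl | hreg
      · exact ⟨0, by omega, Or.inl rfl, triv⟩
      · obtain ⟨m, hm, h⟩ := ih hy
        exact ⟨m, hm, Or.inr hreg, h⟩
    obtain ⟨m, hm, hreg, p, p0, pm, pP, pR, pS⟩ := this
    refine ⟨m + 1, by omega, fun i => if i ≤ m then p i else z, ?_, ?_, ?_, ?_, ?_⟩
    · simpa using p0
    · simp
    · intro i _
      by_cases h : i ≤ m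
      · simpa [h] using pP i h
      · simpa [h] using hz
    · intro i h0 h
      have h : i ≤ m := by omega
      simp only [if_pos h]
      rcases h.lt_or_eq with h | rfl
      · exact pR i h0 h
      · rw [pm]
        exact hreg.resolve_left (by omega)
    · intro i h
      have h : i ≤ m := by omega
      simp only [if_pos h]
      rcases h.lt_or_eq with h | rfl
      · simpa [Nat.succ_le_of_lt h] using pS i h
      · simpa [pm] using hsee

/-- **Corollary.** Between any two points `s, t` in the interior of a simple
polygon with `n ≥ 3` vertices there is a diffuse reflection path with at most
`⌊n/2⌋ - 1` reflections. -/
theorem exists_diffusePath (n : ℕ) (hn : 3 ≤ n) (P : Set Plane) (v : ℕ → Plane)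
    (hP : IsSimplePolygon n P v) (s t : Plane)
    (hs : s ∈ interior P) (ht : t ∈ interior P) :
    ∃ m, m - 1 ≤ n / 2 - 1 ∧ ∃ p : ℕ → Plane, IsDiffusePath n P v s t m p := by
  have hc := IsSimplePolygon.card_region hn hP
  obtain ⟨k, hk, hr⟩ := Region.exists_reach (D := hP.region hn) hs ht (by omega)
  rw [hc] at hk
  obtain ⟨m, hm, p, p0, pm, pP, pR, pS⟩ := hr.exists_path (Or.inl hs)
  refine ⟨m, by omega, p, p0, pm, fun i hi => ?_, fun i h0 hi => ?_, pS⟩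
  · rw [← hP.union_eq]
    exact pP i hi
  · obtain ⟨a, b, hE, h⟩ := pR i h0 hi
    obtain ⟨j, hj, -, -, ho⟩ := IsSimplePolygon.Adj.segment_eq hE
    exact ⟨j, hj, ho ▸ h⟩
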